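/- There exists an absolute constant C ≥ 200 such that for every m ≥ 1, every n ≥ C·m^{4.5}, and every b ∈ ℝ^m with ‖b⁻‖₂ ≤ n/10, if A ∈ ℝ^{m×n} and c ∈ ℝ^n have i.i.d. standard Gaussian N(0,1) entries, then for all real t with 1 ≤ t ≤ n/(C·m^{2.5}·(m + log n)²), the probability that IPGAP(A,b,c) ≥ C·t·m^{2.5}·(m + log n)²/n is at most 4·(1 − 1/25)^t + n^{−7}. -/

import Mathlib

open MeasureTheory ProbabilityTheory

/-- The value of the LP relaxation `max cᵀx, Ax ≤ b, x ∈ [0,1]ⁿ`. -/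
noncomputable def valLP {m n : ℕ} (A : Matrix (Fin m) (Fin n) ℝ) (b : Fin m → ℝ)
    (c : Fin n → ℝ) : ℝ :=
  sSup {v | ∃ x : Fin n → ℝ, (∀ i, x i ∈ Set.Icc (0 : ℝ) 1) ∧ (∀ j, A.mulVec x j ≤ b j) ∧
    v = ∑ i, c i * x i}

/-- The value of the binary IP `max cᵀx, Ax ≤ b, x ∈ {0,1}ⁿ`. -/
noncomputable def valIP {m n : ℕ} (A : Matrix (Fin m) (Fin n) ℝ) (b : Fin m → ℝ)
    (c : Fin n → ℝ) : ℝ :=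
  sSup {v | ∃ x : Fin n → ℝ, (∀ i, x i = 0 ∨ x i = 1) ∧ (∀ j, A.mulVec x j ≤ b j) ∧
    v = ∑ i, c i * x i}

/-- The integrality gap. -/
noncomputable def IPGAP {m n : ℕ} (A : Matrix (Fin m) (Fin n) ℝ) (b : Fin m → ℝ)
    (c : Fin n → ℝ) : ℝ :=
  valLP A b c - valIP A b c

namespace GapProof

/-- A column `(A_i, c_i)`. -/
abbrev Col (m : ℕ) := (Fin m → ℝ) × ℝ

/-- Standard Gaussian on the line. -/
noncomputable abbrev gm : Measure ℝ := gaussianReal 0 1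

/-- The standard Gaussian column law. -/
noncomputable abbrev colM (m : ℕ) : Measure (Col m) := (Measure.pi fun _ : Fin m => gm).prod gm

lemma charFunDual_gauss (v : NNReal) (L : StrongDual ℝ ℝ) :
    charFunDual (gaussianReal 0 v) L = Complex.exp (-((v * (L 1)^2 / 2 : ℝ) : ℂ)) := by
  rw [charFunDual_eq_charFun_map_one, gaussianReal_map_continuousLinearMap, charFun_gaussianReal]
  congr 1
  simp [Real.coe_toNNReal _ (sq_nonneg _)]
  ring

lemma charFunDual_pi_gauss {ι : Type*} [Fintype ι] [DecidableEq ι] (L : StrongDual ℝ (ι → ℝ)) :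
    charFunDual (Measure.pi fun _ : ι => gm) L
      = Complex.exp (-((∑ i, (L (Pi.single i 1))^2 / 2 : ℝ) : ℂ)) := by
  rw [charFunDual_pi]
  simp_rw [charFunDual_gauss]
  rw [← Complex.exp_sum]
  simp

/-- the transposition of a doubly indexed Gaussian family -/
lemma mp_uncurry {ι κ : Type*} [Fintype ι] [Fintype κ]  :
    MeasurePreserving (fun (g : ι × κ → ℝ) => fun i j => g (i, j))
      (Measure.pi fun _ : ι × κ => gm) (Measure.pi fun _ : ι => Measure.pi fun _ : κ => gm) := by
  refine ⟨by fun_prop, ?_⟩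
  have := Measure.infinitePi_map_curry (ι := ι) (κ := κ) (μ := fun _ _ => gm)
  simp only [Measure.infinitePi_eq_pi] at this
  exact this

lemma mp_swap {ι κ : Type*} [Fintype ι] [Fintype κ] :
    MeasurePreserving (fun (g : ι × κ → ℝ) => fun p : κ × ι => g (p.2, p.1))
      (Measure.pi fun _ : ι × κ => gm) (Measure.pi fun _ : κ × ι => gm) := by
  have := measurePreserving_piCongrLeft (α := fun _ : κ × ι => ℝ) (fun _ => gm) (Equiv.prodComm ι κ)
  convert this using 1
  funext g p
  simp [MeasurableEquiv.piCongrLeft, Equiv.piCongrLeft]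
  rfl

lemma mp_curry_symm {ι κ : Type*} [Fintype ι] [Fintype κ]  :
    MeasurePreserving (fun (g : ι → κ → ℝ) => fun p : ι × κ => g p.1 p.2)
      (Measure.pi fun _ : ι => Measure.pi fun _ : κ => gm) (Measure.pi fun _ : ι × κ => gm) := by
  refine ⟨by fun_prop, ?_⟩
  have := Measure.infinitePi_map_curry_symm (ι := ι) (κ := κ) (μ := fun _ _ => gm)
  simp only [Measure.infinitePi_eq_pi] at this
  exact this

lemma mp_transpose {ι κ : Type*} [Fintype ι] [Fintype κ] :
    MeasurePreserving (fun (g : ι → κ → ℝ) => fun j i => g i j)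
      (Measure.pi fun _ : ι => Measure.pi fun _ : κ => gm)
      (Measure.pi fun _ : κ => Measure.pi fun _ : ι => gm) :=
  (mp_uncurry (ι := κ) (κ := ι)).comp (mp_swap.comp mp_curry_symm)

/-- From the matrix and cost vector to the family of columns. -/
lemma mp_cols (m n : ℕ) :
    MeasurePreserving (fun (ω : (Fin m × Fin n → ℝ) × (Fin n → ℝ)) => fun j : Fin n =>
        ((fun i => ω.1 (i, j), ω.2 j) : Col m))
      ((Measure.pi fun _ : Fin m × Fin n => gm).prod (Measure.pi fun _ : Fin n => gm))
      (Measure.pi fun _ : Fin n => colM m) := by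
  have h1 : MeasurePreserving (fun (g : Fin m × Fin n → ℝ) => fun j i => g (i, j))
      (Measure.pi fun _ : Fin m × Fin n => gm)
      (Measure.pi fun _ : Fin n => Measure.pi fun _ : Fin m => gm) :=
    mp_uncurry.comp mp_swap
  have h2 := h1.prod (MeasurePreserving.id (Measure.pi fun _ : Fin n => gm))
  have h3 := (measurePreserving_arrowProdEquivProdArrow (Fin m → ℝ) ℝ (Fin n)
    (fun _ => Measure.pi fun _ => gm) (fun _ => gm)).symm
  exact h3.comp h2

lemma mp_comp_inj {ι κ X : Type*} [Fintype ι] [Fintype κ] [MeasurableSpace X] (μ : Measure X)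
    [IsProbabilityMeasure μ] (e : κ → ι) (he : Function.Injective e) :
    MeasurePreserving (fun (g : ι → X) => fun k => g (e k))
      (Measure.pi fun _ : ι => μ) (Measure.pi fun _ : κ => μ) := by
  refine ⟨by fun_prop, ?_⟩
  have h0 : iIndepFun (fun (i : ι) (g : ι → X) => g i) (Measure.pi fun _ : ι => μ) :=
    iIndepFun_pi (X := fun _ => id) (fun _ => aemeasurable_id)
  have h1 := h0.precomp he
  rw [iIndepFun_iff_map_fun_eq_pi_map (fun k => (measurable_pi_apply _).aemeasurable)] at h1
  refine h1.trans ?_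
  congr 1
  funext k
  exact (measurePreserving_eval (fun _ : ι => μ) (e k)).map_eq

/-- The Householder reflection adapted to a dual vector `u`. -/
noncomputable def rot {m : ℕ} (u : Fin m → ℝ) (z : Col m) : Col m :=
  let σ := Real.sqrt (1 + ∑ j, u j ^ 2)
  (fun j => z.1 j + (z.2 - (∑ k, z.1 k * u k) / (σ + 1)) * (u j / σ),
    (∑ k, z.1 k * u k) / σ - z.2 / σ)

lemma mp_rot {m : ℕ} (u : Fin m → ℝ) : MeasurePreserving (rot u) (colM m) (colM m) := by
  set σ := Real.sqrt (1 + ∑ j, u j ^ 2) with hσ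
  have hnn : 0 ≤ ∑ j, u j ^ 2 := Finset.sum_nonneg fun _ _ => sq_nonneg _
  have hσ2 : σ ^ 2 = 1 + ∑ j, u j ^ 2 := Real.sq_sqrt (by linarith)
  have hσ1 : 1 ≤ σ := by rw [hσ]; exact Real.one_le_sqrt.mpr (by linarith)
  let Rl : Col m →ₗ[ℝ] Col m :=
    { toFun := rot u
      map_add' := by
        intro x y
        ext j
        · simp [rot, add_mul, Finset.sum_add_distrib]; ring
        · simp [rot, add_mul, Finset.sum_add_distrib]; ring
      map_smul' := by
        intro c x
        ext j
        · simp [rot, mul_assoc, ← Finset.mul_sum]; ring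
        · simp [rot, mul_assoc, ← Finset.mul_sum]; ring }
  let R : Col m →L[ℝ] Col m := LinearMap.toContinuousLinearMap Rl
  have hR : ∀ z, R z = rot u z := fun z => rfl
  have hRm : Measurable (rot u) := R.continuous.measurable
  refine ⟨hRm, ?_⟩
  refine Measure.ext_of_charFunDual ?_
  ext L
  have : (colM m).map (rot u) = (colM m).map R := rfl
  rw [this, charFunDual_map, charFunDual_prod, charFunDual_prod, charFunDual_pi_gauss,
    charFunDual_pi_gauss, charFunDual_gauss, charFunDual_gauss, ← Complex.exp_add,
    ← Complex.exp_add]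
  congr 1
  norm_cast
  set w : Fin m → ℝ := fun j => L (Pi.single j 1, 0) with hw
  set d : ℝ := L (0, 1) with hd
  have hL : ∀ z : Col m, L z = ∑ j, z.1 j * w j + z.2 * d := by
    intro z
    have h1 : z = ∑ j, z.1 j • ((Pi.single j 1, 0) : Col m) + z.2 • ((0, 1) : Col m) := by
      ext k
      · simp [Prod.fst_sum, Finset.sum_apply, Pi.single_apply]
      · simp [Prod.snd_sum]
    conv_lhs => rw [h1]
    rw [map_add, map_sum, map_smul]
    simp only [map_smul, smul_eq_mul, hw, hd]
  have e1 : ∀ j, (L.comp (R.comp (ContinuousLinearMap.inl ℝ (Fin m → ℝ) ℝ))) (Pi.single j 1)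
      = w j + u j * (d / σ - (∑ k, u k * w k) / (σ * (σ + 1))) := by
    intro j
    simp only [ContinuousLinearMap.comp_apply, ContinuousLinearMap.inl_apply, hR, hL, rot]
    simp only [Pi.single_apply, ite_mul, one_mul, zero_mul, Finset.sum_ite_eq', Finset.mem_univ,
      if_true, add_mul, Finset.sum_add_distrib, ← hσ]
    have : ∀ x, (0 - u j / (σ + 1)) * (u x / σ) * w x = (u x * w x) * (-(u j / (σ + 1) / σ)) := by
      intro x; ring
    simp only [this, ← Finset.sum_mul]
    have : σ ≠ 0 := by positivity
    have : σ + 1 ≠ 0 := by positivity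
    field_simp
    ring
  have e2 : (L.comp (R.comp (ContinuousLinearMap.inr ℝ (Fin m → ℝ) ℝ))) 1
      = (∑ k, u k * w k) / σ - d / σ := by
    simp only [ContinuousLinearMap.comp_apply, ContinuousLinearMap.inr_apply, hR, hL, rot]
    simp only [Pi.zero_apply, zero_mul, Finset.sum_const_zero, zero_div, sub_zero, one_mul, zero_add,
      ← hσ]
    have : ∀ x, u x / σ * w x = (u x * w x) / σ := by intro x; ring
    simp only [this, ← Finset.sum_div]
    ring
  have e3 : ∀ j, (L.comp (ContinuousLinearMap.inl ℝ (Fin m → ℝ) ℝ)) (Pi.single j 1) = w j :=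
    fun j => rfl
  have e4 : (L.comp (ContinuousLinearMap.inr ℝ (Fin m → ℝ) ℝ)) 1 = d := rfl
  have e1' : ∀ j, ((L.comp R).comp (ContinuousLinearMap.inl ℝ (Fin m → ℝ) ℝ)) (Pi.single j 1)
      = w j + u j * (d / σ - (∑ k, u k * w k) / (σ * (σ + 1))) := e1
  have e2' : ((L.comp R).comp (ContinuousLinearMap.inr ℝ (Fin m → ℝ) ℝ)) 1
      = (∑ k, u k * w k) / σ - d / σ := e2
  simp only [e1', e2', e3, e4]
  set p := ∑ k, u k * w k with hp
  set τ := d / σ - p / (σ * (σ + 1)) with hτ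
  have e5 : ∑ j, (w j + u j * τ) ^ 2 / 2
      = ∑ j, w j ^ 2 / 2 + p * τ + (∑ j, u j ^ 2) * τ ^ 2 / 2 := by
    rw [hp, Finset.sum_mul, Finset.sum_mul, Finset.sum_div, ← Finset.sum_add_distrib,
      ← Finset.sum_add_distrib]
    exact Finset.sum_congr rfl fun j _ => by ring
  rw [e5]
  have e6 : ∑ j, u j ^ 2 = σ ^ 2 - 1 := by linarith
  rw [e6, hτ]
  have : σ ≠ 0 := by positivity
  have : σ + 1 ≠ 0 := by positivity
  push_cast
  field_simp
  ring

lemma rot_cost {m : ℕ} (u : Fin m → ℝ) (z : Col m) :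
    ∑ j, (rot u z).1 j * u j - (rot u z).2 = Real.sqrt (1 + ∑ j, u j ^ 2) * z.2 := by
  set σ := Real.sqrt (1 + ∑ j, u j ^ 2) with hσ
  have hnn : 0 ≤ ∑ j, u j ^ 2 := Finset.sum_nonneg fun _ _ => sq_nonneg _
  have hσ2 : σ ^ 2 = 1 + ∑ j, u j ^ 2 := Real.sq_sqrt (by linarith)
  have hσ1 : 1 ≤ σ := by rw [hσ]; exact Real.one_le_sqrt.mpr (by linarith)
  simp only [rot, ← hσ]
  set p := ∑ k, z.1 k * u k with hp
  have e5 : ∑ j, (z.1 j + (z.2 - p / (σ + 1)) * (u j / σ)) * u j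
      = p + (z.2 - p / (σ + 1)) / σ * (∑ j, u j ^ 2) := by
    rw [hp, Finset.mul_sum, ← Finset.sum_add_distrib]
    exact Finset.sum_congr rfl fun j _ => by ring
  have e6 : ∑ j, u j ^ 2 = σ ^ 2 - 1 := by linarith
  rw [e5, e6]
  have : σ ≠ 0 := by positivity
  have : σ + 1 ≠ 0 := by positivity
  field_simp
  ring

end GapProof

namespace GapProof

lemma law_sum {ι : Type*} [Fintype ι] [DecidableEq ι] (A : Finset ι) :
    (Measure.pi fun _ : ι => gm).map (fun g => ∑ i ∈ A, g i) = gaussianReal 0 (A.card : NNReal) := by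
  let R : (ι → ℝ) →L[ℝ] ℝ := ∑ i ∈ A, ContinuousLinearMap.proj i
  have hR : ∀ g, R g = ∑ i ∈ A, g i := fun g => by simp [R]
  have : (fun g : ι → ℝ => ∑ i ∈ A, g i) = R := by funext g; rw [hR]
  rw [this]
  refine Measure.ext_of_charFunDual ?_
  ext L
  rw [charFunDual_map, charFunDual_pi_gauss, charFunDual_gauss]
  congr 2
  norm_cast
  have : ∀ i, (L.comp R) (Pi.single i 1) = if i ∈ A then L 1 else 0 := by
    intro i
    simp only [ContinuousLinearMap.comp_apply, hR, Pi.single_apply, Finset.sum_ite_eq']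
    split_ifs <;> simp
  simp only [this]
  simp [ite_pow, ite_div, Finset.sum_ite_mem]
  ring

lemma law_sum3 {ι : Type*} [Fintype ι] [DecidableEq ι] (A B B' : Finset ι)
    (h1 : Disjoint A B) (h2 : Disjoint A B') (h3 : Disjoint B B') :
    (Measure.pi fun _ : ι => gm).map (fun g => (∑ i ∈ A, g i, ∑ i ∈ B, g i, ∑ i ∈ B', g i))
      = (gaussianReal 0 (A.card : NNReal)).prod
        ((gaussianReal 0 (B.card : NNReal)).prod (gaussianReal 0 (B'.card : NNReal))) := by
  let R0 : Finset ι → (ι → ℝ) →L[ℝ] ℝ := fun A => ∑ i ∈ A, ContinuousLinearMap.proj i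
  have hR0 : ∀ A g, R0 A g = ∑ i ∈ A, g i := fun A g => by simp [R0]
  let R : (ι → ℝ) →L[ℝ] ℝ × ℝ × ℝ := (R0 A).prod ((R0 B).prod (R0 B'))
  have hR : ∀ g, R g = (∑ i ∈ A, g i, ∑ i ∈ B, g i, ∑ i ∈ B', g i) := fun g => by
    simp [R, hR0]
  have : (fun g : ι → ℝ => (∑ i ∈ A, g i, ∑ i ∈ B, g i, ∑ i ∈ B', g i)) = R := by
    funext g; rw [hR]
  rw [this]
  refine Measure.ext_of_charFunDual ?_
  ext L
  rw [charFunDual_map, charFunDual_pi_gauss, charFunDual_prod, charFunDual_prod,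
    charFunDual_gauss, charFunDual_gauss, charFunDual_gauss, ← Complex.exp_add, ← Complex.exp_add]
  congr 1
  norm_cast
  set a := L (1, 0, 0) with ha
  set b := L (0, 1, 0) with hb
  set c := L (0, 0, 1) with hc
  have hL : ∀ x y z : ℝ, L (x, y, z) = x * a + y * b + z * c := by
    intro x y z
    have : ((x, y, z) : ℝ × ℝ × ℝ) = x • (1, 0, 0) + y • (0, 1, 0) + z • (0, 0, 1) := by simp
    rw [this, map_add, map_add, map_smul, map_smul, map_smul]; simp [ha, hb, hc]
  have e1 : ∀ i, (L.comp R) (Pi.single i 1)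
      = (if i ∈ A then 1 else 0) * a + (if i ∈ B then 1 else 0) * b
        + (if i ∈ B' then 1 else 0) * c := by
    intro i
    simp only [ContinuousLinearMap.comp_apply, hR, Pi.single_apply, Finset.sum_ite_eq', hL]
  have e2 : ∀ i, ((L.comp R) (Pi.single i 1)) ^ 2 / 2
      = (if i ∈ A then a ^ 2 / 2 else 0) + (if i ∈ B then b ^ 2 / 2 else 0)
        + (if i ∈ B' then c ^ 2 / 2 else 0) := by
    intro i
    rw [e1]
    have k1 : i ∈ A → i ∉ B := fun h => Finset.disjoint_left.mp h1 h
    have k2 : i ∈ A → i ∉ B' := fun h => Finset.disjoint_left.mp h2 h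
    have k3 : i ∈ B → i ∉ B' := fun h => Finset.disjoint_left.mp h3 h
    by_cases hA : i ∈ A
    · simp [hA, k1 hA, k2 hA]
    · by_cases hB : i ∈ B
      · simp [hA, hB, k3 hB]
      · by_cases hB' : i ∈ B' <;> simp [hA, hB, hB']
  simp only [e2, Finset.sum_add_distrib]
  have f1 : (L.comp (ContinuousLinearMap.inl ℝ ℝ (ℝ × ℝ))) 1 = a := rfl
  have f2 : ((L.comp (ContinuousLinearMap.inr ℝ ℝ (ℝ × ℝ))).comp
    (ContinuousLinearMap.inl ℝ ℝ ℝ)) 1 = b := rfl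
  have f3 : ((L.comp (ContinuousLinearMap.inr ℝ ℝ (ℝ × ℝ))).comp
    (ContinuousLinearMap.inr ℝ ℝ ℝ)) 1 = c := rfl
  rw [f1, f2, f3]
  simp [Finset.sum_ite_mem]
  ring

lemma gauss_lower (v : ℝ) (hv : 0 < v) (y δ : ℝ) (hδ : 0 < δ) :
    ENNReal.ofReal (2 * δ / Real.sqrt (2 * Real.pi * v) * Real.exp (-((y ^ 2 + δ ^ 2) / v)))
      ≤ gaussianReal 0 v.toNNReal (Set.Icc (y - δ) (y + δ)) := by
  have hv' : v.toNNReal ≠ 0 := by simpa using hv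
  rw [gaussianReal_apply 0 hv']
  have : ENNReal.ofReal (2 * δ / Real.sqrt (2 * Real.pi * v) * Real.exp (-((y ^ 2 + δ ^ 2) / v)))
      = ∫⁻ _ in Set.Icc (y - δ) (y + δ), ENNReal.ofReal
        ((Real.sqrt (2 * Real.pi * v))⁻¹ * Real.exp (-((y ^ 2 + δ ^ 2) / v))) := by
    rw [setLIntegral_const, Real.volume_Icc, ← ENNReal.ofReal_mul (by positivity)]
    congr 1
    ring
  rw [this]
  refine setLIntegral_mono' measurableSet_Icc fun x hx => ?_
  rw [gaussianPDF]
  apply ENNReal.ofReal_le_ofReal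
  rw [gaussianPDFReal, Real.coe_toNNReal _ hv.le]
  refine mul_le_mul_of_nonneg_left ?_ (by positivity)
  apply Real.exp_le_exp.mpr
  rw [neg_div]
  apply neg_le_neg
  rw [div_le_div_iff₀ (by positivity) hv]
  have : (x - 0) ^ 2 ≤ 2 * (y ^ 2 + δ ^ 2) := by
    have h1 : (x - y) ^ 2 ≤ δ ^ 2 := by
      apply sq_le_sq' <;> linarith [hx.1, hx.2]
    nlinarith [sq_nonneg (x - 2 * y)]
  nlinarith

lemma pdf_three (l r : ℝ) (hl : 0 < l) (hr : 0 < r) (z w w' : ℝ) :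
    gaussianPDFReal 0 l.toNNReal z * gaussianPDFReal z r.toNNReal w * gaussianPDFReal z r.toNNReal w'
      ≤ (1 / (2 * Real.pi * Real.sqrt (r * (2 * l + r)))) *
        gaussianPDFReal (l * (w + w') / (2 * l + r)) (l * r / (2 * l + r)).toNNReal z := by
  have hlr : 0 < 2 * l + r := by positivity
  have hv : 0 < l * r / (2 * l + r) := by positivity
  simp only [gaussianPDFReal, Real.coe_toNNReal _ hl.le, Real.coe_toNNReal _ hr.le,
    Real.coe_toNNReal _ hv.le]
  have hpi := Real.pi_pos
  have hc : (Real.sqrt (2 * Real.pi * l))⁻¹ * (Real.sqrt (2 * Real.pi * r))⁻¹ *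
      (Real.sqrt (2 * Real.pi * r))⁻¹ = (1 / (2 * Real.pi * Real.sqrt (r * (2 * l + r)))) *
        (Real.sqrt (2 * Real.pi * (l * r / (2 * l + r))))⁻¹ := by
    have e1 : (Real.sqrt (2 * Real.pi * r)) * (Real.sqrt (2 * Real.pi * r)) = 2 * Real.pi * r :=
      Real.mul_self_sqrt (by positivity)
    have e2 : Real.sqrt (r * (2 * l + r)) * Real.sqrt (2 * Real.pi * (l * r / (2 * l + r)))
        = r * Real.sqrt (2 * Real.pi * l) := by
      rw [← Real.sqrt_mul (by positivity)]
      have : r * (2 * l + r) * (2 * Real.pi * (l * r / (2 * l + r))) = r ^ 2 * (2 * Real.pi * l) := by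
        field_simp
      rw [this, Real.sqrt_mul (by positivity), Real.sqrt_sq hr.le]
    rw [mul_assoc, ← mul_inv, e1, one_div, ← mul_inv, ← mul_inv, mul_assoc (2 * Real.pi), e2]
    congr 1; ring
  calc _ = ((Real.sqrt (2 * Real.pi * l))⁻¹ * (Real.sqrt (2 * Real.pi * r))⁻¹ *
      (Real.sqrt (2 * Real.pi * r))⁻¹) * (Real.exp (-(z - 0) ^ 2 / (2 * l)) *
        Real.exp (-(w - z) ^ 2 / (2 * r)) * Real.exp (-(w' - z) ^ 2 / (2 * r))) := by ring
    _ ≤ _ := by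
      rw [hc, mul_assoc, mul_assoc, ← mul_assoc (1 / _)]
      rw [mul_assoc (1 / _)]
      refine mul_le_mul_of_nonneg_left ?_ (by positivity)
      refine mul_le_mul_of_nonneg_left ?_ (by positivity)
      rw [← Real.exp_add, ← Real.exp_add]
      apply Real.exp_le_exp.mpr
      rw [← sub_nonneg]
      have : -(z - l * (w + w') / (2 * l + r)) ^ 2 / (2 * (l * r / (2 * l + r))) -
          (-(z - 0) ^ 2 / (2 * l) + -(w - z) ^ 2 / (2 * r) + -(w' - z) ^ 2 / (2 * r))
          = (l * (w - w') ^ 2 + r * (w ^ 2 + w' ^ 2)) / (2 * r * (2 * l + r)) := by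
        field_simp
        ring
      rw [this]; positivity

lemma gauss_Icc_eq (r : NNReal) (hr : r ≠ 0) (z a b : ℝ) :
    gaussianReal 0 r {w | z + w ∈ Set.Icc a b} = ∫⁻ w in Set.Icc a b, gaussianPDF z r w := by
  have h := gaussianReal_map_const_add (μ := 0) (v := r) z
  rw [zero_add] at h
  rw [← gaussianReal_apply z hr, ← h, Measure.map_apply (by fun_prop) measurableSet_Icc]
  rfl

lemma meas_pdf_left (r : NNReal) (w : ℝ) : Measurable fun z : ℝ => gaussianPDF z r w :=
  measurable_uncurry_gaussianPDF.comp (by fun_prop : Measurable fun z : ℝ => (z, r, w))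

lemma joint_key (l r : ℕ) (hr : 0 < r) (w w' : ℝ) :
    ∫⁻ z, gaussianPDF z r w * gaussianPDF z r w' ∂(gaussianReal 0 (l : NNReal))
      ≤ ENNReal.ofReal (1 / (2 * Real.pi * Real.sqrt (r * (2 * l + r)))) := by
  have hr' : (r : NNReal) ≠ 0 := by positivity
  have hrR : (0:ℝ) < r := by positivity
  have hrc : (r : NNReal) = (r : ℝ).toNNReal := by simp
  have hm : Measurable (fun z => gaussianPDF z r w * gaussianPDF z r w') :=
    (meas_pdf_left r w).mul (meas_pdf_left r w')
  rcases Nat.eq_zero_or_pos l with rfl | hl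
  · simp only [Nat.cast_zero, gaussianReal_zero_var, mul_zero, zero_add]
    rw [lintegral_dirac' _ hm]
    rw [gaussianPDF, gaussianPDF, ← ENNReal.ofReal_mul (gaussianPDFReal_nonneg _ _ _)]
    apply ENNReal.ofReal_le_ofReal
    have hb : ∀ w, gaussianPDFReal 0 r w ≤ (Real.sqrt (2 * Real.pi * r))⁻¹ := by
      intro w
      rw [gaussianPDFReal]
      simp only [NNReal.coe_natCast]
      refine mul_le_of_le_one_right (by positivity) ?_
      apply Real.exp_le_one_iff.mpr
      rw [neg_div]; simp; positivity
    calc _ ≤ (Real.sqrt (2 * Real.pi * r))⁻¹ * (Real.sqrt (2 * Real.pi * r))⁻¹ :=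
          mul_le_mul (hb w) (hb w') (gaussianPDFReal_nonneg _ _ _) (by positivity)
      _ = _ := by
        rw [← mul_inv, Real.mul_self_sqrt (by positivity), one_div,
          Real.sqrt_mul_self hrR.le]
  · have hlR : (0:ℝ) < l := by positivity
    have hl' : (l : NNReal) ≠ 0 := by positivity
    have hlc : (l : NNReal) = (l : ℝ).toNNReal := by simp
    rw [gaussianReal_of_var_ne_zero _ hl', lintegral_withDensity_eq_lintegral_mul _
      (measurable_gaussianPDF _ _) hm]
    calc _ ≤ ∫⁻ z, ENNReal.ofReal (1 / (2 * Real.pi * Real.sqrt (r * (2 * l + r)))) *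
            gaussianPDF (l * (w + w') / (2 * l + r)) (l * r / (2 * l + r) : ℝ).toNNReal z := by
          refine lintegral_mono fun z => ?_
          simp only [Pi.mul_apply, gaussianPDF]
          rw [← ENNReal.ofReal_mul (gaussianPDFReal_nonneg _ _ _),
            ← ENNReal.ofReal_mul (gaussianPDFReal_nonneg _ _ _),
            ← ENNReal.ofReal_mul (by positivity), ← mul_assoc]
          apply ENNReal.ofReal_le_ofReal
          have := pdf_three l r hlR hrR z w w'
          rwa [← hlc, ← hrc] at this
      _ = _ := by
        rw [lintegral_const_mul _ (measurable_gaussianPDF _ _), lintegral_gaussianPDF_eq_one, mul_one]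
        have : 0 < (l * r / (2 * l + r) : ℝ) := by positivity
        simpa using this

lemma swap3 (μ : Measure ℝ) [SFinite μ] (F : ℝ → ℝ → ℝ → ENNReal)
    (hF : Measurable fun p : ℝ × ℝ × ℝ => F p.1 p.2.1 p.2.2) (S S' : Set ℝ) :
    ∫⁻ z, (∫⁻ w in S, ∫⁻ w' in S', F z w w') ∂μ = ∫⁻ w in S, ∫⁻ w' in S', (∫⁻ z, F z w w' ∂μ) := by
  have hA : Measurable (fun p : ℝ × ℝ => ∫⁻ w' in S', F p.1 p.2 w') :=
    Measurable.lintegral_prod_right' (ν := volume.restrict S')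
      (f := fun p : (ℝ × ℝ) × ℝ => F p.1.1 p.1.2 p.2)
      (hF.comp (by fun_prop : Measurable fun p : (ℝ × ℝ) × ℝ => (p.1.1, p.1.2, p.2)))
  have e1 := lintegral_lintegral_swap (μ := μ) (ν := volume.restrict S)
    (f := fun z w => ∫⁻ w' in S', F z w w') hA.aemeasurable
  rw [e1]
  refine lintegral_congr fun w => ?_
  exact lintegral_lintegral_swap (μ := μ) (ν := volume.restrict S')
    (f := fun z w' => F z w w')
    (hF.comp (by fun_prop : Measurable fun p : ℝ × ℝ => (p.1, w, p.2))).aemeasurable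

lemma meas_pdf3 (r : NNReal) :
    Measurable fun p : ℝ × ℝ × ℝ => gaussianPDF p.1 r p.2.1 * gaussianPDF p.1 r p.2.2 := by
  have h1 : Measurable fun p : ℝ × ℝ × ℝ => gaussianPDF p.1 r p.2.1 :=
    measurable_uncurry_gaussianPDF.comp
      (by fun_prop : Measurable fun p : ℝ × ℝ × ℝ => (p.1, r, p.2.1))
  have h2 : Measurable fun p : ℝ × ℝ × ℝ => gaussianPDF p.1 r p.2.2 :=
    measurable_uncurry_gaussianPDF.comp
      (by fun_prop : Measurable fun p : ℝ × ℝ × ℝ => (p.1, r, p.2.2))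
  exact h1.mul h2

lemma joint_swap (l r : ℕ) (S S' : Set ℝ) :
    ∫⁻ z, (∫⁻ w in S, ∫⁻ w' in S', gaussianPDF z r w * gaussianPDF z r w')
        ∂(gaussianReal 0 (l : NNReal))
    = ∫⁻ w in S, ∫⁻ w' in S', (∫⁻ z, gaussianPDF z r w * gaussianPDF z r w'
        ∂(gaussianReal 0 (l : NNReal))) :=
  swap3 (gaussianReal 0 (l : NNReal)) (fun z w w' => gaussianPDF z r w * gaussianPDF z r w')
    (meas_pdf3 r) S S'

lemma joint_upper (l r : ℕ) (hr : 0 < r) (a a' δ : ℝ) (hδ : 0 < δ) :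
    ((gaussianReal 0 (l : NNReal)).prod
        ((gaussianReal 0 (r : NNReal)).prod (gaussianReal 0 (r : NNReal))))
      {p | p.1 + p.2.1 ∈ Set.Icc (a - δ) (a + δ) ∧ p.1 + p.2.2 ∈ Set.Icc (a' - δ) (a' + δ)}
    ≤ ENNReal.ofReal ((2 * δ) ^ 2 / (2 * Real.pi * Real.sqrt (r * (2 * l + r)))) := by
  have hr' : (r : NNReal) ≠ 0 := by positivity
  have hms : MeasurableSet {p : ℝ × ℝ × ℝ | p.1 + p.2.1 ∈ Set.Icc (a - δ) (a + δ) ∧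
      p.1 + p.2.2 ∈ Set.Icc (a' - δ) (a' + δ)} := by
    apply MeasurableSet.inter
    · exact measurableSet_Icc.preimage (by fun_prop)
    · exact measurableSet_Icc.preimage (by fun_prop)
  rw [Measure.prod_apply hms]
  have hsec : ∀ z : ℝ, ((gaussianReal 0 (r : NNReal)).prod (gaussianReal 0 (r : NNReal)))
      (Prod.mk z ⁻¹' {p : ℝ × ℝ × ℝ | p.1 + p.2.1 ∈ Set.Icc (a - δ) (a + δ) ∧
      p.1 + p.2.2 ∈ Set.Icc (a' - δ) (a' + δ)})
      = ∫⁻ w in Set.Icc (a - δ) (a + δ), ∫⁻ w' in Set.Icc (a' - δ) (a' + δ),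
        gaussianPDF z r w * gaussianPDF z r w' := by
    intro z
    have : Prod.mk z ⁻¹' {p : ℝ × ℝ × ℝ | p.1 + p.2.1 ∈ Set.Icc (a - δ) (a + δ) ∧
      p.1 + p.2.2 ∈ Set.Icc (a' - δ) (a' + δ)} = {w | z + w ∈ Set.Icc (a - δ) (a + δ)} ×ˢ
        {w | z + w ∈ Set.Icc (a' - δ) (a' + δ)} := by ext; simp
    rw [this, Measure.prod_prod, gauss_Icc_eq _ hr', gauss_Icc_eq _ hr',
      ← lintegral_mul_const _ (measurable_gaussianPDF _ _)]
    refine lintegral_congr fun w => ?_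
    rw [lintegral_const_mul _ (measurable_gaussianPDF _ _)]
  rw [lintegral_congr hsec, joint_swap]
  calc _ ≤ ∫⁻ _ in Set.Icc (a - δ) (a + δ), ∫⁻ _ in Set.Icc (a' - δ) (a' + δ),
          ENNReal.ofReal (1 / (2 * Real.pi * Real.sqrt (r * (2 * l + r)))) :=
          lintegral_mono fun w => lintegral_mono fun w' => joint_key l r hr w w'
      _ = _ := by
        rw [setLIntegral_const, setLIntegral_const, Real.volume_Icc, Real.volume_Icc,
          ← ENNReal.ofReal_mul (by positivity), ← ENNReal.ofReal_mul
          (mul_nonneg (by positivity) (by linarith))]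
        congr 1
        ring

end GapProof

namespace GapProof

lemma second_moment {Ω ι : Type*} [MeasurableSpace Ω] [Fintype ι] (μ : Measure Ω)
    [IsProbabilityMeasure μ] (E : ι → Set Ω) (hE : ∀ i, MeasurableSet (E i)) :
    (∑ i, μ.real (E i)) ^ 2 ≤ (∑ i, ∑ j, μ.real (E i ∩ E j)) * μ.real (⋃ i, E i) := by
  set U := ⋃ i, E i with hU
  have hUm : MeasurableSet U := MeasurableSet.iUnion hE
  have key : ∀ x : ℝ, 0 ≤ (∑ i, ∑ j, μ.real (E i ∩ E j)) * (x * x)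
      + (-2 * ∑ i, μ.real (E i)) * x + μ.real U := by
    intro x
    have hi : ∀ S : Set Ω, MeasurableSet S → Integrable (S.indicator (fun _ => (1:ℝ))) μ :=
      fun S hS => (integrable_const (1:ℝ)).indicator hS
    have h0 : ∀ ω, (x * ∑ i, (E i).indicator (fun _ => (1:ℝ)) ω - U.indicator (fun _ => (1:ℝ)) ω) ^ 2
        = (x * x) * (∑ i, ∑ j, (E i ∩ E j).indicator (fun _ => (1:ℝ)) ω)
          + (-2 * x) * (∑ i, (E i).indicator (fun _ => (1:ℝ)) ω) + U.indicator (fun _ => (1:ℝ)) ω := by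
      intro ω
      have e1 : ∑ i, ∑ j, (E i ∩ E j).indicator (fun _ => (1:ℝ)) ω
          = (∑ i, (E i).indicator (fun _ => (1:ℝ)) ω) ^ 2 := by
        rw [sq, Finset.sum_mul_sum]
        refine Finset.sum_congr rfl fun i _ => Finset.sum_congr rfl fun j _ => ?_
        by_cases h1 : ω ∈ E i <;> by_cases h2 : ω ∈ E j <;> simp [Set.indicator, h1, h2]
      have e2 : U.indicator (fun _ => (1:ℝ)) ω * (∑ i, (E i).indicator (fun _ => (1:ℝ)) ω)
          = ∑ i, (E i).indicator (fun _ => (1:ℝ)) ω := by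
        rw [Finset.mul_sum]
        refine Finset.sum_congr rfl fun i _ => ?_
        by_cases h1 : ω ∈ E i
        · have : ω ∈ U := Set.mem_iUnion.mpr ⟨i, h1⟩
          simp [h1, this]
        · simp [h1]
      have e3 : U.indicator (fun _ => (1:ℝ)) ω ^ 2 = U.indicator (fun _ => (1:ℝ)) ω := by
        by_cases h1 : ω ∈ U <;> simp [h1]
      rw [e1]
      linear_combination e3 - 2 * x * e2
    have h1 : 0 ≤ ∫ ω, (x * ∑ i, (E i).indicator (fun _ => (1:ℝ)) ω
        - U.indicator (fun _ => (1:ℝ)) ω) ^ 2 ∂μ := integral_nonneg fun _ => sq_nonneg _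
    simp_rw [h0] at h1
    have i1 : Integrable (fun ω => ∑ i, ∑ j, (E i ∩ E j).indicator (fun _ => (1:ℝ)) ω) μ :=
      integrable_finsetSum _ fun i _ => integrable_finsetSum _ fun j _ =>
        hi _ ((hE i).inter (hE j))
    have i2 : Integrable (fun ω => ∑ i, (E i).indicator (fun _ => (1:ℝ)) ω) μ :=
      integrable_finsetSum _ fun i _ => hi _ (hE i)
    have i12 : Integrable (fun ω => x * x * (∑ i, ∑ j, (E i ∩ E j).indicator (fun _ => (1:ℝ)) ω)
        + (-2 * x) * (∑ i, (E i).indicator (fun _ => (1:ℝ)) ω)) μ :=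
      (i1.const_mul _).add (i2.const_mul _)
    rw [integral_add i12 (hi _ hUm),
      integral_add (i1.const_mul _) (i2.const_mul _), integral_const_mul, integral_const_mul,
      integral_finsetSum _ (fun i _ => integrable_finsetSum _ fun j _ =>
        hi _ ((hE i).inter (hE j))), integral_finsetSum _ (fun i _ => hi _ (hE i))] at h1
    simp_rw [integral_finsetSum Finset.univ (fun j _ => hi _ ((hE _).inter (hE j)))] at h1
    have i3 : ∀ S : Set Ω, MeasurableSet S → ∫ ω, S.indicator (fun _ => (1:ℝ)) ω ∂μ = μ.real S :=
      fun S hS => integral_indicator_one hS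
    rw [i3 U hUm] at h1
    simp_rw [i3 _ (hE _), i3 _ ((hE _).inter (hE _))] at h1
    linarith
  have := discrim_le_zero key
  rw [discrim] at this
  linarith

lemma F_base (s l : ℝ) (hs : 0 < s) (h : l ^ 2 / s ^ 2 ≤ 1 / 2) :
    s / Real.sqrt (s ^ 2 - l ^ 2) ≤ Real.exp (l ^ 2 / s ^ 2) := by
  set x := l ^ 2 / s ^ 2 with hx
  have hx0 : 0 ≤ x := by positivity
  have hl : l ^ 2 = x * s ^ 2 := by rw [hx]; field_simp
  have hpos : 0 < s ^ 2 - l ^ 2 := by rw [hl]; nlinarith [sq_pos_of_pos hs]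
  rw [div_le_iff₀ (Real.sqrt_pos.mpr hpos)]
  refine le_of_abs_le (abs_le_of_sq_le_sq ?_ (by positivity))
  rw [mul_pow, Real.sq_sqrt hpos.le, hl, ← Real.exp_nat_mul]
  have h1 := Real.add_one_le_exp ((2:ℕ) * x)
  push_cast at h1 ⊢
  have h2 : 1 ≤ Real.exp (2 * x) * (1 - x) := by nlinarith
  nlinarith [sq_pos_of_pos hs]

lemma F_bound (m s q l : ℕ) (hm : 1 ≤ m) (hms : m ≤ s) (hq : 256 * m ≤ q ^ 2)
    (hlog : m * Real.log s ≤ s) (hl : l < s) :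
    ((s:ℝ) / Real.sqrt ((s:ℝ) ^ 2 - (l:ℝ) ^ 2)) ^ m
      ≤ Real.exp (1 / 4) + Real.exp (2 * l - 8 * s / q) := by
  have hs : (0:ℝ) < s := by have : 0 < s := by omega
                            exact_mod_cast this
  have hmR : (1:ℝ) ≤ m := by exact_mod_cast hm
  have hmsR : (m:ℝ) ≤ s := by exact_mod_cast hms
  have hqR : 256 * (m:ℝ) ≤ (q:ℝ) ^ 2 := by exact_mod_cast hq
  have hlR : (l:ℝ) + 1 ≤ s := by exact_mod_cast hl
  have hl0 : (0:ℝ) ≤ l := by positivity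
  have hq0 : (0:ℝ) < q := by
    rcases Nat.eq_zero_or_pos q with h | h
    · subst h; simp at hqR; linarith
    · exact_mod_cast h
  have hpos : 0 < (s:ℝ) ^ 2 - (l:ℝ) ^ 2 := by nlinarith
  have hb0 : 0 ≤ (s:ℝ) / Real.sqrt ((s:ℝ) ^ 2 - (l:ℝ) ^ 2) := by positivity
  by_cases hc : (l:ℝ) ≤ 8 * s / q
  · have h1 : (l:ℝ) ^ 2 / s ^ 2 * m ≤ 1 / 4 := by
      rw [div_mul_eq_mul_div, div_le_iff₀ (by positivity)]
      have h2 : (l:ℝ) * q ≤ 8 * s := (le_div_iff₀ hq0).mp hc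
      have h3 : ((l:ℝ) * q) ^ 2 ≤ (8 * s) ^ 2 := pow_le_pow_left₀ (by positivity) h2 2
      nlinarith [mul_le_mul_of_nonneg_left hqR (sq_nonneg (l:ℝ))]
    have h2 : (l:ℝ) ^ 2 / s ^ 2 ≤ 1 / 2 := by
      have : 0 ≤ (l:ℝ) ^ 2 / s ^ 2 := by positivity
      nlinarith
    calc _ ≤ (Real.exp ((l:ℝ) ^ 2 / s ^ 2)) ^ m := pow_le_pow_left₀ hb0 (F_base _ _ hs h2) m
      _ = Real.exp ((l:ℝ) ^ 2 / s ^ 2 * m) := by rw [← Real.exp_nat_mul]; ring_nf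
      _ ≤ Real.exp (1 / 4) := Real.exp_le_exp.mpr h1
      _ ≤ _ := by linarith [Real.exp_pos (2 * (l:ℝ) - 8 * s / q)]
  · push Not at hc
    have hE : Real.exp (l:ℝ) ≤ Real.exp (2 * l - 8 * s / q) := Real.exp_le_exp.mpr (by linarith)
    have hF : ((s:ℝ) / Real.sqrt ((s:ℝ) ^ 2 - (l:ℝ) ^ 2)) ^ m ≤ Real.exp l := by
      by_cases h2 : (l:ℝ) ^ 2 / s ^ 2 ≤ 1 / 2
      · calc _ ≤ (Real.exp ((l:ℝ) ^ 2 / s ^ 2)) ^ m := pow_le_pow_left₀ hb0 (F_base _ _ hs h2) m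
          _ = Real.exp ((l:ℝ) ^ 2 / s ^ 2 * m) := by rw [← Real.exp_nat_mul]; ring_nf
          _ ≤ Real.exp l := by
            apply Real.exp_le_exp.mpr
            rw [div_mul_eq_mul_div, div_le_iff₀ (by positivity)]
            have : (l:ℝ) * m ≤ s * s := mul_le_mul (by linarith) hmsR (by positivity) hs.le
            nlinarith
      · push Not at h2
        rw [lt_div_iff₀ (by positivity)] at h2
        have h3 : (s:ℝ) / 2 ≤ l := by nlinarith
        have h4 : (s:ℝ) / Real.sqrt ((s:ℝ) ^ 2 - (l:ℝ) ^ 2) ≤ Real.sqrt s := by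
          rw [div_le_iff₀ (Real.sqrt_pos.mpr hpos), ← Real.sqrt_mul hs.le]
          apply Real.le_sqrt_of_sq_le
          have h5 : (s:ℝ) ≤ (s:ℝ) ^ 2 - (l:ℝ) ^ 2 := by nlinarith
          nlinarith
        calc _ ≤ (Real.sqrt s) ^ m := pow_le_pow_left₀ hb0 h4 m
          _ = Real.exp (m * Real.log s / 2) := by
            rw [← Real.exp_log (Real.sqrt_pos.mpr hs), ← Real.exp_nat_mul, Real.log_sqrt hs.le]
            ring_nf
          _ ≤ Real.exp l := Real.exp_le_exp.mpr (by linarith)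
    linarith [Real.exp_pos (1/4 : ℝ)]

end GapProof

namespace GapProof

/-- Overlap count. -/
def ovl {s q : ℕ} (f f' : Fin s → Fin q) : ℕ := (Finset.univ.filter fun i => f i = f' i).card

lemma ovl_lt {s q : ℕ} (f f' : Fin s → Fin q) (h : f ≠ f') : ovl f f' < s := by
  obtain ⟨i, hi⟩ := Function.ne_iff.mp h
  have : (Finset.univ.filter fun i => f i = f' i) ⊂ Finset.univ := by
    rw [Finset.filter_ssubset]; exact ⟨i, Finset.mem_univ _, hi⟩
  have := Finset.card_lt_card this
  simpa [ovl] using this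

lemma sum_ovl {s q : ℕ} (hq : 0 < q) (f : Fin s → Fin q) :
    ∑ f' : Fin s → Fin q, Real.exp (2 * (ovl f f' : ℝ)) ≤ (q:ℝ) ^ s * Real.exp (8 * s / q) := by
  have hqR : (0:ℝ) < q := by exact_mod_cast hq
  have h1 : ∀ f' : Fin s → Fin q, Real.exp (2 * (ovl f f' : ℝ))
      = ∏ i, (if f i = f' i then Real.exp 2 else 1) := by
    intro f'
    rw [Finset.prod_ite, Finset.prod_const, Finset.prod_const_one, mul_one, ← Real.exp_nat_mul, ovl]
    ring_nf
  simp_rw [h1]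
  have h2 := Finset.prod_univ_sum (fun _ : Fin s => (Finset.univ : Finset (Fin q)))
    (fun i v => if f i = v then Real.exp 2 else (1:ℝ))
  rw [Fintype.piFinset_univ] at h2
  rw [← h2]
  have h3 : ∀ i, ∑ v : Fin q, (if f i = v then Real.exp 2 else (1:ℝ)) = q + (Real.exp 2 - 1) := by
    intro i
    have : ∀ v : Fin q, (if f i = v then Real.exp 2 else (1:ℝ))
        = 1 + (if f i = v then Real.exp 2 - 1 else 0) := by intro v; split_ifs <;> ring
    simp_rw [this, Finset.sum_add_distrib]
    simp
  simp_rw [h3]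
  rw [Finset.prod_const, Finset.card_univ, Fintype.card_fin]
  have h4 : (q:ℝ) + (Real.exp 2 - 1) ≤ q * Real.exp (8 / q) := by
    have h5 := Real.add_one_le_exp (8 / (q:ℝ))
    have h6 : Real.exp 2 ≤ 9 := by
      have := Real.exp_one_lt_d9
      have e : Real.exp 2 = Real.exp 1 ^ 2 := by rw [← Real.exp_nat_mul]; norm_num
      rw [e]; nlinarith [Real.exp_pos 1]
    have h7 : (q:ℝ) * (8 / q + 1) = 8 + q := by field_simp
    nlinarith
  calc _ ≤ ((q:ℝ) * Real.exp (8 / q)) ^ s := pow_le_pow_left₀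
        (by have := Real.add_one_le_exp (2:ℝ); linarith) h4 s
    _ = _ := by rw [mul_pow, ← Real.exp_nat_mul]; ring_nf

/-- The selection event. -/
def selE {m s q : ℕ} (y : Fin m → ℝ) (δ : ℝ) (f : Fin s → Fin q) :
    Set (Fin m → Fin s × Fin q → ℝ) :=
  {g | ∀ j, ∑ i, g j (i, f i) ∈ Set.Icc (y j - δ) (y j + δ)}

lemma selE_eq {m s q : ℕ} (y : Fin m → ℝ) (δ : ℝ) (f : Fin s → Fin q) :
    selE y δ f = Set.univ.pi fun j => {h | ∑ i, h (i, f i) ∈ Set.Icc (y j - δ) (y j + δ)} := by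
  ext g; simp [selE]

lemma selE_meas {m s q : ℕ} (y : Fin m → ℝ) (δ : ℝ) (f : Fin s → Fin q) :
    MeasurableSet (selE y δ f) := by
  rw [selE_eq]
  exact MeasurableSet.univ_pi fun j => measurableSet_Icc.preimage (by fun_prop)

/-- Pool measure. -/
noncomputable abbrev poolM (m s q : ℕ) : Measure (Fin m → Fin s × Fin q → ℝ) :=
  Measure.pi fun _ : Fin m => Measure.pi fun _ : Fin s × Fin q => gm

lemma inj_graph {s q : ℕ} (f : Fin s → Fin q) : Function.Injective fun i => (i, f i) :=
  fun a b h => (Prod.mk.inj h).1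

lemma law_sel {s q : ℕ} (f : Fin s → Fin q) (S : Set ℝ) (hS : MeasurableSet S) :
    (Measure.pi fun _ : Fin s × Fin q => gm) {h | ∑ i, h (i, f i) ∈ S}
      = gaussianReal 0 (s : NNReal) S := by
  have := law_sum (Finset.univ.image fun i => (i, f i))
  rw [Finset.card_image_of_injective _ (inj_graph f), Finset.card_univ, Fintype.card_fin] at this
  rw [← this, Measure.map_apply (by fun_prop) hS]
  congr 1
  ext h
  simp only [Set.mem_ofPred_eq, Set.mem_preimage]
  rw [Finset.sum_image (fun a _ b _ h => inj_graph f h)]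

lemma sel_lower {m s q : ℕ} (hs : 0 < s) (y : Fin m → ℝ) (δ : ℝ) (hδ : 0 < δ)
    (hy : ∑ j, y j ^ 2 ≤ s) (hd : m * δ ^ 2 ≤ s) (f : Fin s → Fin q) :
    (2 * δ / Real.sqrt (2 * Real.pi * s)) ^ m * Real.exp (-2) ≤ (poolM m s q).real (selE y δ f) := by
  have hsR : (0:ℝ) < s := by exact_mod_cast hs
  have h1 : ENNReal.ofReal ((2 * δ / Real.sqrt (2 * Real.pi * s)) ^ m * Real.exp (-2))
      ≤ poolM m s q (selE y δ f) := by
    rw [selE_eq, Measure.pi_pi]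
    calc _ ≤ ENNReal.ofReal (∏ j, (2 * δ / Real.sqrt (2 * Real.pi * s) *
            Real.exp (-((y j ^ 2 + δ ^ 2) / s)))) := by
          apply ENNReal.ofReal_le_ofReal
          rw [Finset.prod_mul_distrib, Finset.prod_const, Finset.card_univ, Fintype.card_fin,
            ← Real.exp_sum]
          refine mul_le_mul_of_nonneg_left ?_ (by positivity)
          apply Real.exp_le_exp.mpr
          rw [Finset.sum_neg_distrib, ← Finset.sum_div, Finset.sum_add_distrib, Finset.sum_const,
            Finset.card_univ, Fintype.card_fin, nsmul_eq_mul]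
          apply neg_le_neg
          rw [div_le_iff₀ hsR]; linarith
      _ = ∏ j, ENNReal.ofReal (2 * δ / Real.sqrt (2 * Real.pi * s) *
            Real.exp (-((y j ^ 2 + δ ^ 2) / s))) :=
          ENNReal.ofReal_prod_of_nonneg fun j _ => by positivity
      _ ≤ _ := by
          refine Finset.prod_le_prod' fun j _ => ?_
          rw [law_sel f _ measurableSet_Icc]
          have := gauss_lower s hsR (y j) δ hδ
          simpa using this
  rw [Measure.real, ← ENNReal.ofReal_le_iff_le_toReal (measure_ne_top _ _)]
  exact h1

lemma sel_pair {m s q : ℕ} (y : Fin m → ℝ) (δ : ℝ) (hδ : 0 < δ)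
    (f f' : Fin s → Fin q) (hf : f ≠ f') :
    (poolM m s q).real (selE y δ f ∩ selE y δ f')
      ≤ ((2 * δ / Real.sqrt (2 * Real.pi * s)) ^ m) ^ 2 *
        ((s:ℝ) / Real.sqrt ((s:ℝ) ^ 2 - (ovl f f':ℝ) ^ 2)) ^ m := by
  have hl := ovl_lt f f' hf
  set l := ovl f f' with hldef
  have hlR : (l:ℝ) + 1 ≤ s := by exact_mod_cast hl
  have hl0 : (0:ℝ) ≤ l := by positivity
  have hsR : (0:ℝ) < s := by linarith
  have hpos : 0 < (s:ℝ) ^ 2 - (l:ℝ) ^ 2 := by nlinarith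
  set P := Finset.univ.filter fun i => f i = f' i with hP
  set Q := Finset.univ.filter fun i => ¬ f i = f' i with hQ
  have hPc : P.card = l := rfl
  have hQc : Q.card = s - l := by
    have := Finset.card_filter_add_card_filter_not (s := (Finset.univ : Finset (Fin s)))
      (fun i => f i = f' i)
    rw [Finset.card_univ, Fintype.card_fin] at this
    change P.card + Q.card = s at this
    omega
  have law := law_sum3 (P.image fun i => (i, f i)) (Q.image fun i => (i, f i))
    (Q.image fun i => (i, f' i))
    (by
      rw [Finset.disjoint_left]; intro a ha hb
      simp only [Finset.mem_image, hP, hQ, Finset.mem_filter, Finset.mem_univ, true_and] at ha hb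
      obtain ⟨i, hi, rfl⟩ := ha
      obtain ⟨k, hk, he⟩ := hb
      obtain rfl := (Prod.mk.inj he).1
      exact hk hi)
    (by
      rw [Finset.disjoint_left]; intro a ha hb
      simp only [Finset.mem_image, hP, hQ, Finset.mem_filter, Finset.mem_univ, true_and] at ha hb
      obtain ⟨i, hi, rfl⟩ := ha
      obtain ⟨k, hk, he⟩ := hb
      obtain rfl := (Prod.mk.inj he).1
      exact hk hi)
    (by
      rw [Finset.disjoint_left]; intro a ha hb
      simp only [Finset.mem_image, hQ, Finset.mem_filter, Finset.mem_univ, true_and] at ha hb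
      obtain ⟨i, hi, rfl⟩ := ha
      obtain ⟨k, hk, he⟩ := hb
      obtain ⟨rfl, h2⟩ := Prod.mk.inj he
      exact hi h2.symm)
  rw [Finset.card_image_of_injective _ (inj_graph f), Finset.card_image_of_injective _ (inj_graph f),
    Finset.card_image_of_injective _ (inj_graph f'), hPc, hQc] at law
  have hcast : ((s - l : ℕ) : ℝ) = s - l := by push_cast [hl.le]; ring
  have hone : ∀ j, (Measure.pi fun _ : Fin s × Fin q => gm)
      {h | ∑ i, h (i, f i) ∈ Set.Icc (y j - δ) (y j + δ) ∧
        ∑ i, h (i, f' i) ∈ Set.Icc (y j - δ) (y j + δ)}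
      ≤ ENNReal.ofReal ((2 * δ) ^ 2 / (2 * Real.pi * Real.sqrt ((s:ℝ) ^ 2 - (l:ℝ) ^ 2))) := by
    intro j
    have := joint_upper l (s - l) (by omega) (y j) (y j) δ hδ
    rw [hcast, show ((s:ℝ) - l) * (2 * l + (s - l)) = (s:ℝ) ^ 2 - (l:ℝ) ^ 2 by ring, ← law,
      Measure.map_apply (by fun_prop) (by
        apply MeasurableSet.inter
        · exact measurableSet_Icc.preimage (by fun_prop)
        · exact measurableSet_Icc.preimage (by fun_prop))] at this
    convert this using 2
    ext h
    simp only [Set.mem_ofPred_eq, Set.mem_preimage]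
    rw [Finset.sum_image (fun a _ b _ h => inj_graph f h),
      Finset.sum_image (fun a _ b _ h => inj_graph f h),
      Finset.sum_image (fun a _ b _ h => inj_graph f' h)]
    have e1 : ∑ i ∈ P, h (i, f i) + ∑ i ∈ Q, h (i, f i) = ∑ i, h (i, f i) :=
      Finset.sum_filter_add_sum_filter_not _ _ _
    have e2 : ∑ i ∈ P, h (i, f i) + ∑ i ∈ Q, h (i, f' i) = ∑ i, h (i, f' i) := by
      rw [← Finset.sum_filter_add_sum_filter_not (Finset.univ) (fun i => f i = f' i)
        (fun i => h (i, f' i))]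
      congr 1
      refine Finset.sum_congr rfl fun i hi => ?_
      rw [(Finset.mem_filter.mp hi).2]
    rw [e1, e2]
  have hset : selE y δ f ∩ selE y δ f' = Set.univ.pi fun j =>
      {h | ∑ i, h (i, f i) ∈ Set.Icc (y j - δ) (y j + δ) ∧
        ∑ i, h (i, f' i) ∈ Set.Icc (y j - δ) (y j + δ)} := by
    ext g; simp only [selE, Set.mem_inter_iff, Set.mem_ofPred_eq, Set.mem_pi, Set.mem_univ,
      forall_true_left, forall_and]
  have hfin : poolM m s q (selE y δ f ∩ selE y δ f') ≤ ENNReal.ofReal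
      (((2 * δ) ^ 2 / (2 * Real.pi * Real.sqrt ((s:ℝ) ^ 2 - (l:ℝ) ^ 2))) ^ m) := by
    rw [hset, Measure.pi_pi, ENNReal.ofReal_pow (by positivity)]
    calc _ ≤ ∏ _j : Fin m, ENNReal.ofReal
          ((2 * δ) ^ 2 / (2 * Real.pi * Real.sqrt ((s:ℝ) ^ 2 - (l:ℝ) ^ 2))) :=
          Finset.prod_le_prod' fun j _ => hone j
      _ = _ := by simp
  calc _ ≤ ((2 * δ) ^ 2 / (2 * Real.pi * Real.sqrt ((s:ℝ) ^ 2 - (l:ℝ) ^ 2))) ^ m :=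
        ENNReal.toReal_le_of_le_ofReal (by positivity) hfin
    _ = _ := by
      rw [← pow_mul, mul_comm m 2, pow_mul, ← mul_pow]
      congr 1
      rw [div_pow _ (Real.sqrt _), Real.sq_sqrt (by positivity)]
      field_simp

lemma pool (m s q : ℕ) (hm : 1 ≤ m) (hms : m ≤ s) (hq : 256 * m ≤ q ^ 2)
    (hlog : m * Real.log s ≤ s) (y : Fin m → ℝ) (δ : ℝ) (hδ : 0 < δ)
    (hy : ∑ j, y j ^ 2 ≤ s) (hd : m * δ ^ 2 ≤ s)
    (hbig : Real.exp 2 ≤ (q:ℝ) ^ s * (2 * δ / Real.sqrt (2 * Real.pi * s)) ^ m) :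
    1 / 1000 ≤ (poolM m s q).real (⋃ f : Fin s → Fin q, selE y δ f) := by
  set β := (2 * δ / Real.sqrt (2 * Real.pi * s)) ^ m with hβ
  have hs : 0 < s := by omega
  have hsR : (0:ℝ) < s := by exact_mod_cast hs
  have hβ0 : 0 < β := by positivity
  have hq0 : 0 < q := by
    rcases Nat.eq_zero_or_pos q with h | h
    · subst h; simp at hq; omega
    · exact h
  have hqR : (0:ℝ) < q := by exact_mod_cast hq0
  set N := ∑ f : Fin s → Fin q, (poolM m s q).real (selE y δ f) with hN
  have hcard : (Fintype.card (Fin s → Fin q) : ℝ) = (q:ℝ) ^ s := by simp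
  have hNl : (q:ℝ) ^ s * (β * Real.exp (-2)) ≤ N := by
    rw [← hcard, ← nsmul_eq_mul, ← Finset.card_univ, ← Finset.sum_const]
    exact Finset.sum_le_sum fun f _ => sel_lower hs y δ hδ hy hd f
  have hN1 : 1 ≤ N := by
    calc (1:ℝ) = Real.exp 2 * Real.exp (-2) := by rw [← Real.exp_add]; simp
      _ ≤ (q:ℝ) ^ s * β * Real.exp (-2) := mul_le_mul_of_nonneg_right hbig (Real.exp_pos _).le
      _ ≤ N := by linarith
  have hS : ∑ f, ∑ f', (poolM m s q).real (selE y δ f ∩ selE y δ f')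
      ≤ N + ((q:ℝ) ^ s) ^ 2 * β ^ 2 * (Real.exp (1 / 4) + 1) := by
    have h1 : ∀ f f' : Fin s → Fin q, (poolM m s q).real (selE y δ f ∩ selE y δ f')
        ≤ (if f = f' then (poolM m s q).real (selE y δ f) else 0) +
          (β ^ 2 * Real.exp (1 / 4) + β ^ 2 * Real.exp (-(8 * s / q)) * Real.exp (2 * ovl f f')) := by
      intro f f'
      split_ifs with h
      · subst h
        rw [Set.inter_self]
        have : 0 ≤ β ^ 2 * Real.exp (1 / 4) + β ^ 2 * Real.exp (-(8 * s / q)) * Real.exp (2 * ovl f f) := by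
          positivity
        linarith
      · rw [zero_add, mul_assoc, ← Real.exp_add, ← mul_add]
        refine (sel_pair y δ hδ f f' h).trans ?_
        refine mul_le_mul_of_nonneg_left ?_ (by positivity)
        have := F_bound m s q (ovl f f') hm hms hq hlog (ovl_lt f f' h)
        rwa [show -(8 * (s:ℝ) / q) + 2 * (ovl f f' : ℝ) = 2 * ovl f f' - 8 * s / q by ring]
    calc _ ≤ ∑ f : Fin s → Fin q, ((poolM m s q).real (selE y δ f) +
            ((q:ℝ) ^ s * β ^ 2 * (Real.exp (1 / 4) + 1))) := by
          refine Finset.sum_le_sum fun f _ => ?_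
          refine (Finset.sum_le_sum fun f' _ => h1 f f').trans ?_
          rw [Finset.sum_add_distrib, Finset.sum_ite_eq, if_pos (Finset.mem_univ _),
            Finset.sum_add_distrib, Finset.sum_const, ← Finset.mul_sum, Finset.card_univ,
            nsmul_eq_mul, hcard]
          have h2 := sum_ovl hq0 f
          have h3 : β ^ 2 * Real.exp (-(8 * s / q)) * ∑ f' : Fin s → Fin q, Real.exp (2 * (ovl f f' : ℝ))
              ≤ β ^ 2 * Real.exp (-(8 * s / q)) * ((q:ℝ) ^ s * Real.exp (8 * s / q)) :=
            mul_le_mul_of_nonneg_left h2 (by positivity)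
          have h4 : Real.exp (-(8 * s / q : ℝ)) * Real.exp (8 * s / q) = 1 := by
            rw [← Real.exp_add]; simp
          have h5 : β ^ 2 * Real.exp (-(8 * s / q)) * ((q:ℝ) ^ s * Real.exp (8 * s / q))
              = β ^ 2 * (q:ℝ) ^ s := by linear_combination (β ^ 2 * (q:ℝ) ^ s) * h4
          linarith
      _ = _ := by
        rw [Finset.sum_add_distrib, Finset.sum_const, Finset.card_univ, nsmul_eq_mul, hcard]
        ring
  have hsm := second_moment (poolM m s q) (fun f : Fin s → Fin q => selE y δ f)
    (fun f => selE_meas y δ f)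
  set P := (poolM m s q).real (⋃ f : Fin s → Fin q, selE y δ f) with hP
  have hP0 : 0 ≤ P := measureReal_nonneg
  have he4 : (q:ℝ) ^ s * β ≤ Real.exp 2 * N := by
    have : (q:ℝ) ^ s * β = Real.exp 2 * ((q:ℝ) ^ s * (β * Real.exp (-2))) := by
      have : Real.exp 2 * Real.exp (-2) = 1 := by rw [← Real.exp_add]; simp
      linear_combination (-(q:ℝ) ^ s * β) * this
    rw [this]
    exact mul_le_mul_of_nonneg_left hNl (Real.exp_pos _).le
  have he : Real.exp 2 ≤ 7.5 := by
    have := Real.exp_one_lt_d9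
    have e : Real.exp 2 = Real.exp 1 ^ 2 := by rw [← Real.exp_nat_mul]; norm_num
    rw [e]; nlinarith [Real.exp_pos 1]
  have he' : Real.exp (1 / 4) ≤ 3 := by
    have := Real.exp_one_lt_d9
    have : Real.exp (1 / 4) ≤ Real.exp 1 := Real.exp_le_exp.mpr (by norm_num)
    linarith
  have hqb : ((q:ℝ) ^ s) ^ 2 * β ^ 2 ≤ 60 * N ^ 2 := by
    have h8 : (q:ℝ) ^ s * β ≤ 7.5 * N := he4.trans (mul_le_mul_of_nonneg_right he (by linarith))
    have := pow_le_pow_left₀ (by positivity) h8 2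
    nlinarith
  have hS2 : ∑ f, ∑ f', (poolM m s q).real (selE y δ f ∩ selE y δ f') ≤ 1000 * N ^ 2 := by
    have : ((q:ℝ) ^ s) ^ 2 * β ^ 2 * (Real.exp (1 / 4) + 1) ≤ 60 * N ^ 2 * 4 :=
      mul_le_mul hqb (by linarith) (by positivity) (by positivity)
    nlinarith
  have h9 : N ^ 2 ≤ 1000 * N ^ 2 * P := hsm.trans (mul_le_mul_of_nonneg_right hS2 hP0)
  have hNp : 0 < N ^ 2 := by positivity
  rw [div_le_iff₀ (by norm_num)]
  by_contra hcon
  push Not at hcon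
  nlinarith
end GapProof

namespace GapProof

lemma lint_prod {ι X : Type*} [Fintype ι] [MeasurableSpace X] (μ : Measure X)
    [IsProbabilityMeasure μ] (h : X → ENNReal) (hh : Measurable h) :
    ∫⁻ x, ∏ i, h (x i) ∂(Measure.pi fun _ : ι => μ) = (∫⁻ x, h x ∂μ) ^ Fintype.card ι := by
  have h0 : iIndepFun (fun (i : ι) (g : ι → X) => h (g i)) (Measure.pi fun _ : ι => μ) :=
    iIndepFun_pi (X := fun _ => h) (fun _ => hh.aemeasurable)
  have := lintegral_prod_eq_prod_lintegral_of_indepFun Finset.univ _ h0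
    (fun i => hh.comp (measurable_pi_apply i))
  rw [this]
  have h1 : ∀ i : ι, ∫⁻ x, h (x i) ∂(Measure.pi fun _ : ι => μ) = ∫⁻ x, h x ∂μ := fun i =>
    (measurePreserving_eval (fun _ : ι => μ) i).lintegral_comp hh
  simp_rw [h1]
  simp

lemma prod_markov {ι X : Type*} [Fintype ι] [MeasurableSpace X] (μ : Measure X)
    [IsProbabilityMeasure μ] (h : X → ENNReal) (hh : Measurable h) (K : ENNReal)
    (S : Set (ι → X)) (hS : ∀ x ∈ S, 1 ≤ K * ∏ i, h (x i)) :
    (Measure.pi fun _ : ι => μ) S ≤ K * (∫⁻ x, h x ∂μ) ^ Fintype.card ι := by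
  have hm : Measurable fun x : ι → X => ∏ i, h (x i) :=
    Finset.measurable_fun_prod _ fun i _ => hh.comp (measurable_pi_apply i)
  have h1 := mul_meas_ge_le_lintegral (μ := Measure.pi fun _ : ι => μ) (hm.const_mul K) 1
  rw [one_mul, lintegral_const_mul _ hm, lint_prod μ h hh] at h1
  exact (measure_mono hS).trans h1

lemma chernoff {ι X : Type*} [Fintype ι] [MeasurableSpace X] (μ : Measure X)
    [IsProbabilityMeasure μ] (H P : Set X) [DecidablePred (· ∈ P)] (hH : MeasurableSet H) (hP : MeasurableSet P)
    (hPH : P ⊆ H) (l k : ℝ) (hl : 0 ≤ l) :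
    (Measure.pi fun _ : ι => μ) {x | (∀ i, x i ∈ H) ∧
        ((Finset.univ.filter fun i => x i ∈ P).card : ℝ) ≤ k}
      ≤ ENNReal.ofReal (Real.exp (l * k) *
        (μ.real H - (1 - Real.exp (-l)) * μ.real P) ^ Fintype.card ι) := by
  let h : X → ENNReal := fun x => (H \ P).indicator (fun _ => 1) x
    + P.indicator (fun _ => ENNReal.ofReal (Real.exp (-l))) x
  have hh : Measurable h := (measurable_const.indicator (hH.diff hP)).add
    (measurable_const.indicator hP)
  have hIntEq : ∫⁻ x, h x ∂μ = ENNReal.ofReal (μ.real H - (1 - Real.exp (-l)) * μ.real P) := by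
    rw [lintegral_add_left (measurable_const.indicator (hH.diff hP)), lintegral_indicator (hH.diff hP),
      lintegral_indicator hP, setLIntegral_const, setLIntegral_const, one_mul]
    have h1 : μ.real (H \ P) = μ.real H - μ.real P := measureReal_sdiff hPH hP
    rw [← ofReal_measureReal (μ := μ) (s := H \ P), ← ofReal_measureReal (μ := μ) (s := P), h1,
      ← ENNReal.ofReal_mul (Real.exp_pos _).le, ← ENNReal.ofReal_add
        (by rw [← h1]; exact measureReal_nonneg) (mul_nonneg (Real.exp_pos _).le measureReal_nonneg)]
    congr 1; ring
  have := prod_markov (ι := ι) μ h hh (ENNReal.ofReal (Real.exp (l * k)))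
    {x | (∀ i, x i ∈ H) ∧ ((Finset.univ.filter fun i => x i ∈ P).card : ℝ) ≤ k} (by
      rintro x ⟨hx, hk⟩
      have h2 : ∀ i, h (x i) = ENNReal.ofReal (if x i ∈ P then Real.exp (-l) else 1) := by
        intro i
        by_cases hp : x i ∈ P <;> simp [h, hp, hx i]
      simp_rw [h2]
      rw [← ENNReal.ofReal_prod_of_nonneg (fun i _ => by split_ifs <;> positivity),
        ← ENNReal.ofReal_mul (Real.exp_pos _).le, Finset.prod_ite, Finset.prod_const,
        Finset.prod_const_one, mul_one, ← Real.exp_nat_mul, ← Real.exp_add]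
      rw [ENNReal.one_le_ofReal]
      apply Real.one_le_exp
      nlinarith)
  refine this.trans ?_
  rw [hIntEq, ENNReal.ofReal_mul (Real.exp_pos _).le, ENNReal.ofReal_pow]
  have := measureReal_mono (μ := μ) hPH
  nlinarith [measureReal_nonneg (μ := μ) (s := P), Real.exp_pos (-l)]

lemma exp_sq_int : ∫⁻ x, ENNReal.ofReal (Real.exp (x ^ 2 / 4)) ∂gm = ENNReal.ofReal (Real.sqrt 2) := by
  rw [gm, gaussianReal_of_var_ne_zero _ one_ne_zero, lintegral_withDensity_eq_lintegral_mul _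
    (measurable_gaussianPDF _ _) (by fun_prop)]
  have h1 : ∀ x, (gaussianPDF 0 1 * fun x => ENNReal.ofReal (Real.exp (x ^ 2 / 4))) x
      = ENNReal.ofReal (Real.sqrt 2) * gaussianPDF 0 2 x := by
    intro x
    simp only [Pi.mul_apply, gaussianPDF]
    rw [← ENNReal.ofReal_mul (gaussianPDFReal_nonneg _ _ _), ← ENNReal.ofReal_mul (by positivity)]
    congr 1
    simp only [gaussianPDFReal, NNReal.coe_one, NNReal.coe_ofNat, sub_zero]
    have e : Real.exp (-x ^ 2 / (2 * 1)) * Real.exp (x ^ 2 / 4) = Real.exp (-x ^ 2 / (2 * 2)) := by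
      rw [← Real.exp_add]; congr 1; ring
    have e2 : Real.sqrt (2 * Real.pi * 2) = Real.sqrt (2 * Real.pi * 1) * Real.sqrt 2 := by
      rw [mul_one, Real.sqrt_mul (by positivity)]
    have : Real.sqrt 2 ≠ 0 := by positivity
    rw [mul_assoc, e, e2, mul_inv]
    field_simp
  rw [lintegral_congr h1, lintegral_const_mul _ (measurable_gaussianPDF _ _),
    lintegral_gaussianPDF_eq_one _ two_ne_zero, mul_one]

lemma chi2 {ι : Type*} [Fintype ι] (x : ℝ) :
    (Measure.pi fun _ : ι => gm) {g | x ≤ ∑ i, g i ^ 2}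
      ≤ ENNReal.ofReal (Real.exp (-(x / 4)) * (Real.sqrt 2) ^ Fintype.card ι) := by
  have := prod_markov (ι := ι) gm (fun x => ENNReal.ofReal (Real.exp (x ^ 2 / 4))) (by fun_prop)
    (ENNReal.ofReal (Real.exp (-(x / 4)))) {g | x ≤ ∑ i, g i ^ 2} (by
      intro g hg
      change x ≤ ∑ i, g i ^ 2 at hg
      rw [← ENNReal.ofReal_prod_of_nonneg (fun i _ => by positivity),
        ← ENNReal.ofReal_mul (Real.exp_pos _).le, ← Real.exp_sum, ← Real.exp_add,
        ENNReal.one_le_ofReal]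
      apply Real.one_le_exp
      rw [← Finset.sum_div]
      linarith)
  rw [exp_sq_int] at this
  rwa [ENNReal.ofReal_mul (Real.exp_pos _).le, ENNReal.ofReal_pow (by positivity)]

lemma gm_neg (S : Set ℝ) (hS : MeasurableSet S) : gm ((fun x => -x) ⁻¹' S) = gm S := by
  have h := gaussianReal_map_neg (μ := 0) (v := 1)
  rw [neg_zero] at h
  conv_rhs => rw [gm, ← h]
  rw [Measure.map_apply measurable_neg hS]

instance instNullGm : NullSingletonClass gm := nullSingletonClass_gaussianReal one_ne_zero

lemma gm_Ioi : gm.real (Set.Ioi 0) = 1 / 2 := by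
  have h1 : gm.real (Set.Iio 0) = gm.real (Set.Ioi 0) := by
    have := gm_neg (Set.Ioi 0) measurableSet_Ioi
    rw [Measure.real, Measure.real, ← this]
    congr 2
    ext x; simp
  have h2 : gm.real (Set.Iio 0) + gm.real (Set.Ici 0) = 1 := by
    have := prob_add_prob_compl (μ := gm) (s := Set.Iio 0) measurableSet_Iio
    rw [Set.compl_Iio] at this
    rw [Measure.real, Measure.real, ← ENNReal.toReal_add (measure_ne_top _ _) (measure_ne_top _ _),
      this]; simp
  have h3 : gm.real (Set.Ici 0) = gm.real (Set.Ioi 0) := by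
    rw [Measure.real, Measure.real, measure_congr Ioi_ae_eq_Ici]
  linarith

lemma gm_Ioc_lower (η : ℝ) (h0 : 0 ≤ η) (h1 : η ≤ 1) : η / 5 ≤ gm.real (Set.Ioc 0 η) := by
  have : ENNReal.ofReal (η / 5) ≤ gm (Set.Ioc 0 η) := by
    rw [gm, gaussianReal_apply 0 one_ne_zero]
    calc ENNReal.ofReal (η / 5) = ∫⁻ _ in Set.Ioc 0 η, ENNReal.ofReal (1 / 5) := by
          rw [setLIntegral_const, Real.volume_Ioc, ← ENNReal.ofReal_mul (by norm_num)]
          congr 1; ring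
      _ ≤ _ := by
        refine setLIntegral_mono' measurableSet_Ioc fun x hx => ?_
        rw [gaussianPDF]
        apply ENNReal.ofReal_le_ofReal
        simp only [gaussianPDFReal, NNReal.coe_one, sub_zero, mul_one]
        have hs : Real.sqrt (2 * Real.pi) ≤ 2.52 := by
          apply Real.sqrt_le_iff.mpr
          constructor
          · norm_num
          · have := Real.pi_lt_d2; norm_num at *; linarith
        have he : 0.6 ≤ Real.exp (-x ^ 2 / 2) := by
          have : (0.6:ℝ) ≤ Real.exp (-(1/2)) := by
            have h := Real.exp_one_lt_d9
            have e : Real.exp (-(1/2)) ^ 2 * Real.exp 1 = 1 := by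
              rw [← Real.exp_nat_mul, ← Real.exp_add]; norm_num
            by_contra hc
            push Not at hc
            have := Real.exp_pos (-(1/2))
            have h5 : Real.exp (-(1/2)) ^ 2 < 0.36 := by nlinarith
            nlinarith
          refine this.trans (Real.exp_le_exp.mpr ?_)
          nlinarith [hx.1, hx.2]
        have hs0 : 0 < Real.sqrt (2 * Real.pi) := by positivity
        rw [inv_mul_eq_div, le_div_iff₀ hs0]
        linarith
  rw [Measure.real, ← ENNReal.ofReal_le_iff_le_toReal (measure_ne_top _ _)]
  exact this

lemma gm_Ici : 3 / 10 ≤ gm.real (Set.Ici (1 / 2)) := by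
  have h1 : gm.real (Set.Ioo 0 (1/2)) ≤ 1 / 5 := by
    refine ENNReal.toReal_le_of_le_ofReal (by norm_num) ?_
    rw [gm, gaussianReal_apply 0 one_ne_zero]
    calc _ ≤ ∫⁻ _ in Set.Ioo (0:ℝ) (1/2), ENNReal.ofReal (2 / 5) := by
          refine setLIntegral_mono' measurableSet_Ioo fun x hx => ?_
          rw [gaussianPDF]
          apply ENNReal.ofReal_le_ofReal
          simp only [gaussianPDFReal, NNReal.coe_one, sub_zero, mul_one]
          have hs : 2.5 ≤ Real.sqrt (2 * Real.pi) := by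
            apply Real.le_sqrt_of_sq_le
            have := Real.pi_gt_d2; norm_num at *; linarith
          have he : Real.exp (-x ^ 2 / 2) ≤ 1 := Real.exp_le_one_iff.mpr (by nlinarith [sq_nonneg x])
          rw [inv_mul_eq_div, div_le_iff₀ (by linarith)]
          linarith
      _ = _ := by
        rw [setLIntegral_const, Real.volume_Ioo, ← ENNReal.ofReal_mul (by norm_num)]
        congr 1; norm_num
  have h2 : gm.real (Set.Ioi 0) ≤ gm.real (Set.Ioo 0 (1/2)) + gm.real (Set.Ici (1/2)) := by
    rw [← Set.Ioo_union_Ici_eq_Ioi (by norm_num : (0:ℝ) < 1/2)]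
    exact measureReal_union_le _ _
  rw [gm_Ioi] at h2
  linarith

lemma gm_Iic : 3 / 10 ≤ gm.real (Set.Iic (-(1 / 2))) := by
  have := gm_neg (Set.Ici (1/2)) measurableSet_Ici
  have h : (fun x : ℝ => -x) ⁻¹' (Set.Ici (1/2)) = Set.Iic (-(1/2)) := by
    ext x; simp only [Set.mem_preimage, Set.mem_Ici, Set.mem_Iic]; constructor <;> intro h <;> linarith
  rw [h] at this
  rw [Measure.real, this]
  exact gm_Ici

end GapProof

namespace GapProof

lemma mp_curryX {ι κ X : Type*} [Fintype ι] [Fintype κ] [MeasurableSpace X] (μ : Measure X)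
    [IsProbabilityMeasure μ] :
    MeasurePreserving (fun (g : ι × κ → X) => fun i j => g (i, j))
      (Measure.pi fun _ : ι × κ => μ) (Measure.pi fun _ : ι => Measure.pi fun _ : κ => μ) := by
  refine ⟨by fun_prop, ?_⟩
  have := Measure.infinitePi_map_curry (ι := ι) (κ := κ) (μ := fun _ _ => μ)
  simp only [Measure.infinitePi_eq_pi] at this
  exact this

/-- A good selection. -/
def goodSel {ι : Type*} {m : ℕ} (s : ℕ) (y : Fin m → ℝ) (δ η : ℝ) (S : Finset ι)
    (g : ι → Fin m → ℝ) (ρ : ι → ℝ) : Prop :=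
  S.card = s ∧ (∀ i ∈ S, ρ i ≤ η) ∧ ∀ j, |∑ i ∈ S, g i j - y j| ≤ δ

lemma goodSel_meas {ι Ω : Type*} [Fintype ι] [MeasurableSpace Ω] {m : ℕ} (s : ℕ)
    (y : Ω → Fin m → ℝ) (δ η : ℝ) (S : Finset ι)
    (g : Ω → ι → Fin m → ℝ) (ρ : Ω → ι → ℝ) (hy : Measurable y) (hg : Measurable g)
    (hρ : Measurable ρ) :
    MeasurableSet {ω | goodSel s (y ω) δ η S (g ω) (ρ ω)} := by
  unfold goodSel
  apply MeasurableSet.inter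
  · exact MeasurableSet.const _
  apply MeasurableSet.inter
  · have : {ω | ∀ i ∈ S, ρ ω i ≤ η} = ⋂ i ∈ S, {ω | ρ ω i ≤ η} := by ext; simp
    change MeasurableSet {ω | ∀ i ∈ S, ρ ω i ≤ η}
    rw [this]
    refine Finset.measurableSet_biInter _ fun i _ => measurableSet_le (by fun_prop) measurable_const
  · have : {ω | ∀ j, |∑ i ∈ S, g ω i j - y ω j| ≤ δ} = ⋂ j, {ω | |∑ i ∈ S, g ω i j - y ω j| ≤ δ} := by
      ext; simp
    change MeasurableSet {ω | ∀ j, |∑ i ∈ S, g ω i j - y ω j| ≤ δ}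
    rw [this]
    refine MeasurableSet.iInter fun j => measurableSet_le ?_ measurable_const
    have : Measurable fun ω => ∑ i ∈ S, g ω i j - y ω j := by fun_prop
    exact this.abs

/-- No good selection. -/
def noSel {ι : Type*} {m : ℕ} (s : ℕ) (y : Fin m → ℝ) (δ η : ℝ) : Set (ι → Col m) :=
  {z | (∀ i, 0 < (z i).2) ∧ ∀ S : Finset ι,
    ¬ goodSel s y δ η S (fun i => (z i).1) (fun i => (z i).2)}

lemma pool_many {ι : Type*} [Fintype ι] {m s q T : ℕ} (y : Fin m → ℝ) (δ η p : ℝ) (ρ : ι → ℝ)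
    (hp : p ≤ (poolM m s q).real (⋃ f : Fin s → Fin q, selE y δ f)) (hp0 : 0 ≤ p) (hp1 : p ≤ 1)
    (e : Fin T × (Fin s × Fin q) → ι) (he : Function.Injective e) (hρ : ∀ k, ρ (e k) ≤ η) :
    (Measure.pi fun _ : ι => Measure.pi fun _ : Fin m => gm)
      {g | ∀ S : Finset ι, ¬ goodSel s y δ η S g ρ} ≤ ENNReal.ofReal ((1 - p) ^ T) := by
  classical
  have m1 := mp_comp_inj (Measure.pi fun _ : Fin m => gm) e he
  have m2 := mp_curryX (ι := Fin T) (κ := Fin s × Fin q) (Measure.pi fun _ : Fin m => gm)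
  have m3 := measurePreserving_pi (fun _ : Fin T => Measure.pi fun _ : Fin s × Fin q =>
    Measure.pi fun _ : Fin m => gm) (fun _ => poolM m s q)
    (fun _ => mp_transpose (ι := Fin s × Fin q) (κ := Fin m))
  have m4 := m3.comp (m2.comp m1)
  set U := ⋃ f : Fin s → Fin q, selE y δ f with hU
  have hUm : MeasurableSet U := MeasurableSet.iUnion fun f => selE_meas y δ f
  have hsub : {g : ι → Fin m → ℝ | ∀ S : Finset ι, ¬ goodSel s y δ η S g ρ} ⊆
      (fun g : ι → Fin m → ℝ => fun (τ : Fin T) (j : Fin m) (p : Fin s × Fin q) => g (e (τ, p)) j) ⁻¹'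
        (Set.univ.pi fun _ : Fin T => Uᶜ) := by
    intro g hg
    simp only [Set.mem_preimage, Set.mem_pi, Set.mem_univ, forall_true_left]
    intro τ hτ
    obtain ⟨f, hf⟩ := Set.mem_iUnion.mp hτ
    have hinj : Function.Injective fun i : Fin s => e (τ, (i, f i)) := by
      intro a b hab
      have := he hab
      simp only [Prod.mk.injEq, true_and] at this
      exact this.1
    refine hg (Finset.univ.image fun i : Fin s => e (τ, (i, f i))) ⟨?_, ?_, ?_⟩
    · rw [Finset.card_image_of_injective _ hinj]; simp
    · intro i hi
      obtain ⟨k, _, rfl⟩ := Finset.mem_image.mp hi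
      exact hρ _
    · intro j
      rw [Finset.sum_image (fun a _ b _ h => hinj h)]
      have := hf j
      rw [abs_le]
      constructor <;> linarith [this.1, this.2]
  refine (measure_mono hsub).trans ?_
  have hmeas : MeasurableSet (Set.univ.pi fun _ : Fin T => Uᶜ) :=
    MeasurableSet.univ_pi fun _ => hUm.compl
  have h5 := m4.measure_preimage hmeas.nullMeasurableSet
  refine (le_of_eq h5).trans ?_
  rw [Measure.pi_pi, ENNReal.ofReal_pow (by linarith)]
  simp only [Finset.prod_const, Finset.card_univ, Fintype.card_fin]
  refine pow_le_pow_left' ?_ T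
  rw [prob_compl_eq_one_sub hUm, ENNReal.ofReal_sub _ hp0, ENNReal.ofReal_one]
  refine tsub_le_tsub_left ?_ _
  rw [ENNReal.ofReal_le_iff_le_toReal (measure_ne_top _ _)]
  exact hp

lemma cond_bound {ι : Type*} [Fintype ι] {m s q T : ℕ} (y : Fin m → ℝ) (δ η p : ℝ)
    (hη0 : 0 ≤ η) (hη1 : η ≤ 1)
    (hp : p ≤ (poolM m s q).real (⋃ f : Fin s → Fin q, selE y δ f)) (hp0 : 0 ≤ p) (hp1 : p ≤ 1) :
    (Measure.pi fun _ : ι => colM m) (noSel s y δ η)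
      ≤ ENNReal.ofReal ((1 / 2) ^ Fintype.card ι *
        ((1 - p) ^ T + Real.exp (T * (s * q) - η * Fintype.card ι / 4))) := by
  classical
  have mp := measurePreserving_arrowProdEquivProdArrow (Fin m → ℝ) ℝ ι
    (fun _ => Measure.pi fun _ : Fin m => gm) (fun _ => gm)
  let B : Set ((ι → Fin m → ℝ) × (ι → ℝ)) := {z | (∀ i, 0 < z.2 i) ∧ ∀ S : Finset ι,
    ¬ goodSel s y δ η S z.1 z.2}
  have hBm : MeasurableSet B := by
    apply MeasurableSet.inter
    · have : {z : (ι → Fin m → ℝ) × (ι → ℝ) | ∀ i, 0 < z.2 i} = ⋂ i, {z | 0 < z.2 i} := by ext; simp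
      change MeasurableSet {z : (ι → Fin m → ℝ) × (ι → ℝ) | ∀ i, 0 < z.2 i}
      rw [this]
      exact MeasurableSet.iInter fun i => measurableSet_lt measurable_const (by fun_prop)
    · have : {z : (ι → Fin m → ℝ) × (ι → ℝ) | ∀ S : Finset ι, ¬ goodSel s y δ η S z.1 z.2}
          = ⋂ S : Finset ι, {z | goodSel s y δ η S z.1 z.2}ᶜ := by ext; simp
      change MeasurableSet {z : (ι → Fin m → ℝ) × (ι → ℝ) | ∀ S : Finset ι, ¬ goodSel s y δ η S z.1 z.2}
      rw [this]
      exact MeasurableSet.iInter fun S => (goodSel_meas s (fun _ => y) δ η S _ _ measurable_const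
        measurable_fst measurable_snd).compl
  have h1 : (Measure.pi fun _ : ι => colM m) (noSel s y δ η)
      = ((Measure.pi fun _ : ι => Measure.pi fun _ : Fin m => gm).prod
        (Measure.pi fun _ : ι => gm)) B := by
    rw [← mp.measure_preimage hBm.nullMeasurableSet]
    rfl
  rw [h1, Measure.prod_apply_symm hBm]
  let A1 : Set (ι → ℝ) := {ρ | ∀ i, ρ i ∈ Set.Ioi (0:ℝ)}
  let A2 : Set (ι → ℝ) := {ρ | (∀ i, ρ i ∈ Set.Ioi (0:ℝ)) ∧
    ((Finset.univ.filter fun i => ρ i ∈ Set.Ioc 0 η).card : ℝ) ≤ T * (s * q)}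
  have hsec : ∀ ρ : ι → ℝ, (Measure.pi fun _ : ι => Measure.pi fun _ : Fin m => gm)
      ((fun g => (g, ρ)) ⁻¹' B) ≤ A1.indicator (fun _ => ENNReal.ofReal ((1 - p) ^ T)) ρ
        + A2.indicator (fun _ => 1) ρ := by
    intro ρ
    by_cases hρ : ∀ i, 0 < ρ i
    · have hA1 : ρ ∈ A1 := hρ
      by_cases hA2 : ρ ∈ A2
      · rw [Set.indicator_of_mem hA2]
        exact prob_le_one.trans le_add_self
      · rw [Set.indicator_of_mem hA1, Set.indicator_of_notMem hA2, add_zero]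
        have hcard : T * (s * q) ≤ (Finset.univ.filter fun i => ρ i ∈ Set.Ioc 0 η).card := by
          by_contra hc
          push Not at hc
          apply hA2
          refine ⟨hρ, ?_⟩
          have : ((Finset.univ.filter fun i => ρ i ∈ Set.Ioc 0 η).card : ℝ) ≤ ((T * (s * q) : ℕ) : ℝ) :=
            by exact_mod_cast hc.le
          push_cast at this
          exact this
        have : Nonempty ((Fin T × (Fin s × Fin q)) ↪ {i // i ∈ Finset.univ.filter fun i => ρ i ∈ Set.Ioc 0 η}) := by
          apply Function.Embedding.nonempty_of_card_le
          rw [Fintype.card_coe]; simpa using hcard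
        obtain ⟨e⟩ := this
        have h2 := pool_many (T := T) y δ η p ρ hp hp0 hp1 (fun k => (e k : ι))
          (Subtype.val_injective.comp e.injective)
          (fun k => ((Finset.mem_filter.mp (e k).2).2).2)
        refine (measure_mono ?_).trans h2
        intro g hg
        exact hg.2
    · have : (fun g : ι → Fin m → ℝ => (g, ρ)) ⁻¹' B = ∅ := by
        ext g
        simp only [Set.mem_preimage, Set.mem_empty_iff_false, iff_false]
        exact fun h => hρ h.1
      rw [this]; simp
  have hA1m : MeasurableSet A1 := by
    have : A1 = Set.univ.pi fun _ : ι => Set.Ioi (0:ℝ) := by ext; simp [A1]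
    rw [this]; exact MeasurableSet.univ_pi fun _ => measurableSet_Ioi
  have hA1 : (Measure.pi fun _ : ι => gm) A1 = ENNReal.ofReal ((1/2) ^ Fintype.card ι) := by
    have : A1 = Set.univ.pi fun _ : ι => Set.Ioi (0:ℝ) := by ext; simp [A1]
    rw [this, Measure.pi_pi, Finset.prod_const, Finset.card_univ, ENNReal.ofReal_pow (by norm_num),
      ← gm_Ioi, ofReal_measureReal]
  have hA2 : (Measure.pi fun _ : ι => gm) A2 ≤ ENNReal.ofReal ((1 / 2) ^ Fintype.card ι *
      Real.exp (T * (s * q) - η * Fintype.card ι / 4)) := by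
    refine (chernoff gm (Set.Ioi 0) (Set.Ioc 0 η) measurableSet_Ioi measurableSet_Ioc
      (fun x hx => hx.1) 1 (T * (s * q)) zero_le_one).trans ?_
    apply ENNReal.ofReal_le_ofReal
    have hE : Real.exp (-1) ≤ 3 / 8 := by
      have h := Real.exp_one_gt_d9
      have e : Real.exp (-1) * Real.exp 1 = 1 := by rw [← Real.exp_add]; simp
      nlinarith [Real.exp_pos (-1)]
    have h3 := gm_Ioc_lower η hη0 hη1
    have h4 : gm.real (Set.Ioi 0) - (1 - Real.exp (-1)) * gm.real (Set.Ioc 0 η)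
        ≤ 1 / 2 * Real.exp (-(η / 4)) := by
      rw [gm_Ioi]
      have h6 : 5 / 8 * (η / 5) ≤ (1 - Real.exp (-1)) * gm.real (Set.Ioc 0 η) :=
        mul_le_mul (by linarith) h3 (by positivity) (by linarith)
      have := Real.add_one_le_exp (-(η / 4))
      linarith
    have h5 : 0 ≤ gm.real (Set.Ioi 0) - (1 - Real.exp (-1)) * gm.real (Set.Ioc 0 η) := by
      have : gm.real (Set.Ioc 0 η) ≤ gm.real (Set.Ioi 0) := measureReal_mono fun x hx => hx.1
      nlinarith [Real.exp_pos (-1), measureReal_nonneg (μ := gm) (s := Set.Ioc 0 η)]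
    calc _ ≤ Real.exp (1 * (T * (s * q))) * (1 / 2 * Real.exp (-(η / 4))) ^ Fintype.card ι :=
          mul_le_mul_of_nonneg_left (pow_le_pow_left₀ h5 h4 _) (Real.exp_pos _).le
      _ = _ := by
        rw [mul_pow, ← Real.exp_nat_mul, mul_left_comm, ← Real.exp_add]
        congr 2
        ring
  calc _ ≤ ∫⁻ ρ, (A1.indicator (fun _ => ENNReal.ofReal ((1 - p) ^ T)) ρ
        + A2.indicator (fun _ => 1) ρ) ∂(Measure.pi fun _ : ι => gm) := lintegral_mono hsec
    _ = ∫⁻ ρ, A1.indicator (fun _ => ENNReal.ofReal ((1 - p) ^ T)) ρ ∂(Measure.pi fun _ : ι => gm)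
        + ∫⁻ ρ, A2.indicator (fun _ => 1) ρ ∂(Measure.pi fun _ : ι => gm) :=
        lintegral_add_left (measurable_const.indicator hA1m) _
    _ ≤ ENNReal.ofReal ((1 - p) ^ T) * (Measure.pi fun _ : ι => gm) A1
        + (Measure.pi fun _ : ι => gm) A2 := by
        gcongr
        · rw [lintegral_indicator hA1m, setLIntegral_const]
        · refine (lintegral_indicator_le _ _).trans ?_
          rw [setLIntegral_const, one_mul]
    _ ≤ ENNReal.ofReal ((1 - p) ^ T) * ENNReal.ofReal ((1/2) ^ Fintype.card ι)
        + ENNReal.ofReal ((1 / 2) ^ Fintype.card ι *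
      Real.exp (T * (s * q) - η * Fintype.card ι / 4)) := by rw [hA1]; gcongr
    _ = _ := by
      have : 0 ≤ (1 - p) ^ T := pow_nonneg (by linarith) _
      rw [← ENNReal.ofReal_mul this, ← ENNReal.ofReal_add (by positivity) (by positivity)]
      congr 1; ring

end GapProof

namespace GapProof

/-- Reduced cost. -/
def rc {m : ℕ} (z : Col m) (u : Fin m → ℝ) : ℝ := z.2 - ∑ j, z.1 j * u j

/-- Dual vector attached to a primal point. -/
noncomputable def pp {ι : Type*} [Fintype ι] {m : ℕ} (b : Fin m → ℝ) (w : ι → Col m) (x : ι → ℝ) :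
    Fin m → ℝ := fun j => max 0 (∑ i, (w i).1 j * x i - b j)

/-- Optimality conditions of the penalised problem. -/
def IsSol {ι : Type*} [Fintype ι] {m : ℕ} (b : Fin m → ℝ) (w : ι → Col m) (x : ι → ℝ) : Prop :=
  ∀ i, 0 ≤ x i ∧ x i ≤ 1 ∧ rc (w i) (pp b w x) * (1 - x i) ≤ 0 ∧ 0 ≤ rc (w i) (pp b w x) * x i

lemma half_sq (p d : ℝ) : (max 0 (p + d)) ^ 2 / 2 ≤ (max 0 p) ^ 2 / 2 + max 0 p * d + d ^ 2 / 2 := by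
  rcases le_total 0 p with hp | hp <;> rcases le_total 0 (p + d) with hd | hd
  · rw [max_eq_right hp, max_eq_right hd]; nlinarith
  · rw [max_eq_right hp, max_eq_left hd]; nlinarith [sq_nonneg (p + d)]
  · rw [max_eq_left hp, max_eq_right hd]; nlinarith
  · rw [max_eq_left hp, max_eq_left hd]; nlinarith [sq_nonneg d]

lemma exists_sol {ι : Type*} [Fintype ι] {m : ℕ} (b : Fin m → ℝ) (w : ι → Col m) :
    ∃ x, IsSol b w x := by
  classical
  let Φ : (ι → ℝ) → ℝ := fun x => ∑ i, (w i).2 * x i - ∑ j, (pp b w x j) ^ 2 / 2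
  have hΦ : Continuous Φ := by
    unfold Φ pp
    fun_prop
  have hK : IsCompact (Set.univ.pi fun _ : ι => Set.Icc (0:ℝ) 1) :=
    isCompact_univ_pi fun _ => isCompact_Icc
  obtain ⟨x, hx, hmax⟩ := hK.exists_isMaxOn ⟨fun _ => 0, fun i _ => ⟨le_rfl, zero_le_one⟩⟩ hΦ.continuousOn
  have hx' : ∀ i, 0 ≤ x i ∧ x i ≤ 1 := fun i => hx i (Set.mem_univ _)
  have hvar : ∀ i h, 0 ≤ x i + h → x i + h ≤ 1 →
      h * rc (w i) (pp b w x) ≤ h ^ 2 * (∑ j, (w i).1 j ^ 2 / 2) := by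
    intro i h h0 h1
    let x' : ι → ℝ := Function.update x i (x i + h)
    have hx'm : x' ∈ Set.univ.pi fun _ : ι => Set.Icc (0:ℝ) 1 := by
      intro k _
      by_cases hk : k = i
      · subst hk; simp [x', h0, h1]
      · simp only [x', Function.update_of_ne hk]; exact hx' k
    have hle : Φ x' ≤ Φ x := hmax hx'm
    have hs : ∀ a : ι → ℝ, ∑ k, a k * x' k = ∑ k, a k * x k + a i * h := by
      intro a
      have : ∀ k, a k * x' k = a k * x k + (if k = i then a i * h else 0) := by
        intro k
        by_cases hk : k = i
        · subst hk; simp [x']; ring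
        · simp [x', hk]
      simp_rw [this, Finset.sum_add_distrib]
      simp
    have hq : ∀ j, (pp b w x' j) ^ 2 / 2 ≤ (pp b w x j) ^ 2 / 2 + pp b w x j * ((w i).1 j * h)
        + ((w i).1 j * h) ^ 2 / 2 := by
      intro j
      have := half_sq (∑ i, (w i).1 j * x i - b j) ((w i).1 j * h)
      simp only [pp]
      rw [hs fun k => (w k).1 j]
      rw [show ∑ k, (w k).1 j * x k + (w i).1 j * h - b j = ∑ k, (w k).1 j * x k - b j + (w i).1 j * h
        by ring]
      exact this
    have hq' := Finset.sum_le_sum fun j (_ : j ∈ Finset.univ) => hq j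
    simp only [Finset.sum_add_distrib] at hq'
    have e1 : ∑ j, pp b w x j * ((w i).1 j * h) = h * ∑ j, (w i).1 j * pp b w x j := by
      rw [Finset.mul_sum]; exact Finset.sum_congr rfl fun j _ => by ring
    have e2 : ∑ j, ((w i).1 j * h) ^ 2 / 2 = h ^ 2 * ∑ j, (w i).1 j ^ 2 / 2 := by
      rw [Finset.mul_sum]; exact Finset.sum_congr rfl fun j _ => by ring
    rw [e1, e2] at hq'
    simp only [Φ] at hle
    rw [hs fun k => (w k).2] at hle
    rw [rc]
    linarith
  refine ⟨x, fun i => ⟨(hx' i).1, (hx' i).2, ?_, ?_⟩⟩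
  all_goals
    set r := rc (w i) (pp b w x) with hr
    set M := ∑ j, (w i).1 j ^ 2 / 2 with hM
    have hM0 : 0 ≤ M := Finset.sum_nonneg fun j _ => by positivity
  · by_contra hc
    push Not at hc
    have h1 : 0 < 1 - x i := by
      rcases (sub_nonneg.mpr (hx' i).2).lt_or_eq with h | h
      · exact h
      · rw [← h] at hc; simp at hc
    have hr0 : 0 < r := pos_of_mul_pos_left hc h1.le
    set h := min (1 - x i) (r / (2 * (M + 1))) with hh
    have hp : 0 < h := lt_min h1 (by positivity)
    have ha : h ≤ 1 - x i := min_le_left _ _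
    have hb' : h * (2 * (M + 1)) ≤ r := (le_div_iff₀ (by positivity)).mp (min_le_right _ _)
    have := hvar i h (by linarith [(hx' i).1]) (by linarith)
    have h5 : r ≤ h * M := by
      have : h * r ≤ h * (h * M) := by linarith
      exact le_of_mul_le_mul_left this hp
    nlinarith
  · by_contra hc
    push Not at hc
    have h1 : 0 < x i := by
      rcases (hx' i).1.lt_or_eq with h | h
      · exact h
      · rw [← h] at hc; simp at hc
    have hr0 : r < 0 := by
      by_contra h
      push Not at h
      linarith [mul_nonneg h h1.le]
    set h := min (x i) (-r / (2 * (M + 1))) with hh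
    have hp : 0 < h := lt_min h1 (by apply div_pos <;> linarith)
    have ha : h ≤ x i := min_le_left _ _
    have hb' : h * (2 * (M + 1)) ≤ -r := (le_div_iff₀ (by positivity)).mp (min_le_right _ _)
    have := hvar i (-h) (by linarith) (by linarith [(hx' i).2])
    have h5 : -r ≤ h * M := by
      have : h * -r ≤ h * (h * M) := by linarith
      exact le_of_mul_le_mul_left this hp
    nlinarith

lemma sum_swap {ι : Type*} [Fintype ι] {m : ℕ} (w : ι → Col m) (x : ι → ℝ) (u : Fin m → ℝ) :
    ∑ j, (∑ i, (w i).1 j * x i) * u j = ∑ i, x i * ∑ j, (w i).1 j * u j := by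
  simp_rw [Finset.sum_mul, Finset.mul_sum]
  rw [Finset.sum_comm]
  exact Finset.sum_congr rfl fun i _ => Finset.sum_congr rfl fun j _ => by ring

lemma sol_unique {ι : Type*} [Fintype ι] {m : ℕ} (b : Fin m → ℝ) (w : ι → Col m) (x x' : ι → ℝ)
    (h : IsSol b w x) (h' : IsSol b w x') : pp b w x = pp b w x' := by
  set u := pp b w x with hu
  set u' := pp b w x' with hu'
  have h1 : ∀ i, (x i - x' i) * (rc (w i) u' - rc (w i) u) ≤ 0 := by
    intro i
    obtain ⟨a1, a2, a3, a4⟩ := h i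
    obtain ⟨b1, b2, b3, b4⟩ := h' i
    rw [← hu] at a3 a4
    rw [← hu'] at b3 b4
    generalize rc (w i) u = r at *
    generalize rc (w i) u' = r' at *
    rcases lt_trichotomy r 0 with hr | hr | hr <;> rcases lt_trichotomy r' 0 with hr' | hr' | hr' <;>
      nlinarith
  have h2 : ∑ j, ((∑ i, (w i).1 j * x i) - ∑ i, (w i).1 j * x' i) * (u j - u' j) ≤ 0 := by
    have e : ∑ j, ((∑ i, (w i).1 j * x i) - ∑ i, (w i).1 j * x' i) * (u j - u' j)
        = ∑ i, (x i - x' i) * (rc (w i) u' - rc (w i) u) := by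
      have e1 := sum_swap w (fun i => x i - x' i) (fun j => u j - u' j)
      simp only [mul_sub, Finset.sum_sub_distrib] at e1
      rw [← sub_eq_zero]
      simp only [rc, mul_sub, Finset.sum_sub_distrib] at *
      linarith
    rw [e]
    exact Finset.sum_nonpos fun i _ => h1 i
  have h3 : ∀ j, (u j - u' j) ^ 2
      ≤ ((∑ i, (w i).1 j * x i) - ∑ i, (w i).1 j * x' i) * (u j - u' j) := by
    intro j
    have e1 : u j = max 0 (∑ i, (w i).1 j * x i - b j) := rfl
    have e2 : u' j = max 0 (∑ i, (w i).1 j * x' i - b j) := rfl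
    rw [e1, e2]
    generalize ∑ i, (w i).1 j * x i = p
    generalize ∑ i, (w i).1 j * x' i = p'
    rcases max_cases 0 (p - b j) with ⟨h5, h6⟩ | ⟨h5, h6⟩ <;>
    rcases max_cases 0 (p' - b j) with ⟨h7, h8⟩ | ⟨h7, h8⟩ <;> rw [h5, h7] <;> nlinarith
  have h4 : ∑ j, (u j - u' j) ^ 2 ≤ 0 := (Finset.sum_le_sum fun j _ => h3 j).trans h2
  have h5 : ∑ j, (u j - u' j) ^ 2 = 0 := le_antisymm h4 (Finset.sum_nonneg fun _ _ => sq_nonneg _)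
  funext j
  have := (Finset.sum_eq_zero_iff_of_nonneg fun _ _ => sq_nonneg _).mp h5 j (Finset.mem_univ _)
  have := pow_eq_zero_iff (two_ne_zero) |>.mp this
  linarith

/-- The dual solution. -/
noncomputable def uSol {ι : Type*} [Fintype ι] {m : ℕ} (b : Fin m → ℝ) (w : ι → Col m) : Fin m → ℝ :=
  pp b w (exists_sol b w).choose

lemma uSol_eq {ι : Type*} [Fintype ι] {m : ℕ} (b : Fin m → ℝ) (w : ι → Col m) (x : ι → ℝ)
    (h : IsSol b w x) : uSol b w = pp b w x :=
  sol_unique b w _ _ (exists_sol b w).choose_spec h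

lemma uSol_cont {ι : Type*} [Fintype ι] {m : ℕ} (b : Fin m → ℝ) :
    Continuous (fun w : ι → Col m => uSol b w) := by
  rw [continuous_iff_isClosed]
  intro C hC
  let Z : Set ((ι → Col m) × (ι → Set.Icc (0:ℝ) 1)) :=
    {p | IsSol b p.1 (fun i => (p.2 i : ℝ)) ∧ pp b p.1 (fun i => (p.2 i : ℝ)) ∈ C}
  have hpp : Continuous fun p : (ι → Col m) × (ι → Set.Icc (0:ℝ) 1) =>
      pp b p.1 (fun i => (p.2 i : ℝ)) := by
    unfold pp; fun_prop
  have hZ : IsClosed Z := by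
    apply IsClosed.inter
    · have hx : ∀ i, Continuous fun p : (ι → Col m) × (ι → Set.Icc (0:ℝ) 1) => (p.2 i : ℝ) := by
        intro i; fun_prop
      have hrc : ∀ i, Continuous fun p : (ι → Col m) × (ι → Set.Icc (0:ℝ) 1) =>
          rc (p.1 i) (pp b p.1 (fun i => (p.2 i : ℝ))) := by
        intro i
        have := hpp
        unfold rc
        fun_prop
      have hset : {p : (ι → Col m) × (ι → Set.Icc (0:ℝ) 1) |
          IsSol b p.1 (fun i => (p.2 i : ℝ))} = ⋂ i, {p | 0 ≤ (p.2 i : ℝ) ∧ (p.2 i : ℝ) ≤ 1 ∧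
          rc (p.1 i) (pp b p.1 (fun i => (p.2 i : ℝ))) * (1 - (p.2 i : ℝ)) ≤ 0 ∧
          0 ≤ rc (p.1 i) (pp b p.1 (fun i => (p.2 i : ℝ))) * (p.2 i : ℝ)} := by
        ext p
        rw [Set.mem_iInter]
        exact Iff.rfl
      change IsClosed {p : (ι → Col m) × (ι → Set.Icc (0:ℝ) 1) |
          IsSol b p.1 (fun i => (p.2 i : ℝ))}
      rw [hset]
      refine isClosed_iInter fun i => ?_
      refine (isClosed_le continuous_const (hx i)).inter
        ((isClosed_le (hx i) continuous_const).inter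
        ((isClosed_le ((hrc i).mul (continuous_const.sub (hx i))) continuous_const).inter
        (isClosed_le continuous_const ((hrc i).mul (hx i)))))
    · exact hC.preimage hpp
  have : (fun w : ι → Col m => uSol b w) ⁻¹' C = Prod.fst '' Z := by
    ext w
    constructor
    · intro hw
      have hs := (exists_sol b w).choose_spec
      exact ⟨(w, fun i => ⟨_, (hs i).1, (hs i).2.1⟩), ⟨hs, hw⟩, rfl⟩
    · rintro ⟨⟨w', x⟩, ⟨h1, h2⟩, rfl⟩
      change uSol b w' ∈ C
      rw [uSol_eq b w' _ h1]
      exact h2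
  rw [this]
  exact isClosedMap_fst_of_compactSpace _ hZ

lemma sol_identity {ι : Type*} [Fintype ι] {m : ℕ} (b : Fin m → ℝ) (w : ι → Col m) :
    ∑ j, b j * uSol b w j + ∑ i, max 0 (rc (w i) (uSol b w)) + ∑ j, uSol b w j ^ 2
      ≤ ∑ i, max 0 (w i).2 := by
  obtain ⟨x, hx⟩ := exists_sol b w
  rw [uSol_eq b w x hx]
  set u := pp b w x with hu
  have h1 : ∀ i, max 0 (rc (w i) u) = rc (w i) u * x i := by
    intro i
    obtain ⟨a1, a2, a3, a4⟩ := hx i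
    rw [← hu] at a3 a4
    rcases max_cases 0 (rc (w i) u) with ⟨h5, h6⟩ | ⟨h5, h6⟩ <;> rw [h5] <;> nlinarith
  have h2 : ∀ j, (∑ i, (w i).1 j * x i) * u j = b j * u j + u j ^ 2 := by
    intro j
    have e1 : u j = max 0 (∑ i, (w i).1 j * x i - b j) := rfl
    rw [e1]
    rcases max_cases 0 (∑ i, (w i).1 j * x i - b j) with ⟨h5, h6⟩ | ⟨h5, h6⟩ <;> rw [h5] <;> ring
  have h3 := sum_swap w x u
  simp_rw [h2] at h3
  rw [Finset.sum_add_distrib] at h3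
  have h4 : ∑ i, max 0 (rc (w i) u) = ∑ i, (w i).2 * x i - ∑ i, x i * ∑ j, (w i).1 j * u j := by
    rw [← Finset.sum_sub_distrib]
    refine Finset.sum_congr rfl fun i _ => ?_
    rw [h1, rc]; ring
  have h5 : ∑ i, (w i).2 * x i ≤ ∑ i, max 0 (w i).2 := by
    refine Finset.sum_le_sum fun i _ => ?_
    obtain ⟨a1, a2, -, -⟩ := hx i
    rcases max_cases 0 (w i).2 with ⟨h5, h6⟩ | ⟨h5, h6⟩ <;> rw [h5] <;> nlinarith
  linarith

open Classical in
lemma sol_restrict {ι : Type*} [Fintype ι] {m : ℕ} (b : Fin m → ℝ) (w : ι → Col m) (p : ι → Prop)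
    (hp : ∀ i, p i ↔ rc (w i) (uSol b w) < 0) :
    uSol b (fun i : {i // ¬ p i} => w i) = uSol b w := by
  obtain ⟨x, hx⟩ := exists_sol b w
  have hu := uSol_eq b w x hx
  have h0 : ∀ i, p i → x i = 0 := by
    intro i hi
    obtain ⟨a1, a2, a3, a4⟩ := hx i
    have := (hp i).mp hi
    rw [hu] at this
    nlinarith
  have hpp : pp b (fun i : {i // ¬ p i} => w i) (fun i => x i) = pp b w x := by
    funext j
    simp only [pp]
    have := Fintype.sum_subtype_add_sum_subtype p (fun i => (w i).1 j * x i)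
    rw [← this, Finset.sum_eq_zero (s := Finset.univ (α := {i // p i})), zero_add]
    intro i _
    rw [h0 i i.2, mul_zero]
  have hs : IsSol b (fun i : {i // ¬ p i} => w i) (fun i => x i) := by
    intro i
    rw [hpp]
    exact hx i
  rw [uSol_eq b _ _ hs, hpp, hu]

open Classical in
lemma sol_extend {ι : Type*} [Fintype ι] {m : ℕ} (b : Fin m → ℝ) (w : ι → Col m) (p : ι → Prop)
    (hp : ∀ i, p i → rc (w i) (uSol b (fun i : {i // ¬ p i} => w i)) < 0) :
    uSol b w = uSol b (fun i : {i // ¬ p i} => w i) := by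
  obtain ⟨x, hx⟩ := exists_sol b (fun i : {i // ¬ p i} => w i)
  have hu := uSol_eq b _ x hx
  let x' : ι → ℝ := fun i => if h : ¬ p i then x ⟨i, h⟩ else 0
  have hpp : pp b w x' = pp b (fun i : {i // ¬ p i} => w i) x := by
    funext j
    simp only [pp]
    have := Fintype.sum_subtype_add_sum_subtype p (fun i => (w i).1 j * x' i)
    rw [← this, Finset.sum_eq_zero (s := Finset.univ (α := {i // p i})), zero_add]
    · congr 2
      refine Finset.sum_congr rfl fun i _ => ?_
      simp [x', i.2]
    · intro i _
      simp [x', i.2]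
  have hs : IsSol b w x' := by
    intro i
    rw [hpp]
    by_cases h : p i
    · have := hp i h
      rw [hu] at this
      simp [x', h, this.le]
    · simp only [x', h, not_false_eq_true, dif_pos]
      exact hx ⟨i, h⟩
  rw [uSol_eq b _ _ hs, hpp, hu]

end GapProof

namespace GapProof

open Classical in
lemma round_sparse {ι : Type*} [Fintype ι] {m : ℕ} (a : ι → Fin m → ℝ) (x : ι → ℝ)
    (hx : ∀ i, 0 ≤ x i ∧ x i ≤ 1) :
    ∃ x' : ι → ℝ, (∀ i, 0 ≤ x' i ∧ x' i ≤ 1) ∧ (∀ i, x i = 0 → x' i = 0) ∧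
      (∀ i, x i = 1 → x' i = 1) ∧ (∀ j, ∑ i, a i j * x' i = ∑ i, a i j * x i) ∧
      (Finset.univ.filter fun i => 0 < x' i ∧ x' i < 1).card ≤ m := by
  induction' hk : (Finset.univ.filter fun i => 0 < x i ∧ x i < 1).card using
    Nat.strong_induction_on with k ih generalizing x
  by_cases hkm : k ≤ m
  · exact ⟨x, hx, fun _ h => h, fun _ h => h, fun _ => rfl, by rw [hk]; exact hkm⟩
  push Not at hkm
  set F := Finset.univ.filter fun i => 0 < x i ∧ x i < 1 with hF
  have hdep : ¬ LinearIndependent ℝ (fun i : F => a i) := by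
    intro hl
    have := hl.fintype_card_le_finrank
    simp at this
    omega
  rw [Fintype.not_linearIndependent_iff] at hdep
  obtain ⟨g, hg, i0, hi0⟩ := hdep
  let l : ι → ℝ := fun i => if h : i ∈ F then g ⟨i, h⟩ else 0
  have hl0 : ∀ i, i ∉ F → l i = 0 := fun i hi => by simp [l, hi]
  have hla : ∀ j, ∑ i, a i j * l i = 0 := by
    intro j
    have := congrFun hg j
    simp only [Finset.sum_apply, Pi.smul_apply, smul_eq_mul, Pi.zero_apply] at this
    rw [← this, ← Finset.sum_subset (Finset.subset_univ F), ← Finset.sum_coe_sort F]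
    · refine Finset.sum_congr rfl fun i _ => ?_
      simp [l]; ring
    · intro i _ hi
      rw [hl0 i hi, mul_zero]
  let S := F.filter fun i => l i ≠ 0
  have hS : S.Nonempty := ⟨i0, by simp only [S, Finset.mem_filter, i0.2, true_and]; simpa [l] using hi0⟩
  let τ : ι → ℝ := fun i => if 0 < l i then (1 - x i) / l i else x i / (- l i)
  obtain ⟨i1, hi1, hmin⟩ := S.exists_min_image τ hS
  have hFm : ∀ i, i ∈ F → 0 < x i ∧ x i < 1 := by
    intro i hi
    simpa [hF] using hi
  have hi1F : i1 ∈ F := (Finset.mem_filter.mp hi1).1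
  have hl1 : l i1 ≠ 0 := (Finset.mem_filter.mp hi1).2
  have hτ0 : 0 ≤ τ i1 := by
    have := hFm i1 hi1F
    simp only [τ]
    split_ifs with h
    · exact div_nonneg (by linarith) h.le
    · exact div_nonneg this.1.le (by linarith)
  let y : ι → ℝ := fun i => x i + τ i1 * l i
  have hy : ∀ i, 0 ≤ y i ∧ y i ≤ 1 := by
    intro i
    by_cases hi : i ∈ S
    · have h1 := hmin i hi
      have hiF := hFm i (Finset.mem_filter.mp hi).1
      have hne := (Finset.mem_filter.mp hi).2
      by_cases hp : 0 < l i
      · have h2 : τ i = (1 - x i) / l i := by simp [τ, hp]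
        rw [h2, le_div_iff₀ hp] at h1
        have := mul_nonneg hτ0 hp.le
        exact ⟨by simp only [y]; linarith, by simp only [y]; linarith⟩
      · have hn : 0 < - l i := by
          rcases lt_or_gt_of_ne hne with h | h
          · linarith
          · exact absurd h hp
        have h2 : τ i = x i / (- l i) := by simp [τ, hp]
        rw [h2, le_div_iff₀ hn] at h1
        have := mul_nonneg hτ0 hn.le
        exact ⟨by simp only [y]; linarith, by simp only [y]; linarith⟩
    · have h0 : l i = 0 := by
        by_cases hF' : i ∈ F
        · by_contra hne
          exact hi (Finset.mem_filter.mpr ⟨hF', hne⟩)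
        · exact hl0 i hF'
      simp only [y, h0, mul_zero, add_zero]
      exact hx i
  have hy1 : y i1 = 0 ∨ y i1 = 1 := by
    by_cases hp : 0 < l i1
    · right
      simp only [y, τ, hp, if_true]
      field_simp; ring
    · left
      simp only [y, τ, hp, if_false]
      field_simp; ring
  have hyF : ∀ i, i ∉ F → y i = x i := fun i hi => by simp [y, hl0 i hi]
  have hlt : (Finset.univ.filter fun i => 0 < y i ∧ y i < 1).card < k := by
    rw [← hk]
    apply Finset.card_lt_card
    rw [Finset.ssubset_iff_of_subset]
    · refine ⟨i1, hi1F, ?_⟩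
      simp only [Finset.mem_filter, Finset.mem_univ, true_and]
      rcases hy1 with h | h <;> rw [h] <;> norm_num
    · intro i hi
      by_contra hn
      have := hyF i hn
      simp only [Finset.mem_filter, Finset.mem_univ, true_and] at hi
      rw [this] at hi
      exact hn (by simp [hF, hi])
  obtain ⟨x', h1, h2, h3, h4, h5⟩ := ih _ hlt y hy rfl
  refine ⟨x', h1, fun i hi => h2 i ?_, fun i hi => h3 i ?_, fun j => ?_, h5⟩
  · rw [hyF i, hi]; intro h; have := hFm i h; linarith
  · rw [hyF i, hi]; intro h; have := hFm i h; linarith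
  · rw [h4]
    have : ∀ i, a i j * y i = a i j * x i + τ i1 * (a i j * l i) := fun i => by simp only [y]; ring
    simp_rw [this, Finset.sum_add_distrib, ← Finset.mul_sum, hla, mul_zero, add_zero]

open Classical in
lemma round_bern {ι : Type*} {m : ℕ} (a : ι → Fin m → ℝ) (x : ι → ℝ)
    (hx : ∀ i, 0 ≤ x i ∧ x i ≤ 1) (F : Finset ι) :
    ∃ U : Finset ι, U ⊆ F ∧ (∀ i ∈ F, x i = 0 → i ∉ U) ∧ (∀ i ∈ F, x i = 1 → i ∈ U) ∧
      ∑ j, (∑ i ∈ F, a i j * x i - ∑ i ∈ U, a i j) ^ 2 ≤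
        ∑ i ∈ F, x i * (1 - x i) * ∑ j, a i j ^ 2 := by
  induction F using Finset.induction_on with
  | empty => exact ⟨∅, by simp⟩
  | insert k F hk ih =>
    obtain ⟨U, hUF, h0, h1, hs⟩ := ih
    have hkU : k ∉ U := fun h => hk (hUF h)
    set v : Fin m → ℝ := fun j => ∑ i ∈ F, a i j * x i - ∑ i ∈ U, a i j with hv
    have key : x k * ∑ j, (v j + a k j * x k - a k j) ^ 2 + (1 - x k) * ∑ j, (v j + a k j * x k) ^ 2
        = ∑ j, v j ^ 2 + x k * (1 - x k) * ∑ j, a k j ^ 2 := by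
      simp_rw [Finset.mul_sum, ← Finset.sum_add_distrib]
      exact Finset.sum_congr rfl fun j _ => by ring
    have hA : x k ≠ 1 → (∑ j, (v j + a k j * x k) ^ 2 ≤ ∑ j, v j ^ 2 + x k * (1 - x k) * ∑ j, a k j ^ 2)
        → _ := fun hne hh => (⟨U, hUF.trans (Finset.subset_insert _ _), by
          intro i hi hi0
          rcases Finset.mem_insert.mp hi with rfl | hi
          · exact hkU
          · exact h0 i hi hi0, by
          intro i hi hi0
          rcases Finset.mem_insert.mp hi with rfl | hi
          · exact absurd hi0 hne
          · exact h1 i hi hi0, by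
          rw [Finset.sum_insert hk]
          have : ∀ j, ∑ i ∈ insert k F, a i j * x i - ∑ i ∈ U, a i j = v j + a k j * x k := by
            intro j
            rw [Finset.sum_insert hk, hv]; ring
          simp_rw [this]
          linarith⟩ : ∃ U : Finset ι, U ⊆ insert k F ∧ (∀ i ∈ insert k F, x i = 0 → i ∉ U) ∧
            (∀ i ∈ insert k F, x i = 1 → i ∈ U) ∧
            ∑ j, (∑ i ∈ insert k F, a i j * x i - ∑ i ∈ U, a i j) ^ 2 ≤
              ∑ i ∈ insert k F, x i * (1 - x i) * ∑ j, a i j ^ 2)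
    have hB : x k ≠ 0 → (∑ j, (v j + a k j * x k - a k j) ^ 2
        ≤ ∑ j, v j ^ 2 + x k * (1 - x k) * ∑ j, a k j ^ 2)
        → _ := fun hne hh => (⟨insert k U, Finset.insert_subset_insert _ hUF, by
          intro i hi hi0
          rcases Finset.mem_insert.mp hi with rfl | hi2
          · exact absurd hi0 hne
          · intro hU
            rcases Finset.mem_insert.mp hU with rfl | hU
            · exact hk hi2
            · exact h0 i hi2 hi0 hU, by
          intro i hi hi0
          rcases Finset.mem_insert.mp hi with rfl | hi
          · exact Finset.mem_insert_self _ _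
          · exact Finset.mem_insert_of_mem (h1 i hi hi0), by
          rw [Finset.sum_insert hk]
          have : ∀ j, ∑ i ∈ insert k F, a i j * x i - ∑ i ∈ insert k U, a i j
              = v j + a k j * x k - a k j := by
            intro j
            rw [Finset.sum_insert hk, Finset.sum_insert hkU, hv]; ring
          simp_rw [this]
          linarith⟩ : ∃ U : Finset ι, U ⊆ insert k F ∧ (∀ i ∈ insert k F, x i = 0 → i ∉ U) ∧
            (∀ i ∈ insert k F, x i = 1 → i ∈ U) ∧
            ∑ j, (∑ i ∈ insert k F, a i j * x i - ∑ i ∈ U, a i j) ^ 2 ≤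
              ∑ i ∈ insert k F, x i * (1 - x i) * ∑ j, a i j ^ 2)
    obtain ⟨hk0, hk1⟩ := hx k
    by_cases e0 : x k = 0
    · apply hA (by rw [e0]; norm_num)
      rw [e0] at key ⊢
      linarith
    by_cases e1 : x k = 1
    · apply hB e0
      rw [e1] at key ⊢
      linarith
    by_contra hno
    have hA' : ¬ _ := fun h => hno (hA e1 h)
    have hB' : ¬ _ := fun h => hno (hB e0 h)
    push Not at hA' hB'
    have p0 : 0 < x k := lt_of_le_of_ne hk0 (Ne.symm e0)
    have p1 : 0 < 1 - x k := sub_pos.mpr (lt_of_le_of_ne hk1 e1)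
    have q0 := mul_lt_mul_of_pos_left hB' p0
    have q1 := mul_lt_mul_of_pos_left hA' p1
    linarith

open Classical in
lemma rounding {ι : Type*} [Fintype ι] {m : ℕ} (a : ι → Fin m → ℝ) (x : ι → ℝ)
    (hx : ∀ i, 0 ≤ x i ∧ x i ≤ 1) (M : ℝ) (hM0 : 0 ≤ M) (hM : ∀ i, ∑ j, a i j ^ 2 ≤ M) :
    ∃ U : Finset ι, (∀ i, x i = 0 → i ∉ U) ∧ (∀ i, x i = 1 → i ∈ U) ∧
      ∑ j, (∑ i, a i j * x i - ∑ i ∈ U, a i j) ^ 2 ≤ m * M / 4 := by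
  obtain ⟨x', h1, h2, h3, h4, h5⟩ := round_sparse a x hx
  obtain ⟨U, -, g0, g1, g2⟩ := round_bern a x' h1 Finset.univ
  refine ⟨U, fun i hi => g0 i (Finset.mem_univ _) (h2 i hi),
    fun i hi => g1 i (Finset.mem_univ _) (h3 i hi), ?_⟩
  simp_rw [← h4]
  refine g2.trans ?_
  rw [← Finset.sum_filter_add_sum_filter_not Finset.univ (fun i => 0 < x' i ∧ x' i < 1)]
  rw [Finset.sum_eq_zero (s := Finset.univ.filter fun i => ¬ (0 < x' i ∧ x' i < 1)), add_zero]
  · have : ∀ i ∈ Finset.univ.filter fun i => 0 < x' i ∧ x' i < 1,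
        x' i * (1 - x' i) * ∑ j, a i j ^ 2 ≤ M / 4 := by
      intro i _
      have hs : 0 ≤ ∑ j, a i j ^ 2 := Finset.sum_nonneg fun _ _ => sq_nonneg _
      have : x' i * (1 - x' i) ≤ 1 / 4 := by nlinarith [sq_nonneg (x' i - 1 / 2)]
      calc x' i * (1 - x' i) * ∑ j, a i j ^ 2 ≤ 1 / 4 * ∑ j, a i j ^ 2 :=
            mul_le_mul_of_nonneg_right this hs
        _ ≤ M / 4 := by linarith [hM i]
    refine (Finset.sum_le_card_nsmul _ _ _ this).trans ?_
    rw [nsmul_eq_mul]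
    have : ((Finset.univ.filter fun i => 0 < x' i ∧ x' i < 1).card : ℝ) ≤ m := by exact_mod_cast h5
    nlinarith
  · intro i hi
    simp only [Finset.mem_filter, Finset.mem_univ, true_and] at hi
    obtain ⟨p0, p1⟩ := h1 i
    rcases p0.lt_or_eq with h | h
    · rcases p1.lt_or_eq with h' | h'
      · exact absurd ⟨h, h'⟩ hi
      · rw [h']; simp
    · rw [← h]; simp

end GapProof

namespace GapProof

/-- The scale. -/
noncomputable def sg {m : ℕ} (u : Fin m → ℝ) : ℝ := Real.sqrt (1 + ∑ j, u j ^ 2)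

lemma sg_sq {m : ℕ} (u : Fin m → ℝ) : sg u ^ 2 = 1 + ∑ j, u j ^ 2 :=
  Real.sq_sqrt (by have : 0 ≤ ∑ j, u j ^ 2 := Finset.sum_nonneg fun _ _ => sq_nonneg _
                   linarith)

lemma one_le_sg {m : ℕ} (u : Fin m → ℝ) : 1 ≤ sg u := by
  have : 0 ≤ ∑ j, u j ^ 2 := Finset.sum_nonneg fun _ _ => sq_nonneg _
  exact Real.one_le_sqrt.mpr (by linarith)

lemma abs_le_sg {m : ℕ} (u : Fin m → ℝ) (j : Fin m) : |u j| ≤ sg u := by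
  apply Real.abs_le_sqrt
  have := Finset.single_le_sum (f := fun j => u j ^ 2) (fun _ _ => sq_nonneg _) (Finset.mem_univ j)
  linarith

lemma rot_snd {m : ℕ} (u : Fin m → ℝ) (z : Col m) : (rot u z).2 * sg u = - rc z u := by
  have h := one_le_sg u
  have : (rot u z).2 = (∑ k, z.1 k * u k) / sg u - z.2 / sg u := rfl
  rw [this, rc]
  field_simp
  ring

lemma rot_fst {m : ℕ} (u : Fin m → ℝ) (z : Col m) (j : Fin m) :
    z.1 j = (rot u z).1 j - (∑ k, (rot u z).1 k * u k) * (u j / (sg u * (sg u + 1)))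
      + (rot u z).2 * (u j / sg u) := by
  have h := one_le_sg u
  have h2 := sg_sq u
  have e1 : ∀ k, (rot u z).1 k = z.1 k + (z.2 - (∑ k, z.1 k * u k) / (sg u + 1)) * (u k / sg u) :=
    fun k => rfl
  have e2 : (rot u z).2 = (∑ k, z.1 k * u k) / sg u - z.2 / sg u := rfl
  rw [e2]
  simp_rw [e1]
  set p := ∑ k, z.1 k * u k with hp
  set K := z.2 - p / (sg u + 1) with hK
  have e3 : ∑ k, (z.1 k + K * (u k / sg u)) * u k = p + K * ((sg u ^ 2 - 1) / sg u) := by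
    have : ∀ k, (z.1 k + K * (u k / sg u)) * u k = z.1 k * u k + K / sg u * u k ^ 2 := fun k => by ring
    simp_rw [this, Finset.sum_add_distrib, ← Finset.mul_sum]
    rw [h2]; ring
  rw [e3, hK]
  generalize sg u = σ at *
  have : σ ≠ 0 := by linarith
  have : σ + 1 ≠ 0 := by linarith
  field_simp
  ring

lemma rot_fst_sum {ι : Type*} {m : ℕ} (u : Fin m → ℝ) (z : ι → Col m) (T : Finset ι) (j : Fin m) :
    ∑ i ∈ T, (z i).1 j = ∑ i ∈ T, (rot u (z i)).1 j
      - (∑ k, (∑ i ∈ T, (rot u (z i)).1 k) * u k) * (u j / (sg u * (sg u + 1)))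
      + (∑ i ∈ T, (rot u (z i)).2) * (u j / sg u) := by
  rw [Finset.sum_congr rfl fun i _ => rot_fst u (z i) j]
  rw [Finset.sum_add_distrib, Finset.sum_sub_distrib, ← Finset.sum_mul, ← Finset.sum_mul,
    Finset.sum_comm]
  simp_rw [Finset.sum_mul]

/-- Residual after rounding. -/
noncomputable def Vv {ι : Type*} [Fintype ι] {m : ℕ} (b : Fin m → ℝ) (w : ι → Col m) (U : Finset ι)
    (j : Fin m) : ℝ := b j - ∑ i ∈ U, (w i).1 j + uSol b w j

/-- Relevant part of the residual. -/
noncomputable def Dv {ι : Type*} [Fintype ι] {m : ℕ} (b : Fin m → ℝ) (w : ι → Col m) (U : Finset ι)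
    (j : Fin m) : ℝ := if 0 < uSol b w j then Vv b w U j else min (Vv b w U j) 0

/-- Target for the sum of added columns. -/
noncomputable def Dt {ι : Type*} [Fintype ι] {m : ℕ} (b : Fin m → ℝ) (w : ι → Col m) (U : Finset ι)
    (δ κ : ℝ) (j : Fin m) : ℝ :=
  Dv b w U j - uSol b w j - δ - κ * (uSol b w j / sg (uSol b w))

/-- Target in rotated coordinates. -/
noncomputable def yv {ι : Type*} [Fintype ι] {m : ℕ} (b : Fin m → ℝ) (w : ι → Col m) (U : Finset ι)
    (δ κ : ℝ) (j : Fin m) : ℝ :=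
  Dt b w U δ κ j + (∑ k, Dt b w U δ κ k * uSol b w k) * (uSol b w j / (sg (uSol b w) + 1))

/-- Valid rounding. -/
def validU {ι : Type*} [Fintype ι] {m : ℕ} (b : Fin m → ℝ) (w : ι → Col m) (M : ℝ)
    (U : Finset ι) : Prop :=
  (∀ i, 0 < rc (w i) (uSol b w) → i ∈ U) ∧ ∑ j, Dv b w U j ^ 2 ≤ m * M / 4

lemma uSol_nonneg {ι : Type*} [Fintype ι] {m : ℕ} (b : Fin m → ℝ) (w : ι → Col m) (j : Fin m) :
    0 ≤ uSol b w j := le_max_left _ _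

lemma exists_valid {ι : Type*} [Fintype ι] {m : ℕ} (b : Fin m → ℝ) (w : ι → Col m) (M : ℝ)
    (hM0 : 0 ≤ M) (hM : ∀ i, ∑ j, (w i).1 j ^ 2 ≤ M) : ∃ U, validU b w M U := by
  classical
  obtain ⟨x, hx⟩ := exists_sol b w
  have hu := uSol_eq b w x hx
  obtain ⟨U, h0, h1, h2⟩ := rounding (fun i => (w i).1) x (fun i => ⟨(hx i).1, (hx i).2.1⟩) M hM0 hM
  refine ⟨U, fun i hi => h1 i ?_, (Finset.sum_le_sum fun j _ => ?_).trans h2⟩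
  · obtain ⟨a1, a2, a3, a4⟩ := hx i
    rw [← hu] at a3
    nlinarith
  · apply sq_le_sq.mpr
    have e : uSol b w j = max 0 (∑ i, (w i).1 j * x i - b j) := by rw [hu]; rfl
    simp only [Dv, Vv]
    generalize uSol b w j = v at *
    generalize ∑ i ∈ U, (w i).1 j = p at *
    generalize ∑ i, (w i).1 j * x i = q at *
    split_ifs with h
    · rcases max_cases 0 (q - b j) with ⟨h5, h6⟩ | ⟨h5, h6⟩
      · linarith
      · have : b j - p + v = q - p := by linarith
        rw [this]
    · have hge : q - b j ≤ v := by rw [e]; exact le_max_right _ _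
      rcases le_total (b j - p + v) 0 with h' | h'
      · rw [min_eq_left h', abs_of_nonpos h', abs_of_nonpos (by linarith)]; linarith
      · rw [min_eq_right h']; simp

lemma gap_le {m n : ℕ} (b : Fin m → ℝ) (w : Fin n → Col m) (u : Fin m → ℝ) (hu : ∀ j, 0 ≤ u j)
    (X : Finset (Fin n)) (hX : ∀ j, ∑ i ∈ X, (w i).1 j ≤ b j) :
    IPGAP (Matrix.of fun i j => (w j).1 i) b (fun j => (w j).2) ≤
      ∑ j, b j * u j + ∑ i, max 0 (rc (w i) u) - ∑ i ∈ X, (w i).2 := by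
  classical
  have hsum : ∀ a : Fin n → ℝ, ∑ i, a i * (if i ∈ X then (1:ℝ) else 0) = ∑ i ∈ X, a i := by
    intro a; simp
  have hdual : ∀ x : Fin n → ℝ, (∀ i, x i ∈ Set.Icc (0:ℝ) 1) →
      (∀ j, (Matrix.of fun i j => (w j).1 i : Matrix (Fin m) (Fin n) ℝ).mulVec x j ≤ b j) →
      ∑ i, (w i).2 * x i ≤ ∑ j, b j * u j + ∑ i, max 0 (rc (w i) u) := by
    intro x hx hA
    have h1 := sum_swap w x u
    have h2 : ∑ j, (∑ i, (w i).1 j * x i) * u j ≤ ∑ j, b j * u j :=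
      Finset.sum_le_sum fun j _ => mul_le_mul_of_nonneg_right (hA j) (hu j)
    have h3 : ∑ i, ((w i).2 * x i - x i * ∑ j, (w i).1 j * u j) ≤ ∑ i, max 0 (rc (w i) u) := by
      refine Finset.sum_le_sum fun i _ => ?_
      have : (w i).2 * x i - x i * ∑ j, (w i).1 j * u j = rc (w i) u * x i := by rw [rc]; ring
      rw [this]
      obtain ⟨a1, a2⟩ := hx i
      rcases max_cases 0 (rc (w i) u) with ⟨h5, h6⟩ | ⟨h5, h6⟩ <;> rw [h5] <;> nlinarith
    rw [Finset.sum_sub_distrib] at h3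
    linarith
  have hfeas : ∀ j, (Matrix.of fun i j => (w j).1 i : Matrix (Fin m) (Fin n) ℝ).mulVec
      (fun i => if i ∈ X then (1:ℝ) else 0) j ≤ b j := by
    intro j
    have := hsum fun i => (w i).1 j
    refine le_trans (le_of_eq ?_) (hX j)
    rw [← this]; rfl
  have hLP : valLP (Matrix.of fun i j => (w j).1 i) b (fun j => (w j).2)
      ≤ ∑ j, b j * u j + ∑ i, max 0 (rc (w i) u) := by
    apply csSup_le
    · refine ⟨_, fun i => if i ∈ X then (1:ℝ) else 0, ?_, hfeas, rfl⟩
      intro i; beta_reduce; split_ifs <;> simp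
    · rintro v ⟨x, hx, hA, rfl⟩
      exact hdual x hx hA
  have hIP : ∑ i ∈ X, (w i).2 ≤ valIP (Matrix.of fun i j => (w j).1 i) b (fun j => (w j).2) := by
    apply le_csSup
    · refine ⟨∑ j, b j * u j + ∑ i, max 0 (rc (w i) u), ?_⟩
      rintro v ⟨x, hx, hA, rfl⟩
      refine hdual x (fun i => ?_) hA
      rcases hx i with h | h <;> rw [h] <;> simp
    · refine ⟨fun i => if i ∈ X then (1:ℝ) else 0, ?_, hfeas, (hsum _).symm⟩
      intro i; beta_reduce; split_ifs <;> simp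
  rw [IPGAP]
  linarith

open Classical in
lemma good_gap {m n : ℕ} (b : Fin m → ℝ) (ω : Fin n → Col m) (p : Fin n → Prop) (s : ℕ) (M δ η : ℝ)
    (hδ : 0 ≤ δ)
    (hz : ∀ i : {i // p i}, rc (ω i) (uSol b fun i : {i // ¬ p i} => ω i) < 0)
    (hw : ∀ i : {i // ¬ p i}, 0 ≤ rc (ω i) (uSol b fun i : {i // ¬ p i} => ω i))
    (U : Finset {i // ¬ p i}) (hU : validU b (fun i : {i // ¬ p i} => ω i) M U)
    (T : Finset {i // p i})
    (hT : goodSel s (yv b (fun i : {i // ¬ p i} => ω i) U (2 * m * δ) (s * η)) δ η T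
      (fun i => (rot (uSol b fun i : {i // ¬ p i} => ω i) (ω i)).1)
      (fun i => (rot (uSol b fun i : {i // ¬ p i} => ω i) (ω i)).2)) :
    IPGAP (Matrix.of fun i j => (ω j).1 i) b (fun j => (ω j).2) ≤
      (2 * s * η + 4 * m ^ 2 * δ) * sg (uSol b fun i : {i // ¬ p i} => ω i) := by
  set w := fun i : {i // ¬ p i} => ω i with hwdef
  set u := uSol b w with hu
  have hu0 : ∀ j, 0 ≤ u j := uSol_nonneg b w
  set σ := sg u with hσ
  have hσ1 : 1 ≤ σ := one_le_sg u
  have hσ2 : σ ^ 2 = 1 + ∑ j, u j ^ 2 := sg_sq u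
  have hus : ∀ j, |u j| ≤ σ := abs_le_sg u
  obtain ⟨hTc, hTρ, hTg⟩ := hT
  set P := ∑ i ∈ T, (rot u (ω i)).2 with hP
  set D := Dt b w U (2 * m * δ) (s * η) with hD
  have hρ0 : ∀ i ∈ T, 0 ≤ (rot u (ω i)).2 := by
    intro i _
    have h1 := rot_snd u (ω i)
    have h2 := hz i
    by_contra h
    push Not at h
    nlinarith
  have hP0 : 0 ≤ P := Finset.sum_nonneg hρ0
  have hP1 : P ≤ s * η := by
    have := Finset.sum_le_card_nsmul T _ η hTρ
    rw [nsmul_eq_mul, hTc] at this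
    exact this
  set e : Fin m → ℝ := fun j => ∑ i ∈ T, (rot u (ω i)).1 j - yv b w U (2 * m * δ) (s * η) j with he
  have heδ : ∀ j, |e j| ≤ δ := hTg
  have heu : |∑ k, e k * u k| ≤ m * (δ * σ) := by
    refine (Finset.abs_sum_le_sum_abs _ _).trans ?_
    have : ∀ k ∈ Finset.univ, |e k * u k| ≤ δ * σ := fun k _ => by
      rw [abs_mul]
      exact mul_le_mul (heδ k) (hus k) (abs_nonneg _) hδ
    have := Finset.sum_le_card_nsmul _ _ _ this
    simpa [nsmul_eq_mul] using this
  have hyu : ∑ k, yv b w U (2 * m * δ) (s * η) k * u k = σ * ∑ k, D k * u k := by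
    have : ∀ k, yv b w U (2 * m * δ) (s * η) k * u k
        = D k * u k + (∑ k, D k * u k) / (σ + 1) * u k ^ 2 := fun k => by
      simp only [yv]; rw [← hu, ← hσ, ← hD]; ring
    simp_rw [this, Finset.sum_add_distrib, ← Finset.mul_sum]
    have : ∑ j, u j ^ 2 = (σ - 1) * (σ + 1) := by linarith
    rw [this]
    field_simp
    ring
  set err : Fin m → ℝ := fun j => e j - (∑ k, e k * u k) * (u j / (σ * (σ + 1))) with herr
  have hTa : ∀ j, ∑ i ∈ T, (ω i).1 j = D j + err j + P * (u j / σ) := by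
    intro j
    rw [rot_fst_sum u (fun i : {i // p i} => ω i) T j, ← hP, ← hσ]
    have e1 : ∀ k, ∑ i ∈ T, (rot u (ω i)).1 k = yv b w U (2 * m * δ) (s * η) k + e k := fun k => by
      simp only [he]; ring
    simp_rw [e1, add_mul, Finset.sum_add_distrib, hyu]
    have e2 : yv b w U (2 * m * δ) (s * η) j = D j + (∑ k, D k * u k) * (u j / (σ + 1)) := rfl
    rw [e2]
    simp only [herr]
    field_simp
    ring
  have herrb : ∀ j, |err j| ≤ 2 * m * δ := by
    intro j
    have hm1 : (1:ℝ) ≤ m := by exact_mod_cast Nat.one_le_iff_ne_zero.mpr (Fin.pos j).ne'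
    simp only [herr]
    refine (abs_sub _ _).trans ?_
    rw [abs_mul, abs_div, abs_of_pos (show 0 < σ * (σ + 1) by positivity)]
    have h1 : |∑ k, e k * u k| * (|u j| / (σ * (σ + 1))) ≤ m * (δ * σ) * (σ / (σ * (σ + 1))) := by
      gcongr
      exact hus j
    have h2 : m * (δ * σ) * (σ / (σ * (σ + 1))) ≤ m * δ := by
      have : m * (δ * σ) * (σ / (σ * (σ + 1))) = m * δ * (σ / (σ + 1)) := by
        field_simp
      rw [this]
      apply mul_le_of_le_one_right (by positivity)
      rw [div_le_one (by positivity)]; linarith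
    have h3 := heδ j
    nlinarith
  -- slack
  let X : Finset (Fin n) := T.map (Function.Embedding.subtype _) ∪ U.map (Function.Embedding.subtype _)
  have hdisj : Disjoint (T.map (Function.Embedding.subtype _)) (U.map (Function.Embedding.subtype _)) := by
    rw [Finset.disjoint_left]
    intro i hi hi'
    simp only [Finset.mem_map, Function.Embedding.subtype_apply] at hi hi'
    obtain ⟨a, -, rfl⟩ := hi
    obtain ⟨c, -, hc⟩ := hi'
    exact c.2 (hc ▸ a.2)
  have hXs : ∀ f : Fin n → ℝ, ∑ i ∈ X, f i = ∑ i ∈ T, f i + ∑ i ∈ U, f i := by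
    intro f
    simp only [X]
    rw [Finset.sum_union hdisj, Finset.sum_map, Finset.sum_map]
    rfl
  have hslack : ∀ j, b j - ∑ i ∈ X, (ω i).1 j
      = (Vv b w U j - Dv b w U j) + 2 * m * δ - err j + (s * η - P) * (u j / σ) := by
    intro j
    rw [hXs, hTa]
    have : D j = Dv b w U j - u j - 2 * m * δ - s * η * (u j / σ) := rfl
    rw [this, Vv, ← hu]
    ring
  have hVD : ∀ j, 0 ≤ Vv b w U j - Dv b w U j ∧ (Vv b w U j - Dv b w U j) * u j = 0 := by
    intro j
    rw [Dv, ← hu]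
    split_ifs with h
    · simp
    · have : u j = 0 := le_antisymm (not_lt.mp h) (hu0 j)
      rw [this]
      exact ⟨by linarith [min_le_left (Vv b w U j) 0], by simp⟩
  have hsl0 : ∀ j, ∑ i ∈ X, (ω i).1 j ≤ b j := by
    intro j
    have h1 := hslack j
    have h2 := (abs_le.mp (herrb j)).2
    have h3 : 0 ≤ (s * η - P) * (u j / σ) :=
      mul_nonneg (by linarith) (div_nonneg (hu0 j) (by linarith))
    linarith [(hVD j).1]
  have hslu : ∑ j, (b j - ∑ i ∈ X, (ω i).1 j) * u j ≤ 4 * m ^ 2 * δ * σ + s * η * σ := by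
    have h1 : ∀ j, (b j - ∑ i ∈ X, (ω i).1 j) * u j ≤ 4 * m * δ * σ + s * η / σ * u j ^ 2 := by
      intro j
      rw [hslack]
      have h2 := (abs_le.mp (herrb j)).1
      have h3 : (2 * m * δ - err j) * u j ≤ 4 * m * δ * σ := by
        have : u j ≤ σ := (le_abs_self _).trans (hus j)
        calc (2 * m * δ - err j) * u j ≤ (4 * m * δ) * u j :=
              mul_le_mul_of_nonneg_right (by linarith) (hu0 j)
          _ ≤ _ := mul_le_mul_of_nonneg_left this (by positivity)
      have h4 : (s * η - P) * (u j / σ) * u j ≤ s * η / σ * u j ^ 2 := by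
        have : (s * η - P) * (u j / σ) * u j = (s * η - P) * (u j ^ 2 / σ) := by ring
        rw [this]
        have : s * η / σ * u j ^ 2 = s * η * (u j ^ 2 / σ) := by ring
        rw [this]
        exact mul_le_mul_of_nonneg_right (by linarith) (by positivity)
      have h5 := (hVD j).2
      nlinarith
    refine (Finset.sum_le_sum fun j _ => h1 j).trans ?_
    rw [Finset.sum_add_distrib]
    have h6 : s * η / σ * ∑ j, u j ^ 2 ≤ s * η * σ := by
      have : ∑ j, u j ^ 2 ≤ σ ^ 2 := by linarith
      calc s * η / σ * ∑ j, u j ^ 2 ≤ s * η / σ * σ ^ 2 :=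
            mul_le_mul_of_nonneg_left this (div_nonneg (by linarith) (by linarith))
        _ = s * η * σ := by field_simp
    rw [Finset.mul_sum] at h6
    simp only [Finset.sum_const, Finset.card_univ, Fintype.card_fin, nsmul_eq_mul]
    nlinarith
  have hgap := gap_le b ω u hu0 X hsl0
  refine hgap.trans ?_
  have hrcX : ∑ i ∈ X, (ω i).2 = ∑ i ∈ X, rc (ω i) u + ∑ j, (∑ i ∈ X, (ω i).1 j) * u j := by
    simp_rw [Finset.sum_mul]
    rw [Finset.sum_comm, ← Finset.sum_add_distrib]
    refine Finset.sum_congr rfl fun i _ => by rw [rc]; ring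
  have hmax : ∑ i, max 0 (rc (ω i) u) = ∑ i ∈ U, rc (ω i) u := by
    rw [← Fintype.sum_subtype_add_sum_subtype p, Finset.sum_eq_zero, zero_add]
    · symm
      rw [← Finset.sum_subset (Finset.subset_univ U)]
      · exact Finset.sum_congr rfl fun i _ => (max_eq_right (hw i)).symm
      · intro i _ hi
        apply max_eq_left
        by_contra hc
        push Not at hc
        exact hi (hU.1 i hc)
    · intro i _
      exact max_eq_left (hz i).le
  have hTrc : ∑ i ∈ T, rc (ω i) u = - (σ * P) := by
    rw [hP, Finset.mul_sum, ← Finset.sum_neg_distrib]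
    refine Finset.sum_congr rfl fun i _ => ?_
    have := rot_snd u (ω i)
    linarith
  have e5 := hXs fun i => rc (ω i) u
  simp only [sub_mul, Finset.sum_sub_distrib] at hslu
  have : σ * P ≤ σ * (s * η) := mul_le_mul_of_nonneg_left hP1 (by linarith)
  linarith

lemma yv_norm {ι : Type*} [Fintype ι] {m : ℕ} (b : Fin m → ℝ) (w : ι → Col m) (M : ℝ)
    (U : Finset ι) (hU : validU b w M U) (δ κ : ℝ) :
    ∑ j, yv b w U δ κ j ^ 2 ≤
      sg (uSol b w) ^ 2 * (4 * (m * M / 4 + sg (uSol b w) ^ 2 + m * δ ^ 2 + κ ^ 2)) := by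
  set u := uSol b w with hu
  set σ := sg u with hσ
  have hσ1 : 1 ≤ σ := one_le_sg u
  have hσ2 : σ ^ 2 = 1 + ∑ j, u j ^ 2 := sg_sq u
  set D := Dt b w U δ κ with hD
  set t := ∑ k, D k * u k with ht
  have h1 : ∑ j, yv b w U δ κ j ^ 2 = ∑ j, D j ^ 2 + t ^ 2 := by
    have : ∀ j, yv b w U δ κ j ^ 2 = D j ^ 2 + 2 * (t / (σ + 1)) * (D j * u j)
        + (t / (σ + 1)) ^ 2 * u j ^ 2 := fun j => by
      simp only [yv]; rw [← hu, ← hσ, ← hD, ← ht]; ring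
    simp_rw [this, Finset.sum_add_distrib, ← Finset.mul_sum]
    have : ∑ j, u j ^ 2 = (σ - 1) * (σ + 1) := by linarith
    rw [this, ← ht]
    field_simp
    ring
  have h2 : t ^ 2 ≤ (∑ j, D j ^ 2) * ∑ j, u j ^ 2 := Finset.sum_mul_sq_le_sq_mul_sq _ _ _
  have h3 : ∑ j, yv b w U δ κ j ^ 2 ≤ σ ^ 2 * ∑ j, D j ^ 2 := by
    rw [h1, hσ2]; nlinarith
  refine h3.trans (mul_le_mul_of_nonneg_left ?_ (sq_nonneg _))
  have h4 : ∀ j, D j ^ 2 ≤ 4 * (Dv b w U j ^ 2 + u j ^ 2 + δ ^ 2 + κ ^ 2 / σ ^ 2 * u j ^ 2) := by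
    intro j
    have e : D j = Dv b w U j - u j - δ - κ * (u j / σ) := rfl
    have e2 : κ ^ 2 / σ ^ 2 * u j ^ 2 = (κ * (u j / σ)) ^ 2 := by ring
    rw [e, e2]
    generalize Dv b w U j = a
    generalize u j = c
    generalize κ * (c / σ) = d
    nlinarith [sq_nonneg (a + c), sq_nonneg (a + δ), sq_nonneg (a + d), sq_nonneg (c - δ),
      sq_nonneg (c - d), sq_nonneg (δ - d)]
  refine (Finset.sum_le_sum fun j _ => h4 j).trans ?_
  rw [← Finset.mul_sum]
  simp_rw [Finset.sum_add_distrib, ← Finset.mul_sum]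
  simp only [Finset.sum_const, Finset.card_univ, Fintype.card_fin, nsmul_eq_mul]
  have h5 : κ ^ 2 / σ ^ 2 * ∑ j, u j ^ 2 ≤ κ ^ 2 := by
    have : ∑ j, u j ^ 2 ≤ σ ^ 2 := by linarith
    calc κ ^ 2 / σ ^ 2 * ∑ j, u j ^ 2 ≤ κ ^ 2 / σ ^ 2 * σ ^ 2 :=
          mul_le_mul_of_nonneg_left this (by positivity)
      _ = κ ^ 2 := by field_simp
  have := hU.2
  linarith

end GapProof

namespace GapProof

lemma uSol_meas {ι : Type*} [Fintype ι] {m : ℕ} (b : Fin m → ℝ) :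
    Measurable (fun w : ι → Col m => uSol b w) := (uSol_cont b).measurable

lemma sg_meas {Ω : Type*} [MeasurableSpace Ω] {m : ℕ} {f : Ω → Fin m → ℝ} (hf : Measurable f) :
    Measurable fun w => sg (f w) := by
  unfold sg
  have : Measurable fun w => 1 + ∑ j, f w j ^ 2 := by fun_prop
  exact this.sqrt

lemma rc_meas {Ω : Type*} [MeasurableSpace Ω] {m : ℕ} {f : Ω → Fin m → ℝ} {g : Ω → Col m}
    (hf : Measurable f) (hg : Measurable g) : Measurable fun w => rc (g w) (f w) := by
  unfold rc; fun_prop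

lemma rot_meas {Ω : Type*} [MeasurableSpace Ω] {m : ℕ} {f : Ω → Fin m → ℝ} {g : Ω → Col m}
    (hf : Measurable f) (hg : Measurable g) : Measurable fun w => rot (f w) (g w) := by
  have h := sg_meas hf
  have e : ∀ w, rot (f w) (g w) = (fun j => (g w).1 j + ((g w).2 - (∑ k, (g w).1 k * f w k)
    / (sg (f w) + 1)) * (f w j / sg (f w)), (∑ k, (g w).1 k * f w k) / sg (f w) - (g w).2 / sg (f w)) :=
    fun w => rfl
  simp_rw [e]
  fun_prop

lemma Vv_meas {ι : Type*} [Fintype ι] {m : ℕ} (b : Fin m → ℝ) (U : Finset ι) (j : Fin m) :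
    Measurable fun w : ι → Col m => Vv b w U j := by
  have := uSol_meas (ι := ι) b
  unfold Vv; fun_prop

lemma Dv_meas {ι : Type*} [Fintype ι] {m : ℕ} (b : Fin m → ℝ) (U : Finset ι) (j : Fin m) :
    Measurable fun w : ι → Col m => Dv b w U j := by
  have h1 := uSol_meas (ι := ι) b
  have h2 := Vv_meas b U j
  unfold Dv
  refine Measurable.ite (measurableSet_lt measurable_const ?_) h2 (h2.min measurable_const)
  fun_prop

lemma yv_meas {ι : Type*} [Fintype ι] {m : ℕ} (b : Fin m → ℝ) (U : Finset ι) (δ κ : ℝ) :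
    Measurable fun w : ι → Col m => yv b w U δ κ := by
  have h1 := uSol_meas (ι := ι) b
  have h2 := fun j => Dv_meas b U j
  have h3 := sg_meas h1
  have h4 : ∀ j, Measurable fun w : ι → Col m => Dt b w U δ κ j := by
    intro j; unfold Dt
    have := h2 j
    fun_prop
  unfold yv
  refine measurable_pi_lambda _ fun j => ?_
  fun_prop

lemma validU_meas {ι : Type*} [Fintype ι] {m : ℕ} (b : Fin m → ℝ) (M : ℝ) (U : Finset ι) :
    MeasurableSet {w : ι → Col m | validU b w M U} := by
  have h1 := uSol_meas (ι := ι) b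
  have h2 := fun j => Dv_meas b U j
  apply MeasurableSet.inter
  · have : {w : ι → Col m | ∀ i, 0 < rc (w i) (uSol b w) → i ∈ U}
        = ⋂ i, {w | ¬ (0 < rc (w i) (uSol b w)) ∨ i ∈ U} := by
      ext w; simp [imp_iff_not_or]
    change MeasurableSet {w : ι → Col m | ∀ i, 0 < rc (w i) (uSol b w) → i ∈ U}
    rw [this]
    refine MeasurableSet.iInter fun i => MeasurableSet.union ?_ (MeasurableSet.const _)
    exact (measurableSet_lt measurable_const (rc_meas h1 (measurable_pi_apply i))).compl
  · exact measurableSet_le (Finset.measurable_sum _ fun j _ => (h2 j).pow_const 2) measurable_const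

/-- Conditions on the kept columns. -/
def Hset {ι : Type*} [Fintype ι] {m : ℕ} (b : Fin m → ℝ) (M R : ℝ) : Set (ι → Col m) :=
  {w | (∀ i, 0 ≤ rc (w i) (uSol b w) ∧ ∑ j, (w i).1 j ^ 2 ≤ M) ∧ ∑ j, uSol b w j ^ 2 ≤ R}

lemma Hset_meas {ι : Type*} [Fintype ι] {m : ℕ} (b : Fin m → ℝ) (M R : ℝ) :
    MeasurableSet (Hset b M R : Set (ι → Col m)) := by
  have h1 := uSol_meas (ι := ι) b
  apply MeasurableSet.inter
  · have : {w : ι → Col m | ∀ i, 0 ≤ rc (w i) (uSol b w) ∧ ∑ j, (w i).1 j ^ 2 ≤ M}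
        = ⋂ i, {w | 0 ≤ rc (w i) (uSol b w) ∧ ∑ j, (w i).1 j ^ 2 ≤ M} := by
      ext w; simp
    change MeasurableSet {w : ι → Col m | ∀ i, 0 ≤ rc (w i) (uSol b w) ∧ ∑ j, (w i).1 j ^ 2 ≤ M}
    rw [this]
    refine MeasurableSet.iInter fun i => MeasurableSet.inter ?_ ?_
    · exact measurableSet_le measurable_const (rc_meas h1 (measurable_pi_apply i))
    · have : Measurable fun w : ι → Col m => ∑ j, (w i).1 j ^ 2 := by fun_prop
      exact measurableSet_le this measurable_const
  · have : Measurable fun w : ι → Col m => ∑ j, uSol b w j ^ 2 := by fun_prop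
    exact measurableSet_le this measurable_const

/-- Event on the pair. -/
def Epair {κ ι : Type*} [Fintype ι] {m : ℕ} (b : Fin m → ℝ) (M R : ℝ) :
    Set ((κ → Col m) × (ι → Col m)) :=
  {q | q.2 ∈ Hset b M R ∧ ∀ i, rc (q.1 i) (uSol b q.2) < 0}

/-- Bad event on the pair. -/
def Bpair {κ ι : Type*} [Fintype ι] {m : ℕ} (b : Fin m → ℝ) (M R : ℝ) (s : ℕ) (δ η : ℝ) :
    Set ((κ → Col m) × (ι → Col m)) :=
  {q | q ∈ (Epair b M R : Set ((κ → Col m) × (ι → Col m))) ∧ ∀ U, validU b q.2 M U → ∀ T : Finset κ,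
    ¬ goodSel s (yv b q.2 U (2 * m * δ) (s * η)) δ η T
      (fun i => (rot (uSol b q.2) (q.1 i)).1) (fun i => (rot (uSol b q.2) (q.1 i)).2)}

lemma Epair_meas {κ ι : Type*} [Fintype κ] [Fintype ι] {m : ℕ} (b : Fin m → ℝ) (M R : ℝ) :
    MeasurableSet (Epair b M R : Set ((κ → Col m) × (ι → Col m))) := by
  have h1 : Measurable fun q : (κ → Col m) × (ι → Col m) => uSol b q.2 :=
    (uSol_meas (ι := ι) b).comp measurable_snd
  apply MeasurableSet.inter
  · exact measurable_snd (Hset_meas b M R)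
  · have : {q : (κ → Col m) × (ι → Col m) | ∀ i, rc (q.1 i) (uSol b q.2) < 0}
        = ⋂ i, {q | rc (q.1 i) (uSol b q.2) < 0} := by
      ext w; simp
    change MeasurableSet {q : (κ → Col m) × (ι → Col m) | ∀ i, rc (q.1 i) (uSol b q.2) < 0}
    rw [this]
    refine MeasurableSet.iInter fun i => ?_
    exact measurableSet_lt (rc_meas h1 (by fun_prop)) measurable_const

lemma Bpair_meas {κ ι : Type*} [Fintype κ] [Fintype ι] {m : ℕ} (b : Fin m → ℝ) (M R : ℝ) (s : ℕ)
    (δ η : ℝ) : MeasurableSet (Bpair b M R s δ η : Set ((κ → Col m) × (ι → Col m))) := by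
  have h1 : Measurable fun q : (κ → Col m) × (ι → Col m) => uSol b q.2 :=
    (uSol_meas (ι := ι) b).comp measurable_snd
  apply MeasurableSet.inter
  · exact Epair_meas b M R
  · have hr : Measurable fun (q : (κ → Col m) × (ι → Col m)) (i : κ) => rot (uSol b q.2) (q.1 i) :=
      measurable_pi_lambda _ fun i => rot_meas h1 (by fun_prop)
    have : {q : (κ → Col m) × (ι → Col m) | ∀ U, validU b q.2 M U → ∀ T : Finset κ,
        ¬ goodSel s (yv b q.2 U (2 * m * δ) (s * η)) δ η T
        (fun i => (rot (uSol b q.2) (q.1 i)).1) (fun i => (rot (uSol b q.2) (q.1 i)).2)}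
        = ⋂ U, ({q | validU b q.2 M U}ᶜ ∪ ⋂ T : Finset κ,
          {q | goodSel s (yv b q.2 U (2 * m * δ) (s * η)) δ η T
        (fun i => (rot (uSol b q.2) (q.1 i)).1) (fun i => (rot (uSol b q.2) (q.1 i)).2)}ᶜ) := by
      ext q; simp [imp_iff_not_or]
    change MeasurableSet {q : (κ → Col m) × (ι → Col m) | ∀ U, validU b q.2 M U → ∀ T : Finset κ,
        ¬ goodSel s (yv b q.2 U (2 * m * δ) (s * η)) δ η T
        (fun i => (rot (uSol b q.2) (q.1 i)).1) (fun i => (rot (uSol b q.2) (q.1 i)).2)}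
    rw [this]
    refine MeasurableSet.iInter fun U => MeasurableSet.union
      (measurable_snd (validU_meas b M U)).compl (MeasurableSet.iInter fun T => ?_)
    refine (goodSel_meas s _ δ η T _ _ ((yv_meas b U _ _).comp measurable_snd) ?_ ?_).compl
    · exact measurable_pi_lambda _ fun i => ((measurable_pi_apply i).comp hr).fst
    · exact measurable_pi_lambda _ fun i => ((measurable_pi_apply i).comp hr).snd

lemma half_meas {κ : Type*} [Fintype κ] {m : ℕ} (u : Fin m → ℝ) :
    (Measure.pi fun _ : κ => colM m) {z | ∀ i, rc (z i) u < 0}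
      = ENNReal.ofReal ((1 / 2) ^ Fintype.card κ) := by
  have h1 : {z : κ → Col m | ∀ i, rc (z i) u < 0} = Set.univ.pi fun _ => {z : Col m | rc z u < 0} := by
    ext z; simp
  have h2 : {z : Col m | rc z u < 0} = rot u ⁻¹' (Set.univ ×ˢ Set.Ioi 0) := by
    ext z
    have := rot_snd u z
    have := one_le_sg u
    simp only [Set.mem_ofPred_eq, Set.mem_preimage, Set.mem_prod, Set.mem_univ, true_and, Set.mem_Ioi]
    constructor
    · intro h; by_contra hc; push Not at hc; nlinarith
    · intro h; nlinarith
  have h3 : colM m {z : Col m | rc z u < 0} = ENNReal.ofReal (1 / 2) := by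
    rw [h2, (mp_rot u).measure_preimage (MeasurableSet.univ.prod measurableSet_Ioi).nullMeasurableSet,
      Measure.prod_prod, measure_univ, one_mul, ← gm_Ioi, ofReal_measureReal]
  rw [h1, Measure.pi_pi]
  simp only [h3, Finset.prod_const, Finset.card_univ]
  rw [ENNReal.ofReal_pow (by norm_num)]

lemma mp_rots {κ : Type*} [Fintype κ] {m : ℕ} (u : Fin m → ℝ) :
    MeasurePreserving (fun (z : κ → Col m) i => rot u (z i)) (Measure.pi fun _ : κ => colM m)
      (Measure.pi fun _ : κ => colM m) :=
  measurePreserving_pi _ _ fun _ => mp_rot u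

lemma noSel_meas {ι : Type*} [Fintype ι] {m : ℕ} (s : ℕ) (y : Fin m → ℝ) (δ η : ℝ) :
    MeasurableSet (noSel s y δ η : Set (ι → Col m)) := by
  apply MeasurableSet.inter
  · have : {z : ι → Col m | ∀ i, 0 < (z i).2} = ⋂ i, {z | 0 < (z i).2} := by ext; simp
    change MeasurableSet {z : ι → Col m | ∀ i, 0 < (z i).2}
    rw [this]
    exact MeasurableSet.iInter fun i => measurableSet_lt measurable_const (by fun_prop)
  · have : {z : ι → Col m | ∀ S : Finset ι, ¬ goodSel s y δ η S (fun i => (z i).1) (fun i => (z i).2)}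
        = ⋂ S : Finset ι, {z | goodSel s y δ η S (fun i => (z i).1) (fun i => (z i).2)}ᶜ := by
      ext; simp
    change MeasurableSet {z : ι → Col m | ∀ S : Finset ι,
      ¬ goodSel s y δ η S (fun i => (z i).1) (fun i => (z i).2)}
    rw [this]
    refine MeasurableSet.iInter fun S => (goodSel_meas s _ δ η S _ _ measurable_const ?_ ?_).compl
    · fun_prop
    · fun_prop

lemma pair_bound {κ ι : Type*} [Fintype κ] [Fintype ι] {m : ℕ} (b : Fin m → ℝ) (M R : ℝ) (s q T : ℕ)
    (δ η P : ℝ) (hM : 0 ≤ M) (hP : 0 ≤ P) (hη0 : 0 ≤ η) (hη1 : η ≤ 1)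
    (hy : ∀ y : Fin m → ℝ, ∑ j, y j ^ 2 ≤
        (1 + R) * (4 * (m * M / 4 + (1 + R) + m * (2 * m * δ) ^ 2 + (s * η) ^ 2)) →
      1 / 1000 ≤ (poolM m s q).real (⋃ f : Fin s → Fin q, selE y δ f))
    (hPT : (1 - 1 / 1000) ^ T + Real.exp (T * (s * q) - η * Fintype.card κ / 4) ≤ P) :
    ((Measure.pi fun _ : κ => colM m).prod (Measure.pi fun _ : ι => colM m)) (Bpair b M R s δ η)
      ≤ ENNReal.ofReal P *
        ((Measure.pi fun _ : κ => colM m).prod (Measure.pi fun _ : ι => colM m)) (Epair b M R) := by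
  rw [Measure.prod_apply_symm (Bpair_meas b M R s δ η), Measure.prod_apply_symm (Epair_meas b M R),
    ← lintegral_const_mul']
  swap
  · exact ENNReal.ofReal_ne_top
  refine lintegral_mono fun w => ?_
  by_cases hw : w ∈ (Hset b M R : Set (ι → Col m))
  · obtain ⟨U, hU⟩ := exists_valid b w M hM fun i => (hw.1 i).2
    have hE : (fun z => (z, w)) ⁻¹' (Epair b M R : Set ((κ → Col m) × (ι → Col m)))
        = {z | ∀ i, rc (z i) (uSol b w) < 0} := by
      ext z
      exact ⟨fun h => h.2, fun h => ⟨hw, h⟩⟩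
    rw [hE, half_meas]
    have hsg : sg (uSol b w) ^ 2 ≤ 1 + R := by rw [sg_sq]; linarith [hw.2]
    have hsg0 : 0 ≤ sg (uSol b w) ^ 2 := sq_nonneg _
    set y := yv b w U (2 * m * δ) (s * η) with hydef
    have hB : (fun z => (z, w)) ⁻¹' (Bpair b M R s δ η : Set ((κ → Col m) × (ι → Col m)))
        ⊆ (fun (z : κ → Col m) i => rot (uSol b w) (z i)) ⁻¹' (noSel s y δ η) := by
      intro z hz
      refine ⟨fun i => ?_, fun S => hz.2 U hU S⟩
      have h1 := hz.1.2 i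
      have h2 := rot_snd (uSol b w) (z i)
      have h3 := one_le_sg (uSol b w)
      simp only at h1
      by_contra hc
      push Not at hc
      nlinarith
    refine (measure_mono hB).trans ?_
    rw [(mp_rots (uSol b w)).measure_preimage (noSel_meas s y δ η).nullMeasurableSet]
    refine (cond_bound (q := q) (T := T) y δ η (1 / 1000) hη0 hη1 (hy y ?_) (by norm_num)
      (by norm_num)).trans ?_
    · refine (yv_norm b w M U hU _ _).trans ?_
      gcongr
      linarith
    · rw [← ENNReal.ofReal_mul hP]
      apply ENNReal.ofReal_le_ofReal
      rw [mul_comm]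
      exact mul_le_mul_of_nonneg_right hPT (by positivity)
  · have hB : (fun z => (z, w)) ⁻¹' (Bpair b M R s δ η : Set ((κ → Col m) × (ι → Col m))) = ∅ := by
      ext z
      simp only [Set.mem_preimage, Set.mem_empty_iff_false, iff_false]
      exact fun h => hw h.1.1
    rw [hB]
    simp

end GapProof

namespace GapProof

open Classical in
/-- Splitting of the columns. -/
noncomputable def spl {n m : ℕ} (p : Fin n → Prop) (ω : Fin n → Col m) :
    ({i // p i} → Col m) × ({i // ¬ p i} → Col m) := (fun i => ω i, fun i => ω i)

open Classical in
lemma mp_spl {n m : ℕ} (p : Fin n → Prop) :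
    MeasurePreserving (spl (m := m) p) (Measure.pi fun _ : Fin n => colM m)
      ((Measure.pi fun _ : {i // p i} => colM m).prod (Measure.pi fun _ : {i // ¬ p i} => colM m)) :=
  measurePreserving_piEquivPiSubtypeProd (fun _ : Fin n => colM m) p

open Classical in
lemma E_iff {n m : ℕ} (b : Fin m → ℝ) (M R : ℝ) (p : Fin n → Prop) (ω : Fin n → Col m)
    (h : spl p ω ∈ (Epair b M R : Set (({i // p i} → Col m) × ({i // ¬ p i} → Col m)))) (i : Fin n) :
    p i ↔ rc (ω i) (uSol b ω) < 0 := by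
  have h1 := sol_extend b ω p fun i hi => h.2 ⟨i, hi⟩
  constructor
  · intro hi
    rw [h1]
    exact h.2 ⟨i, hi⟩
  · intro hlt
    by_contra hi
    rw [h1] at hlt
    have := (h.1.1 ⟨i, hi⟩).1
    simp only [spl] at this
    linarith

open Classical in
lemma union_bound {n m : ℕ} (b : Fin m → ℝ) (M R : ℝ) (s q T : ℕ)
    (δ η P : ℝ) (hM : 0 ≤ M) (hP : 0 ≤ P) (hη0 : 0 ≤ η) (hη1 : η ≤ 1)
    (hy : ∀ y : Fin m → ℝ, ∑ j, y j ^ 2 ≤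
        (1 + R) * (4 * (m * M / 4 + (1 + R) + m * (2 * m * δ) ^ 2 + (s * η) ^ 2)) →
      1 / 1000 ≤ (poolM m s q).real (⋃ f : Fin s → Fin q, selE y δ f))
    (hPT : (1 - 1 / 1000) ^ T + Real.exp (T * (s * q) - η * n / 16) ≤ P) :
    (Measure.pi fun _ : Fin n => colM m) {ω | ∃ p : Fin n → Prop,
      (n : ℝ) ≤ 4 * Fintype.card {i // p i} ∧
      spl p ω ∈ (Bpair b M R s δ η : Set (({i // p i} → Col m) × ({i // ¬ p i} → Col m)))}
      ≤ ENNReal.ofReal P := by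
  set μ := Measure.pi fun _ : Fin n => colM m with hμ
  let B : (Fin n → Prop) → Set (Fin n → Col m) := fun p => {ω | (n : ℝ) ≤ 4 * Fintype.card {i // p i} ∧
      spl p ω ∈ (Bpair b M R s δ η : Set (({i // p i} → Col m) × ({i // ¬ p i} → Col m)))}
  let E : (Fin n → Prop) → Set (Fin n → Col m) := fun p =>
      spl p ⁻¹' (Epair b M R : Set (({i // p i} → Col m) × ({i // ¬ p i} → Col m)))
  have hEm : ∀ p, MeasurableSet (E p) := fun p => (mp_spl p).measurable (Epair_meas b M R)
  have hd : Pairwise (Function.onFun Disjoint E) := by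
    intro p p' hne
    rw [Function.onFun, Set.disjoint_left]
    intro ω h h'
    apply hne
    funext i
    exact propext ((E_iff b M R p ω h i).trans (E_iff b M R p' ω h' i).symm)
  have hB : ∀ p, μ (B p) ≤ ENNReal.ofReal P * μ (E p) := by
    intro p
    by_cases hp : (n : ℝ) ≤ 4 * Fintype.card {i // p i}
    · have h1 : B p ⊆ spl p ⁻¹' (Bpair b M R s δ η) := fun ω h => h.2
      refine (measure_mono h1).trans ?_
      rw [(mp_spl p).measure_preimage (Bpair_meas b M R s δ η).nullMeasurableSet]
      have h2 : μ (E p) = _ := (mp_spl p).measure_preimage (Epair_meas b M R).nullMeasurableSet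
      rw [h2]
      apply pair_bound b M R s q T δ η P hM hP hη0 hη1 hy
      refine le_trans ?_ hPT
      refine add_le_add le_rfl (Real.exp_le_exp.mpr ?_)
      nlinarith
    · have : B p = ∅ := by
        ext ω
        simp only [Set.mem_empty_iff_false, iff_false]
        exact fun h => hp h.1
      rw [this]; simp
  have hU : {ω | ∃ p : Fin n → Prop, (n : ℝ) ≤ 4 * Fintype.card {i // p i} ∧
      spl p ω ∈ (Bpair b M R s δ η : Set (({i // p i} → Col m) × ({i // ¬ p i} → Col m)))}
      = ⋃ p, B p := by
    ext ω; simp [B]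
  rw [hU]
  calc μ (⋃ p, B p) ≤ ∑ p, μ (B p) := measure_iUnion_fintype_le _ _
    _ ≤ ∑ p, ENNReal.ofReal P * μ (E p) := Finset.sum_le_sum fun p _ => hB p
    _ = ENNReal.ofReal P * μ (⋃ p, E p) := by
        rw [← Finset.mul_sum, measure_iUnion hd hEm, tsum_fintype]
    _ ≤ ENNReal.ofReal P * 1 := by gcongr; exact prob_le_one
    _ = _ := mul_one _

/-- The good event. -/
def Gset {n m : ℕ} (b : Fin m → ℝ) (M R : ℝ) : Set (Fin n → Col m) :=
  {ω | ∑ j, uSol b ω j ^ 2 ≤ R ∧ (∀ i, ∑ j, (ω i).1 j ^ 2 ≤ M) ∧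
    ∃ S : Finset (Fin n), (n : ℝ) ≤ 4 * S.card ∧ ∀ i ∈ S, rc (ω i) (uSol b ω) < 0}

open Classical in
lemma good_bound {n m : ℕ} (b : Fin m → ℝ) (M R : ℝ) (s q T : ℕ)
    (δ η P : ℝ) (hM : 0 ≤ M) (hP : 0 ≤ P) (hη0 : 0 ≤ η) (hη1 : η ≤ 1) (hδ : 0 ≤ δ)
    (hy : ∀ y : Fin m → ℝ, ∑ j, y j ^ 2 ≤
        (1 + R) * (4 * (m * M / 4 + (1 + R) + m * (2 * m * δ) ^ 2 + (s * η) ^ 2)) →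
      1 / 1000 ≤ (poolM m s q).real (⋃ f : Fin s → Fin q, selE y δ f))
    (hPT : (1 - 1 / 1000) ^ T + Real.exp (T * (s * q) - η * n / 16) ≤ P) :
    (Measure.pi fun _ : Fin n => colM m) {ω | ω ∈ (Gset b M R : Set (Fin n → Col m)) ∧
      (2 * s * η + 4 * m ^ 2 * δ) * Real.sqrt (1 + R) <
        IPGAP (Matrix.of fun i j => (ω j).1 i) b (fun j => (ω j).2)}
      ≤ ENNReal.ofReal P := by
  refine (measure_mono ?_).trans (union_bound b M R s q T δ η P hM hP hη0 hη1 hy hPT)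
  rintro ω ⟨⟨hR, hMb, S, hS, hSrc⟩, hgap⟩
  let p : Fin n → Prop := fun i => rc (ω i) (uSol b ω) < 0
  have hres := sol_restrict b ω p fun i => Iff.rfl
  refine ⟨p, ?_, ⟨⟨⟨fun i => ⟨?_, hMb i⟩, ?_⟩, fun i => ?_⟩, fun U hU T hT => ?_⟩⟩
  · have : S.card ≤ Fintype.card {i // p i} := by
      rw [Fintype.card_subtype]
      exact Finset.card_le_card fun i hi => by simpa [p] using hSrc i hi
    have : (S.card : ℝ) ≤ Fintype.card {i // p i} := by exact_mod_cast this
    linarith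
  · change 0 ≤ rc (ω i) (uSol b fun i : {i // ¬ p i} => ω i)
    rw [hres]
    exact not_lt.mp i.2
  · change ∑ j, (uSol b fun i : {i // ¬ p i} => ω i) j ^ 2 ≤ R
    rw [hres]; exact hR
  · change rc (ω i) (uSol b fun i : {i // ¬ p i} => ω i) < 0
    rw [hres]; exact i.2
  · have := good_gap b ω p s M δ η hδ (fun i => by rw [hres]; exact i.2)
      (fun i => by rw [hres]; exact not_lt.mp i.2) U hU T hT
    rw [hres] at this
    have h2 : sg (uSol b ω) ≤ Real.sqrt (1 + R) := Real.sqrt_le_sqrt (by linarith)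
    have h3 : (2 * s * η + 4 * m ^ 2 * δ) * sg (uSol b ω)
        ≤ (2 * s * η + 4 * m ^ 2 * δ) * Real.sqrt (1 + R) :=
      mul_le_mul_of_nonneg_left h2 (by positivity)
    linarith

end GapProof

namespace GapProof

/-- Grid points. -/
noncomputable def gp {m : ℕ} (n : ℕ) (k : Fin m → Fin (200 * n + 1)) : Fin m → ℝ :=
  fun j => (k j : ℝ) / n

open Classical in
/-- Regular instances. -/
def Reg {n m : ℕ} (M : ℝ) : Set (Fin n → Col m) :=
  {ω | (∀ i, ∑ j, (ω i).1 j ^ 2 ≤ M) ∧ ∑ i, (ω i).2 ^ 2 ≤ 4 * n ∧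
    ∀ k : Fin m → Fin (200 * n + 1),
      (n : ℝ) / 4 ≤ (Finset.univ.filter fun i => sg (gp n k) / 2 ≤ rc (ω i) (gp n k)).card ∧
      (n : ℝ) / 4 ≤ (Finset.univ.filter fun i => rc (ω i) (gp n k) ≤ - (sg (gp n k) / 2)).card}

lemma near_grid {m n : ℕ} (hn : 1 ≤ n) (v : Fin m → ℝ) (hv : ∀ j, 0 ≤ v j)
    (hR : ∑ j, v j ^ 2 ≤ 40000) :
    ∃ k : Fin m → Fin (200 * n + 1), ∀ j, |v j - gp n k j| ≤ 1 / n := by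
  have hn0 : (0:ℝ) < n := by exact_mod_cast hn
  have hb : ∀ j, ⌊v j * n⌋₊ < 200 * n + 1 := by
    intro j
    have h1 := Finset.single_le_sum (f := fun j => v j ^ 2) (fun _ _ => sq_nonneg _) (Finset.mem_univ j)
    have h2 : v j ≤ 200 := by
      have : v j ^ 2 ≤ 200 ^ 2 := by norm_num; linarith
      exact (abs_le_of_sq_le_sq' this (by norm_num)).2
    have h3 : (⌊v j * n⌋₊ : ℝ) ≤ 200 * n :=
      (Nat.floor_le (mul_nonneg (hv j) hn0.le)).trans (by nlinarith)
    have : ⌊v j * n⌋₊ ≤ 200 * n := by exact_mod_cast h3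
    omega
  refine ⟨fun j => ⟨⌊v j * n⌋₊, hb j⟩, fun j => ?_⟩
  have h1 := Nat.floor_le (mul_nonneg (hv j) hn0.le)
  have h2 := Nat.lt_floor_add_one (v j * n)
  simp only [gp]
  have h3 : v j - (⌊v j * n⌋₊ : ℝ) / n = (v j * n - ⌊v j * n⌋₊) / n := by field_simp
  rw [h3, abs_of_nonneg (div_nonneg (by linarith) hn0.le)]
  gcongr
  linarith

lemma rc_near {m n : ℕ} (hn : 1 ≤ n) (M : ℝ) (hMn : 64 * (M * m) ≤ n ^ 2) (z : Col m)
    (hz : ∑ j, z.1 j ^ 2 ≤ M) (v v' : Fin m → ℝ) (h : ∀ j, |v j - v' j| ≤ 1 / n) :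
    |rc z v - rc z v'| ≤ 1 / 8 := by
  have hn0 : (0:ℝ) < n := by exact_mod_cast hn
  have e : rc z v - rc z v' = - ∑ j, z.1 j * (v j - v' j) := by
    simp only [rc, mul_sub, Finset.sum_sub_distrib]; ring
  rw [e, abs_neg]
  apply abs_le_of_sq_le_sq _ (by norm_num)
  have h1 : (∑ j, z.1 j * (v j - v' j)) ^ 2 ≤ (∑ j, z.1 j ^ 2) * ∑ j, (v j - v' j) ^ 2 :=
    Finset.sum_mul_sq_le_sq_mul_sq _ _ _
  have h2 : ∑ j, (v j - v' j) ^ 2 ≤ m * (1 / n) ^ 2 := by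
    have : ∀ j ∈ Finset.univ, (v j - v' j) ^ 2 ≤ (1 / (n:ℝ)) ^ 2 := fun j _ => by
      rw [← sq_abs]
      exact pow_le_pow_left₀ (abs_nonneg _) (h j) 2
    simpa [nsmul_eq_mul] using Finset.sum_le_card_nsmul _ _ _ this
  have h0 : 0 ≤ ∑ j, z.1 j ^ 2 := Finset.sum_nonneg fun _ _ => sq_nonneg _
  have h3 : (∑ j, z.1 j ^ 2) * ∑ j, (v j - v' j) ^ 2 ≤ M * (m * (1 / n) ^ 2) :=
    mul_le_mul hz h2 (Finset.sum_nonneg fun _ _ => sq_nonneg _) (h0.trans hz)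
  have h4 : M * (m * (1 / n) ^ 2) ≤ (1 / 8) ^ 2 := by
    have : M * (m * (1 / (n:ℝ)) ^ 2) = M * m / n ^ 2 := by ring
    rw [this, div_le_iff₀ (by positivity)]
    linarith
  linarith

lemma sg_near {m n : ℕ} (hn : 1 ≤ n) (hmn : m ≤ n ^ 2) (v v' : Fin m → ℝ)
    (h : ∀ j, |v j - v' j| ≤ 1 / n) (hv : ∑ j, v j ^ 2 = 40000) : 199 ≤ sg v' := by
  have hn0 : (0:ℝ) < n := by exact_mod_cast hn
  have h2 : ∑ j, (v j - v' j) ^ 2 ≤ 1 := by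
    have : ∀ j ∈ Finset.univ, (v j - v' j) ^ 2 ≤ (1 / (n:ℝ)) ^ 2 := fun j _ => by
      rw [← sq_abs]
      exact pow_le_pow_left₀ (abs_nonneg _) (h j) 2
    have := Finset.sum_le_card_nsmul _ _ _ this
    simp only [Finset.card_univ, Fintype.card_fin, nsmul_eq_mul] at this
    refine this.trans ?_
    have : (m:ℝ) * (1 / n) ^ 2 = m / n ^ 2 := by ring
    rw [this, div_le_one (by positivity)]
    exact_mod_cast hmn
  apply Real.le_sqrt_of_sq_le
  have h3 : ∀ j, (199 / 200) * v j ^ 2 - 199 * (v j - v' j) ^ 2 ≤ v' j ^ 2 := fun j => by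
    nlinarith [sq_nonneg (v j - 200 * (v j - v' j))]
  have h4 := Finset.sum_le_sum fun j (_ : j ∈ Finset.univ) => h3 j
  rw [Finset.sum_sub_distrib, ← Finset.mul_sum, ← Finset.mul_sum, hv] at h4
  linarith

lemma reg_good {m n : ℕ} (hn : 1 ≤ n) (M : ℝ) (hMn : 64 * (M * m) ≤ n ^ 2) (hmn : m ≤ n ^ 2)
    (b : Fin m → ℝ) (hb : Real.sqrt (∑ j, min (b j) 0 ^ 2) ≤ n / 10) (ω : Fin n → Col m)
    (hω : ω ∈ (Reg M : Set (Fin n → Col m))) : ω ∈ (Gset b M 40000 : Set (Fin n → Col m)) := by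
  classical
  obtain ⟨hM, hc, hk⟩ := hω
  have hn0 : (0:ℝ) < n := by exact_mod_cast hn
  set u := uSol b ω with hu
  have hu0 : ∀ j, 0 ≤ u j := uSol_nonneg b ω
  have hS : ∑ i, max 0 (ω i).2 ≤ 2 * n := by
    have h1 : ∀ i, max 0 (ω i).2 ≤ 1 + (ω i).2 ^ 2 / 4 := fun i => by
      apply max_le
      · positivity
      · nlinarith [sq_nonneg ((ω i).2 / 2 - 1)]
    have h2 := Finset.sum_le_sum fun i (_ : i ∈ Finset.univ) => h1 i
    rw [Finset.sum_add_distrib, ← Finset.sum_div] at h2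
    simp at h2
    linarith
  have hR : ∑ j, u j ^ 2 ≤ 40000 := by
    by_contra hcon
    push Not at hcon
    set r := Real.sqrt (∑ j, u j ^ 2) with hr
    have hr2 : r ^ 2 = ∑ j, u j ^ 2 := Real.sq_sqrt (by linarith)
    have hr200 : 200 < r := by
      apply Real.lt_sqrt_of_sq_lt; norm_num; linarith
    set θ := 200 / r with hθ
    have hθ0 : 0 < θ := by positivity
    have hθ1 : θ < 1 := by rw [hθ, div_lt_one (by linarith)]; exact hr200
    have hθr : θ * r = 200 := by rw [hθ]; field_simp
    let v : Fin m → ℝ := fun j => θ * u j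
    have hv : ∑ j, v j ^ 2 = 40000 := by
      simp only [v, mul_pow, ← Finset.mul_sum]
      rw [← hr2, ← mul_pow, hθr]; norm_num
    obtain ⟨k, hk'⟩ := near_grid hn v (fun j => mul_nonneg hθ0.le (hu0 j)) hv.le
    have hsg := sg_near hn hmn v (gp n k) hk' hv
    have hcnt := (hk k).1
    have h1 : (n:ℝ) / 4 * 99 ≤ ∑ i, max 0 (rc (ω i) v) := by
      calc (n:ℝ) / 4 * 99
          ≤ (Finset.univ.filter fun i => sg (gp n k) / 2 ≤ rc (ω i) (gp n k)).card * 99 := by gcongr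
        _ = ∑ i ∈ Finset.univ.filter fun i => sg (gp n k) / 2 ≤ rc (ω i) (gp n k), (99:ℝ) := by
            rw [Finset.sum_const, nsmul_eq_mul]
        _ ≤ ∑ i ∈ Finset.univ.filter fun i => sg (gp n k) / 2 ≤ rc (ω i) (gp n k),
              max 0 (rc (ω i) v) := by
            refine Finset.sum_le_sum fun i hi => ?_
            have h2 := (Finset.mem_filter.mp hi).2
            have h3 := (abs_le.mp (rc_near hn M hMn (ω i) (hM i) v (gp n k) hk')).1
            exact le_max_of_le_right (by linarith)
        _ ≤ _ := Finset.sum_le_sum_of_subset_of_nonneg (Finset.subset_univ _)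
              fun _ _ _ => le_max_left _ _
    have h2 : ∀ i, max 0 (rc (ω i) v) ≤ (1 - θ) * max 0 (ω i).2 + θ * max 0 (rc (ω i) u) := by
      intro i
      have e : rc (ω i) v = (1 - θ) * (ω i).2 + θ * rc (ω i) u := by
        have : ∑ j, (ω i).1 j * v j = θ * ∑ j, (ω i).1 j * u j := by
          rw [Finset.mul_sum]; exact Finset.sum_congr rfl fun j _ => by simp only [v]; ring
        simp only [rc]; rw [this]; ring
      apply max_le
      · have := le_max_left 0 (ω i).2
        have := le_max_left 0 (rc (ω i) u)
        have := sub_pos.mpr hθ1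
        positivity
      · rw [e]
        have := sub_pos.mpr hθ1
        gcongr
        · exact le_max_right _ _
        · exact le_max_right _ _
    have h3 := Finset.sum_le_sum fun i (_ : i ∈ Finset.univ) => h2 i
    rw [Finset.sum_add_distrib, ← Finset.mul_sum, ← Finset.mul_sum] at h3
    have h4 := sol_identity b ω
    rw [← hu] at h4
    have h5 : - (n / 10 * r) ≤ ∑ j, b j * u j := by
      have h6 : ∑ j, min (b j) 0 * u j ≤ ∑ j, b j * u j :=
        Finset.sum_le_sum fun j _ => mul_le_mul_of_nonneg_right (min_le_left _ _) (hu0 j)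
      have h7 : |∑ j, min (b j) 0 * u j| ≤ n / 10 * r := by
        have : (∑ j, min (b j) 0 * u j) ^ 2 ≤ (∑ j, min (b j) 0 ^ 2) * ∑ j, u j ^ 2 :=
          Finset.sum_mul_sq_le_sq_mul_sq _ _ _
        refine (Real.abs_le_sqrt this).trans ?_
        rw [Real.sqrt_mul (Finset.sum_nonneg fun _ _ => sq_nonneg _)]
        exact mul_le_mul_of_nonneg_right hb (Real.sqrt_nonneg _)
      have := (abs_le.mp h7).1
      linarith
    have h8 : ∑ i, max 0 (rc (ω i) u) ≤ ∑ i, max 0 (ω i).2 + n / 10 * r := by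
      have : 0 ≤ ∑ j, u j ^ 2 := by linarith
      linarith
    have h9 : θ * ∑ i, max 0 (rc (ω i) u) ≤ θ * (∑ i, max 0 (ω i).2 + n / 10 * r) :=
      mul_le_mul_of_nonneg_left h8 hθ0.le
    have h10 : θ * (n / 10 * r) = n / 10 * 200 := by rw [← hθr]; ring
    nlinarith
  refine ⟨hR, hM, ?_⟩
  obtain ⟨k, hk'⟩ := near_grid hn u hu0 hR
  refine ⟨Finset.univ.filter fun i => rc (ω i) (gp n k) ≤ - (sg (gp n k) / 2), ?_, fun i hi => ?_⟩
  · have := (hk k).2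
    linarith
  · have h2 := (Finset.mem_filter.mp hi).2
    have h3 := (abs_le.mp (rc_near hn M hMn (ω i) (hM i) u (gp n k) hk')).2
    have := one_le_sg (gp n k)
    linarith

end GapProof

namespace GapProof

lemma cher_num (n : ℕ) (p : ℝ) (hp : 3 / 10 ≤ p) (hp1 : p ≤ 1) :
    Real.exp (1 / 5 * (n / 4)) * (1 - (1 - Real.exp (-(1 / 5))) * p) ^ n ≤ Real.exp (-(n / 250)) := by
  have h1 : Real.exp (-(1 / 5)) ≤ 82 / 100 := by
    have h2 : Real.exp (1 / 5) ≥ 1 / 5 + 1 + (1/5)^2/2 := by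
      have := Real.quadratic_le_exp_of_nonneg (show (0:ℝ) ≤ 1 / 5 by norm_num)
      linarith
    rw [Real.exp_neg, inv_le_comm₀ (Real.exp_pos _) (by norm_num)]
    norm_num at h2 ⊢
    linarith
  have h3 : 1 - (1 - Real.exp (-(1 / 5))) * p ≤ Real.exp (-(54 / 1000)) := by
    have := Real.add_one_le_exp (-(54 / 1000) : ℝ)
    nlinarith
  have h4 : 0 ≤ 1 - (1 - Real.exp (-(1 / 5))) * p := by
    have := Real.exp_pos (-(1 / 5))
    nlinarith
  calc Real.exp (1 / 5 * (n / 4)) * (1 - (1 - Real.exp (-(1 / 5))) * p) ^ n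
      ≤ Real.exp (1 / 5 * (n / 4)) * Real.exp (-(54 / 1000)) ^ n := by gcongr
    _ = Real.exp (-(n / 250)) := by
        rw [← Real.exp_nat_mul, ← Real.exp_add]; congr 1; ring

lemma pos_meas {m : ℕ} (v : Fin m → ℝ) : 3 / 10 ≤ (colM m).real {z | sg v / 2 ≤ rc z v} := by
  have h2 : {z : Col m | sg v / 2 ≤ rc z v} = rot v ⁻¹' (Set.univ ×ˢ Set.Iic (-(1/2))) := by
    ext z
    have := rot_snd v z
    have := one_le_sg v
    simp only [Set.mem_ofPred_eq, Set.mem_preimage, Set.mem_prod, Set.mem_univ, true_and, Set.mem_Iic]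
    constructor
    · intro h; by_contra hc; push Not at hc; nlinarith
    · intro h; nlinarith
  rw [Measure.real, h2, (mp_rot v).measure_preimage
    (MeasurableSet.univ.prod measurableSet_Iic).nullMeasurableSet,
    Measure.prod_prod, measure_univ, one_mul]
  exact gm_Iic

lemma neg_meas {m : ℕ} (v : Fin m → ℝ) : 3 / 10 ≤ (colM m).real {z | rc z v ≤ -(sg v / 2)} := by
  have h2 : {z : Col m | rc z v ≤ -(sg v / 2)} = rot v ⁻¹' (Set.univ ×ˢ Set.Ici (1/2)) := by
    ext z
    have := rot_snd v z
    have := one_le_sg v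
    simp only [Set.mem_ofPred_eq, Set.mem_preimage, Set.mem_prod, Set.mem_univ, true_and, Set.mem_Ici]
    constructor
    · intro h; by_contra hc; push Not at hc; nlinarith
    · intro h; nlinarith
  rw [Measure.real, h2, (mp_rot v).measure_preimage
    (MeasurableSet.univ.prod measurableSet_Ici).nullMeasurableSet,
    Measure.prod_prod, measure_univ, one_mul]
  exact gm_Ici

open Classical in
lemma cnt_bound {n m : ℕ} (P : Set (Col m)) (hPm : MeasurableSet P) (hP : 3 / 10 ≤ (colM m).real P) :
    (Measure.pi fun _ : Fin n => colM m) {ω | ¬ (n : ℝ) / 4 ≤ (Finset.univ.filter fun i => ω i ∈ P).card}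
      ≤ ENNReal.ofReal (Real.exp (-(n / 250))) := by
  have h := chernoff (ι := Fin n) (colM m) Set.univ P MeasurableSet.univ hPm (Set.subset_univ _)
    (1 / 5) (n / 4) (by norm_num)
  refine (measure_mono ?_).trans (h.trans (ENNReal.ofReal_le_ofReal ?_))
  · intro ω hω
    exact ⟨fun _ => Set.mem_univ _, (not_le.mp hω).le⟩
  · rw [Fintype.card_fin, probReal_univ]
    exact cher_num n _ hP measureReal_le_one

lemma norm_bound {n m : ℕ} (M : ℝ) (i : Fin n) :
    (Measure.pi fun _ : Fin n => colM m) {ω | ¬ ∑ j, (ω i).1 j ^ 2 ≤ M}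
      ≤ ENNReal.ofReal (Real.exp (-(M / 4)) * Real.sqrt 2 ^ m) := by
  have mp1 : MeasurePreserving (fun ω : Fin n → Col m => ω i) (Measure.pi fun _ : Fin n => colM m)
    (colM m) := measurePreserving_eval _ i
  have mp2 : MeasurePreserving (fun z : Col m => z.1) (colM m) (Measure.pi fun _ : Fin m => gm) :=
    measurePreserving_fst
  have hm : MeasurableSet {g : Fin m → ℝ | M ≤ ∑ j, g j ^ 2} :=
    measurableSet_le measurable_const (by fun_prop)
  have h := chi2 (ι := Fin m) M
  rw [← (mp2.comp mp1).measure_preimage hm.nullMeasurableSet, Fintype.card_fin] at h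
  refine (measure_mono ?_).trans h
  intro ω hω
  exact (not_le.mp hω).le

lemma cost_bound {n m : ℕ} :
    (Measure.pi fun _ : Fin n => colM m) {ω | ¬ ∑ i, (ω i).2 ^ 2 ≤ 4 * n}
      ≤ ENNReal.ofReal (Real.exp (-n) * Real.sqrt 2 ^ n) := by
  have mp : MeasurePreserving (fun (ω : Fin n → Col m) i => (ω i).2)
      (Measure.pi fun _ : Fin n => colM m) (Measure.pi fun _ : Fin n => gm) :=
    measurePreserving_pi _ _ fun _ => measurePreserving_snd
  have hm : MeasurableSet {g : Fin n → ℝ | (4 * n : ℝ) ≤ ∑ j, g j ^ 2} :=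
    measurableSet_le measurable_const (by fun_prop)
  have h := chi2 (ι := Fin n) (4 * n)
  rw [← mp.measure_preimage hm.nullMeasurableSet, Fintype.card_fin] at h
  have e : -((4 * n : ℝ) / 4) = - n := by ring
  rw [e] at h
  refine (measure_mono ?_).trans h
  intro ω hω
  exact (not_le.mp hω).le

lemma reg_prob {n m : ℕ} (M : ℝ) :
    (Measure.pi fun _ : Fin n => colM m) (Reg M)ᶜ
      ≤ ENNReal.ofReal (n * (Real.exp (-(M / 4)) * Real.sqrt 2 ^ m) + Real.exp (-n) * Real.sqrt 2 ^ n
        + (200 * n + 1) ^ m * (2 * Real.exp (-(n / 250)))) := by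
  classical
  set μ := Measure.pi fun _ : Fin n => colM m with hμ
  have hsub : (Reg M : Set (Fin n → Col m))ᶜ ⊆
      ((⋃ i, {ω | ¬ ∑ j, (ω i).1 j ^ 2 ≤ M}) ∪ {ω | ¬ ∑ i, (ω i).2 ^ 2 ≤ 4 * n}) ∪
      ⋃ k : Fin m → Fin (200 * n + 1),
        ({ω | ¬ (n : ℝ) / 4 ≤
            (Finset.univ.filter fun i => ω i ∈ {z | sg (gp n k) / 2 ≤ rc z (gp n k)}).card} ∪
         {ω | ¬ (n : ℝ) / 4 ≤
            (Finset.univ.filter fun i => ω i ∈ {z | rc z (gp n k) ≤ -(sg (gp n k) / 2)}).card}) := by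
    intro ω hω
    by_contra hc
    apply hω
    simp only [Set.mem_union, Set.mem_iUnion, not_or, not_exists] at hc
    obtain ⟨⟨h1, h2⟩, h3⟩ := hc
    refine ⟨fun i => not_not.mp (h1 i), not_not.mp h2, fun k => ⟨?_, ?_⟩⟩
    · have := not_not.mp (h3 k).1
      convert this using 3
      exact Finset.filter_congr (fun _ _ => Iff.rfl)
    · have := not_not.mp (h3 k).2
      convert this using 3
      exact Finset.filter_congr (fun _ _ => Iff.rfl)
  refine (measure_mono hsub).trans ?_
  have hrm : ∀ v : Fin m → ℝ, Measurable fun z : Col m => rc z v := fun v =>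
    rc_meas measurable_const measurable_id
  have h1 : μ (⋃ i, {ω | ¬ ∑ j, (ω i).1 j ^ 2 ≤ M})
      ≤ ENNReal.ofReal (n * (Real.exp (-(M / 4)) * Real.sqrt 2 ^ m)) := by
    refine (measure_iUnion_fintype_le _ _).trans ((Finset.sum_le_sum fun i _ => norm_bound M i).trans ?_)
    rw [Finset.sum_const, Finset.card_univ, Fintype.card_fin, nsmul_eq_mul,
      ← ENNReal.ofReal_natCast, ← ENNReal.ofReal_mul (by positivity)]
  have h3 : μ (⋃ k : Fin m → Fin (200 * n + 1),
        ({ω | ¬ (n : ℝ) / 4 ≤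
            (Finset.univ.filter fun i => ω i ∈ {z | sg (gp n k) / 2 ≤ rc z (gp n k)}).card} ∪
         {ω | ¬ (n : ℝ) / 4 ≤
            (Finset.univ.filter fun i => ω i ∈ {z | rc z (gp n k) ≤ -(sg (gp n k) / 2)}).card}))
      ≤ ENNReal.ofReal ((200 * n + 1) ^ m * (2 * Real.exp (-(n / 250)))) := by
    refine (measure_iUnion_fintype_le _ _).trans ((Finset.sum_le_sum fun k _ =>
      (measure_union_le _ _).trans (add_le_add
        (cnt_bound _ (measurableSet_le measurable_const (hrm _)) (pos_meas (gp n k)))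
        (cnt_bound _ (measurableSet_le (hrm _) measurable_const) (neg_meas (gp n k))))).trans ?_)
    rw [Finset.sum_const, Finset.card_univ, Fintype.card_fun, Fintype.card_fin, Fintype.card_fin,
      nsmul_eq_mul, ← ENNReal.ofReal_add (by positivity) (by positivity),
      ← ENNReal.ofReal_natCast, ← ENNReal.ofReal_mul (by positivity)]
    apply ENNReal.ofReal_le_ofReal
    push_cast
    apply le_of_eq
    ring
  refine (measure_union_le _ _).trans ((add_le_add ((measure_union_le _ _).trans
    (add_le_add h1 cost_bound)) h3).trans ?_)
  rw [← ENNReal.ofReal_add (by positivity) (by positivity),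
    ← ENNReal.ofReal_add (by positivity) (by positivity)]

end GapProof

namespace GapProof

lemma fail_num (m n : ℕ) (hm : 1 ≤ m) (L : ℝ) (hL : L = m + Real.log n) (hn201 : (201 : ℝ) ≤ n)
    (hn : 100000 * (m * L) ≤ n) :
    n * (Real.exp (-(40 * L / 4)) * Real.sqrt 2 ^ m) + Real.exp (-n) * Real.sqrt 2 ^ n
        + (200 * n + 1) ^ m * (2 * Real.exp (-((n : ℝ) / 250))) ≤ (n : ℝ) ^ (-(7 : ℝ)) := by
  have hm1 : (1 : ℝ) ≤ m := by exact_mod_cast hm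
  have hn0 : (0 : ℝ) < n := by linarith
  set l := Real.log n with hl
  have hnl : (n : ℝ) = Real.exp l := (Real.exp_log hn0).symm
  have hl3 : 3 ≤ l := by
    rw [hl, Real.le_log_iff_exp_le hn0]
    have := Real.exp_one_lt_d9
    have h3 : Real.exp 3 = Real.exp 1 ^ 3 := by rw [← Real.exp_nat_mul]; norm_num
    rw [h3]
    calc Real.exp 1 ^ 3 ≤ (3 : ℝ) ^ 3 := by
          apply pow_le_pow_left₀ (Real.exp_pos _).le; linarith
      _ ≤ (n : ℝ) := by linarith
  have h2 : Real.sqrt 2 ≤ Real.exp (1 / 2) := by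
    rw [Real.sqrt_le_left (Real.exp_pos _).le, ← Real.exp_nat_mul]
    have := Real.add_one_le_exp (1 : ℝ)
    norm_num at this ⊢
    linarith
  have hml : l ≤ m * l := by nlinarith
  have hmL : m * l + m ≤ m * L := by rw [hL]; nlinarith
  have e3 : Real.exp (-1) * 2 ≤ 1 := by
    have := Real.exp_one_gt_d9
    rw [Real.exp_neg, inv_mul_le_iff₀ (Real.exp_pos _)]; linarith
  have hR : (n : ℝ) ^ (-(7 : ℝ)) = Real.exp (-7 * l) := by
    rw [Real.rpow_def_of_pos hn0]; congr 1; ring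
  have key : ∀ x : ℝ, x ≤ -7 * l - 2 → Real.exp x ≤ Real.exp (-7 * l) * (1 / 4) := by
    intro x hx
    calc Real.exp x ≤ Real.exp (-7 * l + (-1 + -1)) := Real.exp_le_exp.mpr (by linarith)
      _ = Real.exp (-7 * l) * (Real.exp (-1) * Real.exp (-1)) := by rw [Real.exp_add, Real.exp_add]
      _ ≤ _ := by
          apply mul_le_mul_of_nonneg_left _ (Real.exp_pos _).le
          have := Real.exp_pos (-1 : ℝ)
          nlinarith
  have t1 : n * (Real.exp (-(40 * L / 4)) * Real.sqrt 2 ^ m) ≤ Real.exp (-7 * l) * (1 / 4) := by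
    calc n * (Real.exp (-(40 * L / 4)) * Real.sqrt 2 ^ m)
        ≤ Real.exp l * (Real.exp (-(40 * L / 4)) * Real.exp (1 / 2) ^ m) := by
          rw [← hnl]; gcongr
      _ = Real.exp (l + (-(40 * L / 4) + m * (1 / 2))) := by
          rw [← Real.exp_nat_mul, ← Real.exp_add, ← Real.exp_add]
      _ ≤ _ := key _ (by rw [hL]; linarith)
  have t2 : Real.exp (-n) * Real.sqrt 2 ^ n ≤ Real.exp (-7 * l) * (1 / 4) := by
    calc Real.exp (-n) * Real.sqrt 2 ^ n ≤ Real.exp (-n) * Real.exp (1 / 2) ^ n := by gcongr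
      _ = Real.exp (-n + n * (1 / 2)) := by rw [← Real.exp_nat_mul, ← Real.exp_add]
      _ ≤ _ := key _ (by linarith)
  have t3 : (200 * n + 1) ^ m * (2 * Real.exp (-((n : ℝ) / 250))) ≤ Real.exp (-7 * l) * (1 / 2) := by
    have ha : (200 * (n : ℝ) + 1) ≤ Real.exp (2 * l) := by
      have : Real.exp (2 * l) = (n : ℝ) * n := by
        rw [two_mul, Real.exp_add, ← hnl]
      rw [this]; nlinarith
    calc (200 * n + 1) ^ m * (2 * Real.exp (-((n : ℝ) / 250)))
        ≤ Real.exp (2 * l) ^ m * (2 * Real.exp (-((n : ℝ) / 250))) := by gcongr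
      _ = 2 * Real.exp (m * (2 * l) + -((n : ℝ) / 250)) := by
          rw [← Real.exp_nat_mul, Real.exp_add]; ring
      _ ≤ 2 * (Real.exp (-7 * l) * (1 / 4)) := by
          apply mul_le_mul_of_nonneg_left _ (by norm_num)
          exact key _ (by linarith)
      _ = _ := by ring
  rw [hR]
  linarith

lemma t_num (T : ℕ) (X t : ℝ) (ht : 1 ≤ t) (hT : 50 * t ≤ T) (hX : t ≤ X) :
    (1 - 1 / 1000 : ℝ) ^ T + Real.exp (-X) ≤ 2 * (1 - 1 / 25 : ℝ) ^ t := by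
  have h1 : (1 - 1 / 1000 : ℝ) ^ T ≤ (1 - 1 / 25 : ℝ) ^ t := by
    rw [← Real.rpow_natCast]
    calc (1 - 1 / 1000 : ℝ) ^ (T : ℝ) ≤ (1 - 1 / 1000 : ℝ) ^ (50 * t) :=
          Real.rpow_le_rpow_of_exponent_ge (by norm_num) (by norm_num) hT
      _ = ((1 - 1 / 1000 : ℝ) ^ (50 : ℝ)) ^ t := by rw [Real.rpow_mul (by norm_num)]
      _ ≤ _ := by
        apply Real.rpow_le_rpow (by positivity) _ (by linarith)
        rw [show (50 : ℝ) = ((50 : ℕ) : ℝ) by norm_num, Real.rpow_natCast]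
        norm_num
  have h2 : Real.exp (-X) ≤ (1 - 1 / 25 : ℝ) ^ t := by
    calc Real.exp (-X) ≤ Real.exp (-1 * t) := Real.exp_le_exp.mpr (by linarith)
      _ = Real.exp (-1) ^ t := by rw [Real.exp_mul]
      _ ≤ _ := by
        apply Real.rpow_le_rpow (Real.exp_pos _).le _ (by linarith)
        have := Real.exp_neg_one_lt_d9
        linarith
  linarith

lemma big_num (m n s q : ℕ) (hm : 1 ≤ m) (hn : (201 : ℝ) ≤ n) (hs0 : 0 < s) (hsn : (s : ℝ) ≤ n)
    (hq : 16 ≤ q) (hs : 2 + 4 * (m * Real.log n) ≤ s) :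
    Real.exp 2 ≤ (q : ℝ) ^ s * (2 * (1 / (n : ℝ) ^ 2) / Real.sqrt (2 * Real.pi * s)) ^ m := by
  have hn0 : (0 : ℝ) < n := by linarith
  have hs0' : (0 : ℝ) < s := by exact_mod_cast hs0
  have h1 : Real.exp (-4 * Real.log n) ≤ 2 * (1 / (n : ℝ) ^ 2) / Real.sqrt (2 * Real.pi * s) := by
    have e : Real.exp (-4 * Real.log n) = 1 / (n : ℝ) ^ 4 := by
      rw [show -4 * Real.log n = -(((4 : ℕ) : ℝ) * Real.log n) by push_cast; ring, Real.exp_neg,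
        Real.exp_nat_mul, Real.exp_log hn0, one_div]
    have hsq : Real.sqrt (2 * Real.pi * s) ≤ 2 * (n : ℝ) ^ 2 := by
      rw [Real.sqrt_le_left (by positivity)]
      have := Real.pi_lt_four
      have hpi := Real.pi_pos
      calc 2 * Real.pi * s ≤ 2 * 4 * n := by gcongr
        _ ≤ (2 * (n : ℝ) ^ 2) ^ 2 := by
          have : (1 : ℝ) ≤ n := by linarith
          have h3 : (n : ℝ) * 2 ≤ n ^ 2 := by nlinarith
          nlinarith
    rw [e, le_div_iff₀ (by positivity)]
    calc 1 / (n : ℝ) ^ 4 * Real.sqrt (2 * Real.pi * s) ≤ 1 / (n : ℝ) ^ 4 * (2 * (n : ℝ) ^ 2) := by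
          gcongr
      _ = _ := by field_simp
  have h2 : Real.exp s ≤ (q : ℝ) ^ s := by
    have : Real.exp (s : ℝ) = Real.exp 1 ^ s := by rw [← Real.exp_nat_mul, mul_one]
    rw [this]
    apply pow_le_pow_left₀ (Real.exp_pos _).le
    have := Real.exp_one_lt_d9
    have : (16 : ℝ) ≤ q := by exact_mod_cast hq
    linarith
  calc Real.exp 2 ≤ Real.exp (s + m * (-4 * Real.log n)) := Real.exp_le_exp.mpr (by linarith)
    _ = Real.exp s * Real.exp (-4 * Real.log n) ^ m := by rw [Real.exp_add, Real.exp_nat_mul]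
    _ ≤ _ := by gcongr

set_option maxHeartbeats 2000000 in
lemma main_cols : ∃ C : ℝ, 200 ≤ C ∧
      ∀ m n : ℕ, 1 ≤ m → C * (m : ℝ) ^ (4.5 : ℝ) ≤ n →
      ∀ b : Fin m → ℝ, Real.sqrt (∑ j, min (b j) 0 ^ 2) ≤ n / 10 →
      ∀ t : ℝ, 1 ≤ t → t ≤ n / (C * (m : ℝ) ^ (2.5 : ℝ) * ((m : ℝ) + Real.log n) ^ 2) →
      (Measure.pi fun _ : Fin n => colM m)
        {ω | C * t * (m : ℝ) ^ (2.5 : ℝ) * ((m : ℝ) + Real.log n) ^ 2 / n ≤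
            IPGAP (Matrix.of fun i j => (ω j).1 i) b (fun j => (ω j).2)}
        ≤ ENNReal.ofReal (4 * (1 - 1 / 25) ^ t + (n : ℝ) ^ (-(7 : ℝ))) := by
  refine ⟨10 ^ 40, by norm_num, ?_⟩
  intro m n hm hn b hb t ht htn
  have hm1 : (1 : ℝ) ≤ m := by exact_mod_cast hm
  set C : ℝ := 10 ^ 40 with hC
  have hn201 : (201 : ℝ) ≤ n := by
    have : (1 : ℝ) ≤ (m : ℝ) ^ (4.5 : ℝ) := Real.one_le_rpow hm1 (by norm_num)
    have : C ≤ C * (m : ℝ) ^ (4.5 : ℝ) := le_mul_of_one_le_right (by positivity) this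
    have h2 : (201 : ℝ) ≤ C := by rw [hC]; norm_num
    linarith
  have hn0 : (0 : ℝ) < n := by linarith
  set r := Real.sqrt m with hr
  have hr1 : 1 ≤ r := by rw [hr]; exact Real.one_le_sqrt.mpr hm1
  have hr2 : r * r = m := Real.mul_self_sqrt (by linarith)
  have h25 : (m : ℝ) ^ (2.5 : ℝ) = m ^ 2 * r := by
    rw [hr, Real.sqrt_eq_rpow, ← Real.rpow_natCast, ← Real.rpow_add (by linarith)]; norm_num
  rw [h25] at htn ⊢
  set l := Real.log n with hl
  have hl0 : 0 ≤ l := Real.log_nonneg (by linarith)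
  set L : ℝ := m + l with hLdef
  have hL1 : 1 ≤ L := by linarith
  have hmL1 : 1 ≤ m * L := by nlinarith
  -- basic inequality
  have hbase : t * (C * (m ^ 2 * r) * L ^ 2) ≤ n := by
    rwa [le_div_iff₀ (by positivity)] at htn
  set V : ℝ := t * (m ^ 2 * r) * L ^ 2 with hV
  have hCV : C * V ≤ n := by rw [hV]; linarith
  have hmL2 : (m * L) ^ 2 ≤ V := by
    rw [hV]
    have : 1 ≤ t * r := by nlinarith
    calc (m * L) ^ 2 ≤ (m * L) ^ 2 * (t * r) := le_mul_of_one_le_right (by positivity) this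
      _ = _ := by ring
  have hmLV : m * L ≤ V := by nlinarith
  have hV1 : 1 ≤ V := by linarith
  have hmV : (m : ℝ) ^ 2 ≤ V := by nlinarith
  have hVn : V ≤ n / 10 ^ 40 := by
    rw [le_div_iff₀ (by positivity)]; linarith
  -- parameters
  set s : ℕ := ⌈10 ^ 10 * (m * L)⌉₊ with hs
  set q : ℕ := ⌈16 * r⌉₊ with hq
  set T : ℕ := ⌈50 * t⌉₊ with hT
  have hs1 : 10 ^ 10 * (m * L) ≤ s := Nat.le_ceil _
  have hs2 : (s : ℝ) ≤ 2 * 10 ^ 10 * (m * L) := by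
    have := (Nat.ceil_lt_add_one (show 0 ≤ 10 ^ 10 * (m * L) by positivity)).le
    linarith
  have hq1 : 16 * r ≤ q := Nat.le_ceil _
  have hq2 : (q : ℝ) ≤ 17 * r := by
    have := (Nat.ceil_lt_add_one (show 0 ≤ 16 * r by positivity)).le
    linarith
  have hT1 : 50 * t ≤ T := Nat.le_ceil _
  have hT2 : (T : ℝ) ≤ 51 * t := by
    have := (Nat.ceil_lt_add_one (show 0 ≤ 50 * t by positivity)).le
    linarith
  have hs0 : (1 : ℝ) ≤ s := by linarith
  have hq16 : 16 ≤ q := by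
    have : (16 : ℝ) ≤ q := by linarith
    exact_mod_cast this
  have hq16' : (16 : ℝ) ≤ q := by exact_mod_cast hq16
  set η : ℝ := 32 * (T * (s * q)) / n with hη
  have hη0 : 0 ≤ η := by positivity
  have hsη : s * η ≤ 32 * 51 * 17 * 4 * 10 ^ 20 * (V / n) := by
    calc s * η = 32 * (T * (s * s * q)) / n := by rw [hη]; ring
      _ ≤ 32 * ((51 * t) * ((2 * 10 ^ 10 * (m * L)) * (2 * 10 ^ 10 * (m * L)) * (17 * r))) / n := by
          gcongr
      _ = _ := by rw [hV]; ring
  have hVn' : V / n ≤ 1 / 10 ^ 40 := by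
    rw [div_le_div_iff₀ hn0 (by positivity)]; linarith
  have hVn0 : 0 ≤ V / n := by positivity
  have hsη1 : s * η ≤ 1 := by
    refine hsη.trans ?_
    norm_num at hVn' ⊢
    linarith
  have hη1 : η ≤ 1 := (le_mul_of_one_le_left hη0 hs0).trans hsη1
  set δ : ℝ := 1 / (n : ℝ) ^ 2 with hδ
  have hδ0 : 0 < δ := by positivity
  have hδ1 : δ ≤ 1 / n := by
    rw [hδ]
    exact one_div_le_one_div_of_le hn0 (le_self_pow₀ (by linarith) two_ne_zero)
  have hmmn : (m : ℝ) ^ 2 * 10 ^ 40 ≤ n := by linarith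
  have hmmn' : (m : ℝ) ^ 2 * δ ≤ 1 / 10 ^ 40 := by
    calc (m : ℝ) ^ 2 * δ ≤ m ^ 2 * (1 / n) := by gcongr
      _ = (m : ℝ) ^ 2 / n := by ring
      _ ≤ _ := by rw [div_le_div_iff₀ hn0 (by positivity)]; linarith
  have hmmn'' : (m : ℝ) ^ 2 * δ ≤ V / n := by
    calc (m : ℝ) ^ 2 * δ ≤ m ^ 2 * (1 / n) := by gcongr
      _ = (m : ℝ) ^ 2 / n := by ring
      _ ≤ _ := by gcongr
  have hmm2 : (m : ℝ) ≤ m ^ 2 := le_self_pow₀ hm1 two_ne_zero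
  have hmn : (m : ℝ) ≤ n := by linarith
  have hsn : (s : ℝ) ≤ n := by linarith
  have hδ1' : δ ≤ 1 := hδ1.trans (by rw [div_le_one hn0]; linarith)
  have hmδ : m * (2 * m * δ) ^ 2 ≤ 1 := by
    have h1 : (m : ℝ) * δ ≤ 1 / 10 ^ 40 := (mul_le_mul_of_nonneg_right hmm2 hδ0.le).trans hmmn'
    have : m * (2 * m * δ) ^ 2 = 4 * ((m ^ 2 * δ) * (m * δ)) := by ring
    rw [this]
    have h0 : 0 ≤ (m : ℝ) * δ := by positivity
    have h02 : 0 ≤ (m : ℝ) ^ 2 * δ := by positivity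
    have : (m : ℝ) ^ 2 * δ * (m * δ) ≤ 1 / 10 ^ 40 * (1 / 10 ^ 40) := by gcongr
    norm_num at this ⊢
    linarith
  have hmmL : (m : ℝ) ≤ m * L := le_mul_of_one_le_right (by linarith) hL1
  have hms : (m : ℝ) ≤ s := by linarith
  have hmlogs : m * Real.log s ≤ s := by
    have : Real.log s ≤ l := Real.log_le_log (by linarith) hsn
    have : m * Real.log s ≤ m * L := by gcongr; linarith
    linarith
  have hy : ∀ y : Fin m → ℝ, ∑ j, y j ^ 2 ≤
      (1 + 40000) * (4 * (m * (40 * L) / 4 + (1 + 40000) + m * (2 * m * δ) ^ 2 + (s * η) ^ 2)) →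
      1 / 1000 ≤ (poolM m s q).real (⋃ f : Fin s → Fin q, selE y δ f) := by
    intro y hy
    refine pool m s q hm ?_ ?_ hmlogs y δ hδ0 ?_ ?_ ?_
    · have : (m : ℝ) ≤ s := hms
      exact_mod_cast this
    · have : (256 : ℝ) * m ≤ q ^ 2 := by
        calc (256 : ℝ) * m = (16 * r) ^ 2 := by rw [← hr2]; ring
          _ ≤ (q : ℝ) ^ 2 := by gcongr
      exact_mod_cast this
    · refine hy.trans ?_
      have : (s * η) ^ 2 ≤ 1 := by
        have : 0 ≤ s * η := by positivity
        exact pow_le_one₀ this hsη1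
      linarith
    · have : δ ^ 2 ≤ 1 := pow_le_one₀ hδ0.le hδ1'
      have : (m : ℝ) * δ ^ 2 ≤ m * 1 := by gcongr
      linarith
    · apply big_num m n s q hm hn201 _ hsn hq16
      · have : m * l ≤ m * L := by gcongr; linarith
        linarith
      · have : (0 : ℝ) < s := by linarith
        exact_mod_cast this
  have hTs : t ≤ T * (s * q) := by
    have : (1 : ℝ) ≤ s * q := one_le_mul_of_one_le_of_one_le hs0 (by linarith)
    have : (T : ℝ) ≤ T * (s * q) := le_mul_of_one_le_right (by positivity) this
    linarith
  have hPT : (1 - 1 / 1000 : ℝ) ^ T + Real.exp (T * (s * q) - η * n / 16) ≤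
      2 * (1 - 1 / 25 : ℝ) ^ t := by
    have : T * (s * q) - η * n / 16 = -(T * (s * q) : ℝ) := by
      rw [hη]; field_simp; ring
    rw [this]
    exact t_num T _ t ht hT1 hTs
  have hP0 : (0 : ℝ) ≤ 2 * (1 - 1 / 25 : ℝ) ^ t := by
    have : (0 : ℝ) ≤ 1 - 1 / 25 := by norm_num
    positivity
  have hgood := good_bound (n := n) b (40 * L) 40000 s q T δ η (2 * (1 - 1 / 25 : ℝ) ^ t)
    (by positivity) hP0 hη0 hη1 hδ0.le hy hPT
  have hreg := reg_prob (n := n) (m := m) (40 * L)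
  have hfail := fail_num m n hm L rfl hn201 (by linarith)
  have hn1 : 1 ≤ n := by
    have : (1 : ℝ) ≤ n := by linarith
    exact_mod_cast this
  have hmnn : m ≤ n ^ 2 := by
    have h1 : m ≤ n := by exact_mod_cast hmn
    exact h1.trans (Nat.le_self_pow two_ne_zero n)
  have hrg := reg_good (m := m) hn1 (40 * L)
    (by have : (n : ℝ) ≤ n ^ 2 := le_self_pow₀ (by linarith) two_ne_zero
        linarith) hmnn b hb
  have hcost : (2 * s * η + 4 * m ^ 2 * δ) * Real.sqrt (1 + 40000) < C * t * (m ^ 2 * r) * L ^ 2 / n := by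
    have e : C * t * (m ^ 2 * r) * L ^ 2 / n = C * (V / n) := by rw [hV]; ring
    have hsq : Real.sqrt (1 + 40000) ≤ 201 := by
      rw [Real.sqrt_le_left (by norm_num)]; norm_num
    have hVpos : 0 < V / n := by positivity
    rw [e]
    calc (2 * s * η + 4 * m ^ 2 * δ) * Real.sqrt (1 + 40000)
        ≤ (2 * s * η + 4 * m ^ 2 * δ) * 201 := by gcongr
      _ = 402 * (s * η) + 804 * (m ^ 2 * δ) := by ring
      _ < C * (V / n) := by
        rw [hC]; linarith
  have hsub : {ω : Fin n → Col m | C * t * (m ^ 2 * r) * L ^ 2 / n ≤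
            IPGAP (Matrix.of fun i j => (ω j).1 i) b (fun j => (ω j).2)} ⊆
      {ω | ω ∈ Gset b (40 * L) 40000 ∧ (2 * s * η + 4 * m ^ 2 * δ) * Real.sqrt (1 + 40000) <
        IPGAP (Matrix.of fun i j => (ω j).1 i) b (fun j => (ω j).2)} ∪ (Reg (40 * L))ᶜ := by
    intro ω hω
    by_cases h : ω ∈ Reg (40 * L)
    · exact Or.inl ⟨hrg ω h, lt_of_lt_of_le hcost hω⟩
    · exact Or.inr h
  refine (measure_mono hsub).trans ((measure_union_le _ _).trans ((add_le_add hgood hreg).trans ?_))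
  rw [← ENNReal.ofReal_add hP0 (by positivity)]
  apply ENNReal.ofReal_le_ofReal
  linarith

lemma main_final : ∃ C : ℝ, 200 ≤ C ∧
      ∀ m n : ℕ, 1 ≤ m → C * (m : ℝ) ^ (4.5 : ℝ) ≤ n →
      ∀ b : Fin m → ℝ, Real.sqrt (∑ j, min (b j) 0 ^ 2) ≤ n / 10 →
      ∀ t : ℝ, 1 ≤ t → t ≤ n / (C * (m : ℝ) ^ (2.5 : ℝ) * ((m : ℝ) + Real.log n) ^ 2) →
      ((Measure.pi fun _ : Fin m × Fin n => gaussianReal 0 1).prod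
          (Measure.pi fun _ : Fin n => gaussianReal 0 1))
        {ω | C * t * (m : ℝ) ^ (2.5 : ℝ) * ((m : ℝ) + Real.log n) ^ 2 / n ≤
            IPGAP (Matrix.of fun i j => ω.1 (i, j)) b ω.2}
        ≤ ENNReal.ofReal (4 * (1 - 1 / 25) ^ t + (n : ℝ) ^ (-(7 : ℝ))) := by
  obtain ⟨C, hC, h⟩ := main_cols
  refine ⟨C, hC, fun m n hm hn b hb t ht htn => ?_⟩
  refine le_trans ?_ (h m n hm hn b hb t ht htn)
  have hp := mp_cols m n
  set S : Set (Fin n → Col m) := {ω | C * t * (m : ℝ) ^ (2.5 : ℝ) * ((m : ℝ) + Real.log n) ^ 2 / n ≤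
            IPGAP (Matrix.of fun i j => (ω j).1 i) b (fun j => (ω j).2)} with hS
  rw [← measure_toMeasurable S, ← hp.measure_preimage (measurableSet_toMeasurable _ _).nullMeasurableSet]
  apply measure_mono
  intro ω hω
  apply subset_toMeasurable
  exact hω

end GapProof

/-- There is an absolute constant `C ≥ 200` so that for all `m ≥ 1`,
`n ≥ C·m^{4.5}`, `b` with `‖b⁻‖₂ ≤ n/10`, and `1 ≤ t ≤ n/(C·m^{2.5}(m + log n)²)`, with `A, c`
having i.i.d. `N(0,1)` entries,
`P[IPGAP(A,b,c) ≥ C·t·m^{2.5}(m + log n)²/n] ≤ 4·(1 − 1/25)^t + n^{−7}`. -/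
theorem stmt_0 :
    ∃ C : ℝ, 200 ≤ C ∧
      ∀ m n : ℕ, 1 ≤ m → C * (m : ℝ) ^ (4.5 : ℝ) ≤ n →
      ∀ b : Fin m → ℝ, Real.sqrt (∑ j, min (b j) 0 ^ 2) ≤ n / 10 →
      ∀ t : ℝ, 1 ≤ t → t ≤ n / (C * (m : ℝ) ^ (2.5 : ℝ) * ((m : ℝ) + Real.log n) ^ 2) →
      ((Measure.pi fun _ : Fin m × Fin n => gaussianReal 0 1).prod
          (Measure.pi fun _ : Fin n => gaussianReal 0 1))
        {ω | C * t * (m : ℝ) ^ (2.5 : ℝ) * ((m : ℝ) + Real.log n) ^ 2 / n ≤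
            IPGAP (Matrix.of fun i j => ω.1 (i, j)) b ω.2}
        ≤ ENNReal.ofReal (4 * (1 - 1 / 25) ^ t + (n : ℝ) ^ (-(7 : ℝ))) := by
  exact GapProof.main_final
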